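/- Let R be a commutative Noetherian ring and a, b ideals of R such that R/b has finite dimension d. Then for any finitely generated R-module M with Assh_R M = Assh_R(R/b), one has Supp_R H^d_a(M) = P_{a,R/b}; in particular, P_{a,R/b} is a finite set. -/

import Mathlib

/- Common definitions: local cohomology modules, cohomological dimension, module dimension,
secondary representations and attached primes. -/

open CategoryTheory TensorProduct

/-- The `i`-th local cohomology module `H^i_a(M)`, as a type with its `R`-module structure. -/
noncomputable def TopLC (R : Type) [CommRing R] (a : Ideal R) (i : ℕ)
    (M : Type) [AddCommGroup M] [Module R M] : Type :=
  ((localCohomology a i).obj (ModuleCat.of R M))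

noncomputable instance (R : Type) [CommRing R] (a : Ideal R) (i : ℕ)
    (M : Type) [AddCommGroup M] [Module R M] : AddCommGroup (TopLC R a i M) :=
  inferInstanceAs (AddCommGroup ((localCohomology a i).obj (ModuleCat.of R M)))

noncomputable instance (R : Type) [CommRing R] (a : Ideal R) (i : ℕ)
    (M : Type) [AddCommGroup M] [Module R M] : Module R (TopLC R a i M) :=
  inferInstanceAs (Module R ((localCohomology a i).obj (ModuleCat.of R M)))

/-- The cohomological dimension `cd_R(a, M) = sup { i | H^i_a(M) ≠ 0 }`,
with value `⊥` if all local cohomology modules vanish. -/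
noncomputable def cohDim (R : Type) [CommRing R] (a : Ideal R)
    (M : Type) [AddCommGroup M] [Module R M] : WithBot ℕ∞ :=
  sSup {n : WithBot ℕ∞ | ∃ i : ℕ, n = (i : ℕ) ∧ Nontrivial (TopLC R a i M)}

/-- The (Krull) dimension of a module, i.e. the Krull dimension of its support. -/
noncomputable def moduleDim (R : Type) [CommRing R]
    (M : Type) [AddCommGroup M] [Module R M] : WithBot ℕ∞ :=
  Order.krullDim (Module.support R M)

/-- `Assh_R M`: the associated primes `p` of `M` with `dim R/p = dim M`. -/
noncomputable def Assh (R : Type) [CommRing R]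
    (M : Type) [AddCommGroup M] [Module R M] : Set (Ideal R) :=
  { p | p ∈ associatedPrimes R M ∧ ringKrullDim (R ⧸ p) = moduleDim R M }

/-- A submodule `S` is secondary if `S ≠ 0` and every `r : R` acts on `S` either
surjectively or nilpotently. -/
def IsSecondarySub (R : Type) [CommRing R] {M : Type} [AddCommGroup M] [Module R M]
    (S : Submodule R M) : Prop :=
  S ≠ ⊥ ∧ ∀ r : R, (∀ m ∈ S, ∃ s ∈ S, r • s = m) ∨ (∃ n : ℕ, ∀ m ∈ S, r ^ n • m = 0)

/-- A module is representable if it is the (finite) sum of secondary submodules. -/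
def IsRepresentable (R : Type) [CommRing R] (M : Type) [AddCommGroup M] [Module R M] : Prop :=
  ∃ (n : ℕ) (S : Fin n → Submodule R M), (∀ i, IsSecondarySub R (S i)) ∧ (⨆ i, S i) = ⊤

/-- A minimal secondary representation: secondary submodules summing to the whole module,
with pairwise distinct attached primes, none contained in the sum of the others. -/
def IsMinimalRep (R : Type) [CommRing R] {M : Type} [AddCommGroup M] [Module R M]
    {n : ℕ} (S : Fin n → Submodule R M) : Prop :=
  (∀ i, IsSecondarySub R (S i)) ∧ (⨆ i, S i) = ⊤ ∧
    (Function.Injective fun i => (S i).annihilator.radical) ∧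
    ∀ j, ¬ (S j ≤ ⨆ i ∈ ({j}ᶜ : Set (Fin n)), S i)

/-- The attached primes of a module: the radicals of the annihilators of the terms of a
minimal secondary representation. -/
def AttachedPrimes (R : Type) [CommRing R] (M : Type) [AddCommGroup M] [Module R M] :
    Set (Ideal R) :=
  { p | ∃ (n : ℕ) (S : Fin n → Submodule R M), IsMinimalRep R S ∧
      ∃ i, p = (S i).annihilator.radical }

/-- `stab b N = ⟨b⟩N = ⋂ₙ bⁿN`. -/
def stab {R M : Type} [CommRing R] [AddCommGroup M] [Module R M]
    (b : Ideal R) (N : Submodule R M) : Submodule R M :=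
  ⨅ n : ℕ, b ^ n • N

/-- The set `P_{a,M}` of primes `p ⊇ Ann M + a` for which there is a prime `p*` in the
support of the completed localization `(M_p)^` over `(R_p)^` with `dim (R_p)^/p* = d`
and `dim (R_p)^/(a (R_p)^ + p*) = 0`. -/
noncomputable def Pset (R : Type) [CommRing R] (a : Ideal R)
    (M : Type) [AddCommGroup M] [Module R M] (d : ℕ) : Set (PrimeSpectrum R) :=
  fun p =>
    Module.annihilator R M ⊔ a ≤ p.asIdeal ∧
    ∃ q : PrimeSpectrum (AdicCompletion
        (IsLocalRing.maximalIdeal (Localization.AtPrime p.asIdeal))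
        (Localization.AtPrime p.asIdeal)),
      q ∈ Module.support
          (AdicCompletion (IsLocalRing.maximalIdeal (Localization.AtPrime p.asIdeal))
            (Localization.AtPrime p.asIdeal))
          (AdicCompletion (IsLocalRing.maximalIdeal (Localization.AtPrime p.asIdeal))
            (LocalizedModule p.asIdeal.primeCompl M)) ∧
      ringKrullDim (AdicCompletion (IsLocalRing.maximalIdeal (Localization.AtPrime p.asIdeal))
          (Localization.AtPrime p.asIdeal) ⧸ q.asIdeal) = (d : WithBot ℕ∞) ∧
      ringKrullDim (AdicCompletion (IsLocalRing.maximalIdeal (Localization.AtPrime p.asIdeal))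
          (Localization.AtPrime p.asIdeal) ⧸
          (Ideal.map (algebraMap (Localization.AtPrime p.asIdeal)
              (AdicCompletion (IsLocalRing.maximalIdeal (Localization.AtPrime p.asIdeal))
                (Localization.AtPrime p.asIdeal)))
            (Ideal.map (algebraMap R (Localization.AtPrime p.asIdeal)) a) ⊔ q.asIdeal)) =
        (0 : WithBot ℕ∞)

set_option autoImplicit false
open Module Opposite
open scoped Pointwise

/-- A family of functors on the category of modules over `A` having the formal properties of
local cohomology with support in the ideal `I`: linearity, a long exact sequence, the degree zero
part is the `I`-torsion, and the values are `I`-torsion and vanish in positive degrees on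
`I`-torsion modules. -/
structure LocalCohomologyTheory (A : Type) [CommRing A] (I : Ideal A) where
  /-- The cohomology modules. -/
  H : ℕ → ∀ (N : Type) [AddCommGroup N] [Module A N], ModuleCat.{0} A
  /-- Functoriality. -/
  map : ∀ (i : ℕ) {N N' : Type} [AddCommGroup N] [Module A N] [AddCommGroup N'] [Module A N']
    (_ : N →ₗ[A] N'), H i N →ₗ[A] H i N'
  map_id : ∀ (i : ℕ) (N : Type) [AddCommGroup N] [Module A N],
    map i (LinearMap.id : N →ₗ[A] N) = LinearMap.id
  map_comp : ∀ (i : ℕ) {N₁ N₂ N₃ : Type} [AddCommGroup N₁] [Module A N₁] [AddCommGroup N₂]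
    [Module A N₂] [AddCommGroup N₃] [Module A N₃] (f : N₁ →ₗ[A] N₂) (g : N₂ →ₗ[A] N₃),
    map i (g ∘ₗ f) = map i g ∘ₗ map i f
  map_smul : ∀ (i : ℕ) {N N' : Type} [AddCommGroup N] [Module A N] [AddCommGroup N'] [Module A N']
    (r : A) (f : N →ₗ[A] N'), map i (r • f) = r • map i f
  exact_map : ∀ (i : ℕ) {N₁ N₂ N₃ : Type} [AddCommGroup N₁] [Module A N₁] [AddCommGroup N₂]
    [Module A N₂] [AddCommGroup N₃] [Module A N₃] {f : N₁ →ₗ[A] N₂} {g : N₂ →ₗ[A] N₃},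
    Function.Injective f → Function.Exact f g → Function.Surjective g →
    Function.Exact (map i f) (map i g)
  exists_connecting : ∀ (i : ℕ) {N₁ N₂ N₃ : Type} [AddCommGroup N₁] [Module A N₁] [AddCommGroup N₂]
    [Module A N₂] [AddCommGroup N₃] [Module A N₃] {f : N₁ →ₗ[A] N₂} {g : N₂ →ₗ[A] N₃},
    Function.Injective f → Function.Exact f g → Function.Surjective g →
    ∃ δ : H i N₃ →ₗ[A] H (i + 1) N₁,
      Function.Exact (map i g) δ ∧ Function.Exact δ (map (i + 1) f)
  map_zero_injective : ∀ {N N' : Type} [AddCommGroup N] [Module A N] [AddCommGroup N'] [Module A N']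
    (f : N →ₗ[A] N'), Function.Injective f → Function.Injective (map 0 f)
  exists_embedding : ∀ (N : Type) [AddCommGroup N] [Module A N],
    ∃ ι : H 0 N →ₗ[A] N, Function.Injective ι ∧
      ∀ m : N, (∃ n : ℕ, ∀ r ∈ I ^ n, r • m = 0) → m ∈ LinearMap.range ι
  torsion : ∀ (i : ℕ) (N : Type) [AddCommGroup N] [Module A N] (z : H i N),
    ∃ n : ℕ, ∀ r ∈ I ^ n, r • z = 0
  vanishing : ∀ (i : ℕ) (N : Type) [AddCommGroup N] [Module A N],
    (∀ m : N, ∃ n : ℕ, ∀ r ∈ I ^ n, r • m = 0) → Subsingleton (H (i + 1) N)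

theorem Module.Finite.devissage {A : Type} [CommRing A] [IsNoetherianRing A] (d : WithBot ℕ∞)
    {motive : (N : Type) → [AddCommGroup N] → [Module A N] → Prop}
    (subsingleton : ∀ (N : Type) [AddCommGroup N] [Module A N] [Subsingleton N], motive N)
    (exact : ∀ (N₁ N₂ N₃ : Type) [AddCommGroup N₁] [Module A N₁] [Module.Finite A N₁]
      [AddCommGroup N₂] [Module A N₂] [Module.Finite A N₂] [AddCommGroup N₃] [Module A N₃]
      [Module.Finite A N₃] (f : N₁ →ₗ[A] N₂) (g : N₂ →ₗ[A] N₃), Function.Injective f →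
      Function.Surjective g → Function.Exact f g → supportDim A N₂ < d →
      motive N₁ → motive N₃ → motive N₂)
    (quotient : ∀ (P : Ideal A) [P.IsPrime], ringKrullDim (A ⧸ P) < d → motive (A ⧸ P))
    (N : Type) [AddCommGroup N] [Module A N] [Module.Finite A N] (hN : supportDim A N < d) :
    motive N := by
  revert hN
  refine IsNoetherianRing.induction_on_isQuotientEquivQuotientPrime A (M := N) inferInstance
    (motive := fun N _ _ _ => supportDim A N < d → motive N) ?_ ?_ ?_
  · intro N _ _ _ _ _
    exact subsingleton N
  · intro N _ _ _ p e hN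
    have hp : supportDim A (A ⧸ p.1) < d := by rwa [← supportDim_eq_of_equiv e]
    refine exact (A ⧸ p.1) N PUnit e.symm.toLinearMap 0 e.symm.injective
      (Function.surjective_to_subsingleton _)
      ((LinearMap.exact_zero_iff_surjective _ _).2 e.symm.surjective) hN
      (quotient p.1 ?_) (subsingleton _)
    rwa [← supportDim_quotient_eq_ringKrullDim]
  · intro N₁ _ _ _ N₂ _ _ _ N₃ _ _ _ f g hf hg hfg h₁ h₃ hN
    exact exact N₁ N₂ N₃ f g hf hg hfg hN
      (h₁ ((supportDim_le_of_injective f hf).trans_lt hN))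
      (h₃ ((supportDim_le_of_surjective g hg).trans_lt hN))

theorem Ideal.Quotient.isSMulRegular_of_notMem {A : Type} [CommRing A] {P : Ideal A} [P.IsPrime]
    {x : A} (hx : x ∉ P) : IsSMulRegular (A ⧸ P) x := by
  intro a b hab
  have hx' : (Ideal.Quotient.mk P x) ≠ 0 := by rwa [Ne, Ideal.Quotient.eq_zero_iff_mem]
  have : Ideal.Quotient.mk P x * a = Ideal.Quotient.mk P x * b := by
    simpa [Algebra.smul_def] using hab
  exact mul_left_cancel₀ hx' this

theorem supportDim_quotSMulTop_lt {A : Type} [CommRing A] {N : Type} [AddCommGroup N] [Module A N]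
    [Module.Finite A N] {n : ℕ} (hN : supportDim A N < (n + 1 : ℕ)) {x : A}
    (hx : ∀ p ∈ (Module.annihilator A N).minimalPrimes, x ∉ p) :
    supportDim A (QuotSMulTop x N) < n := by
  have h := (supportDim_quotSMulTop_succ_le_of_notMem_minimalPrimes hx).trans_lt hN
  push_cast at h
  exact lt_of_add_lt_add_right h

theorem exact_lsmul_mkQ {A : Type} [CommRing A] {N : Type} [AddCommGroup N] [Module A N] (x : A) :
    Function.Exact (LinearMap.lsmul A N x) (Submodule.mkQ (x • (⊤ : Submodule A N))) := by
  intro y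
  simp [Submodule.mem_smul_pointwise_iff_exists]

namespace LocalCohomologyTheory

variable {A : Type} [CommRing A] {I : Ideal A} (T : LocalCohomologyTheory A I)
variable {N : Type} [AddCommGroup N] [Module A N]

theorem map_lsmul (i : ℕ) (x : A) (z : T.H i N) :
    T.map i (LinearMap.lsmul A N x) z = x • z := by
  have : LinearMap.lsmul A N x = x • LinearMap.id := by ext; simp
  rw [this, T.map_smul, T.map_id]; rfl

theorem subsingleton_of_subsingleton (i : ℕ) [Subsingleton N] : Subsingleton (T.H i N) := by
  refine subsingleton_of_forall_eq 0 fun z => ?_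
  have h : (LinearMap.id : N →ₗ[A] N) = (0 : A) • LinearMap.id := by
    ext; exact Subsingleton.elim _ _
  have h2 := T.map_id i N
  rw [h, T.map_smul, T.map_id] at h2
  have h3 := LinearMap.congr_fun h2 z
  rw [LinearMap.smul_apply, zero_smul] at h3
  exact h3.symm

theorem mem_smul_of_annihilates (i : ℕ) {x : A} (hx : ∀ m : N, x • m = 0) (z : T.H i N) :
    x • z = 0 := by
  have h : (x • LinearMap.id : N →ₗ[A] N) = (0 : A) • LinearMap.id := by
    ext m; simpa using hx m
  have h2 : x • T.map i (LinearMap.id : N →ₗ[A] N) = (0 : A) • T.map i LinearMap.id := by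
    rw [← T.map_smul, ← T.map_smul, h]
  have h3 := LinearMap.congr_fun h2 z
  rwa [T.map_id, LinearMap.smul_apply, LinearMap.smul_apply, zero_smul] at h3

theorem exists_pow_smul_eq_zero (i : ℕ) {x : A} (hx : x ∈ I) (z : T.H i N) :
    ∃ n : ℕ, x ^ n • z = 0 := by
  obtain ⟨n, hn⟩ := T.torsion i N z
  exact ⟨n, hn _ (Ideal.pow_mem_pow hx n)⟩

theorem subsingleton_of_smul_injective (i : ℕ) {x : A} (hx : x ∈ I)
    (h : ∀ z : T.H i N, x • z = 0 → z = 0) : Subsingleton (T.H i N) := by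
  refine subsingleton_of_forall_eq 0 fun z => ?_
  obtain ⟨n, hn⟩ := T.exists_pow_smul_eq_zero i hx z
  induction n with
  | zero => simpa using hn
  | succ n ih => exact ih (h _ (by rw [smul_smul, ← pow_succ']; exact hn))

theorem subsingleton_quotient_of_le (i : ℕ) {P : Ideal A} (h : I ≤ P) :
    Subsingleton (T.H (i + 1) (A ⧸ P)) := by
  refine T.vanishing i _ fun m => ⟨1, fun r hr => ?_⟩
  obtain ⟨m, rfl⟩ := Ideal.Quotient.mk_surjective m
  rw [pow_one] at hr
  rw [Algebra.smul_def, Ideal.Quotient.algebraMap_eq, ← map_mul, Ideal.Quotient.eq_zero_iff_mem]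
  exact P.mul_mem_right _ (h hr)

theorem subsingleton_of_exact (i : ℕ) {N₁ N₃ : Type} [AddCommGroup N₁] [Module A N₁]
    [AddCommGroup N₃] [Module A N₃] {f : N₁ →ₗ[A] N} {g : N →ₗ[A] N₃}
    (hf : Function.Injective f) (hfg : Function.Exact f g) (hg : Function.Surjective g)
    (h₁ : Subsingleton (T.H i N₁)) (h₃ : Subsingleton (T.H i N₃)) : Subsingleton (T.H i N) := by
  refine subsingleton_of_forall_eq 0 fun z => ?_
  obtain ⟨w, rfl⟩ := (T.exact_map i hf hfg hg z).1 (Subsingleton.elim _ _)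
  rw [Subsingleton.elim w 0, map_zero]

theorem map_surjective_of_exact (i : ℕ) {N₁ N₃ : Type} [AddCommGroup N₁] [Module A N₁]
    [AddCommGroup N₃] [Module A N₃] {f : N₁ →ₗ[A] N} {g : N →ₗ[A] N₃}
    (hf : Function.Injective f) (hfg : Function.Exact f g) (hg : Function.Surjective g)
    (h₁ : Subsingleton (T.H (i + 1) N₁)) : Function.Surjective (T.map i g) := by
  obtain ⟨δ, h1, -⟩ := T.exists_connecting i hf hfg hg
  exact fun z => (h1 z).1 (Subsingleton.elim _ _)

theorem map_mono_surjective_of_exact (i : ℕ) {N₁ N₃ : Type} [AddCommGroup N₁] [Module A N₁]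
    [AddCommGroup N₃] [Module A N₃] {f : N₁ →ₗ[A] N} {g : N →ₗ[A] N₃}
    (hf : Function.Injective f) (hfg : Function.Exact f g) (hg : Function.Surjective g)
    (h₃ : Subsingleton (T.H i N₃)) : Function.Surjective (T.map i f) :=
  fun z => (T.exact_map i hf hfg hg z).1 (Subsingleton.elim _ _)

/-- The long exact sequence attached to a regular element. -/
theorem exists_connecting_of_isSMulRegular (i : ℕ) {x : A} (hx : IsSMulRegular N x) :
    ∃ δ : T.H i (QuotSMulTop x N) →ₗ[A] T.H (i + 1) N,
      Function.Exact (T.map i (Submodule.mkQ (x • (⊤ : Submodule A N)))) δ ∧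
      ∀ z, x • z = 0 ↔ z ∈ Set.range δ := by
  obtain ⟨δ, h1, h2⟩ := T.exists_connecting i (f := LinearMap.lsmul A N x) hx
    (exact_lsmul_mkQ x) (Submodule.mkQ_surjective _)
  refine ⟨δ, h1, fun z => ?_⟩
  rw [← T.map_lsmul]
  exact h2 z

theorem subsingleton_of_quotSMulTop (i : ℕ) {x : A} (hx : IsSMulRegular N x) (hxI : x ∈ I)
    (h : Subsingleton (T.H i (QuotSMulTop x N))) : Subsingleton (T.H (i + 1) N) := by
  obtain ⟨δ, -, h2⟩ := T.exists_connecting_of_isSMulRegular i hx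
  refine T.subsingleton_of_smul_injective (i + 1) hxI fun z hz => ?_
  obtain ⟨w, rfl⟩ := (h2 z).1 hz
  rw [Subsingleton.elim w 0, map_zero]

theorem subsingleton_zero_of_isSMulRegular {x : A} (hx : IsSMulRegular N x) (hxI : x ∈ I) :
    Subsingleton (T.H 0 N) := by
  obtain ⟨ι, hι, -⟩ := T.exists_embedding N
  refine T.subsingleton_of_smul_injective 0 hxI fun z hz => hι ?_
  rw [map_zero]
  refine hx ?_
  change x • ι z = x • (0 : N)
  rw [← _root_.map_smul, hz, map_zero, smul_zero]

variable [IsNoetherianRing A]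

/-- Grothendieck's vanishing theorem. -/
theorem subsingleton_of_supportDim_lt (n : ℕ) : ∀ (N : Type) [AddCommGroup N] [Module A N]
    [Module.Finite A N], supportDim A N < n → ∀ i, n ≤ i → Subsingleton (T.H i N) := by
  induction n with
  | zero =>
    intro N _ _ _ hN i _
    have : Subsingleton N := by
      rw [← supportDim_eq_bot_iff_subsingleton A]
      exact WithBot.lt_coe_bot.1 hN
    exact T.subsingleton_of_subsingleton i
  | succ n ih =>
    intro N _ _ _ hN i hi
    obtain ⟨i, rfl⟩ : ∃ j, i = j + 1 := ⟨i - 1, by omega⟩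
    refine Module.Finite.devissage _ (motive := fun N _ _ => Subsingleton (T.H (i + 1) N))
      ?_ ?_ ?_ N hN
    · intro N _ _ _
      exact T.subsingleton_of_subsingleton _
    · intro N₁ N₂ N₃ _ _ _ _ _ _ _ _ _ f g hf hg hfg _ h₁ h₃
      exact T.subsingleton_of_exact _ hf hfg hg h₁ h₃
    · intro P _ hP
      by_cases hIP : I ≤ P
      · exact T.subsingleton_quotient_of_le i hIP
      · obtain ⟨x, hxI, hxP⟩ := SetLike.not_le_iff_exists.1 hIP
        have hreg := Ideal.Quotient.isSMulRegular_of_notMem hxP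
        refine T.subsingleton_of_quotSMulTop i hreg hxI (ih _ ?_ i (by omega))
        refine supportDim_quotSMulTop_lt ?_ fun p hp => hreg.notMem_of_mem_minimalPrimes hp
        rwa [supportDim_quotient_eq_ringKrullDim]

theorem smul_surjective_of_supportDim_quotSMulTop_lt [Module.Finite A N] {d : ℕ}
    (hN : supportDim A N < (d + 1 : ℕ)) {y : A} (hy : supportDim A (QuotSMulTop y N) < d) :
    Function.Surjective fun z : T.H d N => y • z := by
  let f : N →ₗ[A] N := LinearMap.lsmul A N y
  have hr : LinearMap.range f = y • (⊤ : Submodule A N) := by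
    ext z; simp [f, Submodule.mem_smul_pointwise_iff_exists]
  have h1 : Function.Surjective (T.map d f.rangeRestrict) := by
    refine T.map_surjective_of_exact d (f := (LinearMap.ker f).subtype)
      (Submodule.subtype_injective _) ?_ f.surjective_rangeRestrict ?_
    · rw [LinearMap.exact_iff]; simp
    · exact T.subsingleton_of_supportDim_lt (d + 1) _
        ((supportDim_le_of_injective _ (Submodule.subtype_injective _)).trans_lt hN) _ le_rfl
  have h2 : Function.Surjective (T.map d (LinearMap.range f).subtype) := by
    refine T.map_mono_surjective_of_exact d (g := (LinearMap.range f).mkQ)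
      (Submodule.subtype_injective _) ?_ (Submodule.mkQ_surjective _) ?_
    · rw [LinearMap.exact_iff]; simp
    · rw [hr]
      exact T.subsingleton_of_supportDim_lt d _ hy _ le_rfl
  intro z
  obtain ⟨w, hw⟩ := h2 z
  obtain ⟨v, rfl⟩ := h1 w
  refine ⟨v, ?_⟩
  simp only
  rw [← hw, ← LinearMap.comp_apply, ← T.map_comp, ← T.map_lsmul]
  rfl

theorem smul_surjective_quotient {P : Ideal A} [P.IsPrime] {d : ℕ}
    (hP : ringKrullDim (A ⧸ P) < (d + 1 : ℕ)) {y : A} (hy : y ∉ P) :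
    Function.Surjective fun z : T.H d (A ⧸ P) => y • z := by
  have hreg := Ideal.Quotient.isSMulRegular_of_notMem hy
  rw [← supportDim_quotient_eq_ringKrullDim] at hP
  exact T.smul_surjective_of_supportDim_quotSMulTop_lt hP
    (supportDim_quotSMulTop_lt hP fun p hp => hreg.notMem_of_mem_minimalPrimes hp)

omit [IsNoetherianRing A] in
theorem support_subset_of_exact (i : ℕ) {N₁ N₃ : Type} [AddCommGroup N₁] [Module A N₁]
    [AddCommGroup N₃] [Module A N₃] {f : N₁ →ₗ[A] N} {g : N →ₗ[A] N₃}
    (hf : Function.Injective f) (hfg : Function.Exact f g) (hg : Function.Surjective g) :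
    Module.support A (T.H i N) ⊆ Module.support A (T.H i N₁) ∪ Module.support A (T.H i N₃) := by
  have h := Module.support_of_exact
    (f := (LinearMap.range (T.map i f)).subtype) (g := (T.map i g).rangeRestrict) ?_
    (Submodule.subtype_injective _) (T.map i g).surjective_rangeRestrict
  · rw [h]
    exact Set.union_subset_union
      (Module.support_subset_of_surjective _ (T.map i f).surjective_rangeRestrict)
      (Module.support_subset_of_injective _ (Submodule.subtype_injective _))
  · have := (LinearMap.exact_iff).1 (T.exact_map i hf hfg hg)
    rw [LinearMap.exact_iff, LinearMap.ker_rangeRestrict, this, Submodule.range_subtype]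

omit [IsNoetherianRing A] in
theorem support_subset_of_isSMulRegular (i : ℕ) {x : A} (hx : IsSMulRegular N x) (hxI : x ∈ I) :
    Module.support A (T.H (i + 1) N) ⊆ Module.support A (T.H i (QuotSMulTop x N)) := by
  obtain ⟨δ, -, h2⟩ := T.exists_connecting_of_isSMulRegular i hx
  intro p hp
  rw [Module.mem_support_iff'] at hp
  obtain ⟨z, hz⟩ := hp
  obtain ⟨n, hn⟩ := T.exists_pow_smul_eq_zero (i + 1) hxI z
  induction n generalizing z with
  | zero => exact absurd hn (by simpa using hz 1 (fun h => p.2.ne_top ((Ideal.eq_top_iff_one _).2 h)))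
  | succ n ih =>
    by_cases h : ∀ r ∉ p.asIdeal, r • (x • z) ≠ 0
    · exact ih _ h (by rw [smul_smul, ← pow_succ]; exact hn)
    · push Not at h
      obtain ⟨r, hr, h⟩ := h
      obtain ⟨w, hw⟩ := (h2 (r • z)).1 (by rw [smul_comm]; exact h)
      rw [Module.mem_support_iff']
      refine ⟨w, fun s hs h0 => hz (s * r) (fun h => ?_) ?_⟩
      · exact (p.2.mem_or_mem h).elim hs hr
      · rw [mul_smul, ← hw, ← _root_.map_smul, h0, map_zero]

/-- The support of the top local cohomology module is finite. -/
theorem finite_support_of_supportDim_lt (n : ℕ) : ∀ (N : Type) [AddCommGroup N] [Module A N]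
    [Module.Finite A N], supportDim A N < (n + 1 : ℕ) → (Module.support A (T.H n N)).Finite := by
  induction n with
  | zero =>
    intro N _ _ _ hN
    refine Module.Finite.devissage _
      (motive := fun N _ _ => (Module.support A (T.H 0 N)).Finite) ?_ ?_ ?_ N hN
    · intro N _ _ _
      have := T.subsingleton_of_subsingleton (N := N) 0
      simp [Module.support_eq_empty]
    · intro N₁ N₂ N₃ _ _ _ _ _ _ _ _ _ f g hf hg hfg _ h₁ h₃
      exact (h₁.union h₃).subset (T.support_subset_of_exact 0 hf hfg hg)
    · intro P _ hP
      obtain ⟨ι, hι, -⟩ := T.exists_embedding (A ⧸ P)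
      refine Set.Finite.subset ?_ (Module.support_subset_of_injective ι hι)
      have : Ring.KrullDimLE 0 (A ⧸ P) := by
        rw [Ring.krullDimLE_iff]
        exact Order.le_of_lt_succ hP
      have hf : IsField (A ⧸ P) := Ring.KrullDimLE.isField_of_isDomain
      have hmax : P.IsMaximal := Ideal.Quotient.maximal_of_isField P hf
      rw [Module.support_eq_zeroLocus, Ideal.annihilator_quotient]
      refine (Set.finite_singleton (⟨P, inferInstance⟩ : PrimeSpectrum A)).subset fun q hq => ?_
      exact PrimeSpectrum.ext (hmax.eq_of_le q.2.ne_top hq).symm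
  | succ n ih =>
    intro N _ _ _ hN
    refine Module.Finite.devissage _
      (motive := fun N _ _ => (Module.support A (T.H (n + 1) N)).Finite) ?_ ?_ ?_ N hN
    · intro N _ _ _
      have := T.subsingleton_of_subsingleton (N := N) (n + 1)
      simp [Module.support_eq_empty]
    · intro N₁ N₂ N₃ _ _ _ _ _ _ _ _ _ f g hf hg hfg _ h₁ h₃
      exact (h₁.union h₃).subset (T.support_subset_of_exact _ hf hfg hg)
    · intro P _ hP
      by_cases hIP : I ≤ P
      · have := T.subsingleton_quotient_of_le n hIP
        simp [Module.support_eq_empty]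
      · obtain ⟨x, hxI, hxP⟩ := SetLike.not_le_iff_exists.1 hIP
        have hreg := Ideal.Quotient.isSMulRegular_of_notMem hxP
        refine (ih _ ?_).subset (T.support_subset_of_isSMulRegular n hreg hxI)
        refine supportDim_quotSMulTop_lt ?_ fun p hp => hreg.notMem_of_mem_minimalPrimes hp
        rwa [supportDim_quotient_eq_ringKrullDim]

end LocalCohomologyTheory

theorem Module.exists_injective_embedding (A : Type) [CommRing A] (N : Type) [AddCommGroup N]
    [Module A N] : ∃ (J : Type) (_ : AddCommGroup J) (_ : Module A J) (f : N →ₗ[A] J),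
      Module.Injective A J ∧ Function.Injective f := by
  let J := CategoryTheory.Injective.under (ModuleCat.of A N)
  refine ⟨J, inferInstance, inferInstance, (CategoryTheory.Injective.ι (ModuleCat.of A N)).hom, ?_,
    ?_⟩
  · have : CategoryTheory.Injective (ModuleCat.of A J) :=
      inferInstanceAs (CategoryTheory.Injective (CategoryTheory.Injective.under _))
    exact Module.injective_module_of_injective_object A J
  · exact (ModuleCat.mono_iff_injective _).1 inferInstance

/-- Every element outside `0` of `E` has a nonzero multiple in `K`. -/
def Submodule.IsEssentialIn {A : Type} [CommRing A] {J : Type} [AddCommGroup J] [Module A J]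
    (K E : Submodule A J) : Prop :=
  K ≤ E ∧ ∀ x ∈ E, x ≠ 0 → ∃ a : A, a • x ∈ K ∧ a • x ≠ 0

theorem Submodule.exists_injective_isEssentialIn {A : Type} [CommRing A] {J : Type}
    [AddCommGroup J] [Module A J] [hJ : Module.Injective A J] (K : Submodule A J) :
    ∃ E : Submodule A J, K.IsEssentialIn E ∧ Module.Injective A E := by
  obtain ⟨E, -, hE⟩ := zorn_le_nonempty₀ {E : Submodule A J | K.IsEssentialIn E} (by
    intro c hc hchain y hy
    refine ⟨sSup c, ⟨(hc hy).1.trans (le_sSup hy), fun x hx hx0 => ?_⟩, fun z hz => le_sSup hz⟩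
    obtain ⟨z, hz, hxz⟩ := (Submodule.mem_sSup_of_directed ⟨y, hy⟩ hchain.directedOn).1 hx
    exact (hc hz).2 x hxz hx0) K ⟨le_rfl, fun x hx hx0 => ⟨1, by simpa using hx, by simpa using hx0⟩⟩
  obtain ⟨C, -, hC⟩ := zorn_le_nonempty₀ {C : Submodule A J | Disjoint E C} (by
    intro c hc hchain y hy
    exact ⟨sSup c, (DirectedOn.disjoint_sSup_right hchain.directedOn).2 fun z hz => hc hz,
      fun z hz => le_sSup hz⟩) ⊥ disjoint_bot_right
  have hEC : ∀ x ∈ E, x ∈ C → x = 0 := fun x h1 h2 => Submodule.disjoint_def.1 hC.prop x h1 h2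
  have hess : ∀ x : J, x ∉ C → ∃ a : A, ∃ e ∈ E, e ≠ 0 ∧ C.mkQ (a • x) = C.mkQ e := by
    intro x hx
    by_contra! hcon
    refine hx (hC.le_of_ge (y := C ⊔ A ∙ x) ?_ le_sup_left
      (Submodule.mem_sup_right (Submodule.mem_span_singleton_self x)))
    refine Submodule.disjoint_def.2 fun e he he' => ?_
    obtain ⟨c, hc, y, hy, rfl⟩ := Submodule.mem_sup.1 he'
    obtain ⟨a, rfl⟩ := Submodule.mem_span_singleton.1 hy
    by_contra h0
    refine hcon a _ he h0 ?_
    rw [map_add, (Submodule.Quotient.mk_eq_zero C).2 hc |> fun h => (show C.mkQ c = 0 from h),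
      zero_add]
  obtain ⟨φ, hφ⟩ := hJ.out (C.mkQ ∘ₗ E.subtype) (by
    rw [← LinearMap.ker_eq_bot, LinearMap.ker_eq_bot']
    intro e he
    exact Subtype.ext (hEC e e.2 ((Submodule.Quotient.mk_eq_zero C).1 he))) E.subtype
  have hφ' : ∀ e ∈ E, φ (C.mkQ e) = e := fun e he => hφ ⟨e, he⟩
  have hrange : LinearMap.range φ ≤ E := by
    refine hE.le_of_ge ?_ fun e he => ⟨_, hφ' e he⟩
    refine ⟨fun k hk => ⟨_, hφ' k (hE.prop.1 hk)⟩, ?_⟩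
    rintro _ ⟨x, rfl⟩ hx
    obtain ⟨x, rfl⟩ := C.mkQ_surjective x
    obtain ⟨a, e, he, he0, h⟩ := hess x (fun hxC => hx (by
      rw [(show C.mkQ x = 0 from (Submodule.Quotient.mk_eq_zero C).2 hxC), map_zero]))
    obtain ⟨b, hb, hb0⟩ := hE.prop.2 e he he0
    have : (b * a) • φ (C.mkQ x) = b • e := by
      rw [← map_smul, ← map_smul, mul_smul, map_smul, h, map_smul, hφ' e he]
    exact ⟨b * a, this ▸ hb, this ▸ hb0⟩
  refine ⟨E, hE.prop, ⟨fun X Y _ _ _ _ f hf g => ?_⟩⟩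
  obtain ⟨h, hh⟩ := hJ.out f hf (E.subtype ∘ₗ g)
  refine ⟨(φ ∘ₗ C.mkQ ∘ₗ h).codRestrict E fun y => hrange ⟨_, rfl⟩, fun x => Subtype.ext ?_⟩
  simp only [LinearMap.codRestrict_apply, LinearMap.comp_apply, hh]
  exact hφ' _ (g x).2

/-- The module `E` is injective, contains the residue field, and has a finite socle. -/
structure Module.IsDualizing (A : Type) [CommRing A] [IsLocalRing A] (E : Type) [AddCommGroup E]
    [Module A E] : Prop where
  injective : Module.Injective A E
  exists_embedding : ∃ f : IsLocalRing.ResidueField A →ₗ[A] E, Function.Injective f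
  finite_socle : Module.Finite A (IsLocalRing.ResidueField A →ₗ[A] E)

theorem Module.exists_isDualizing (A : Type) [CommRing A] [IsLocalRing A] [IsNoetherianRing A] :
    ∃ (E : Type) (_ : AddCommGroup E) (_ : Module A E), Module.IsDualizing A E := by
  obtain ⟨J, _, _, f, hJ, hf⟩ :=
    Module.exists_injective_embedding A (IsLocalRing.ResidueField A)
  obtain ⟨E, hE, hE'⟩ := Submodule.exists_injective_isEssentialIn (LinearMap.range f)
  refine ⟨E, inferInstance, inferInstance, hE', ?_, ?_⟩
  · exact ⟨f.codRestrict E fun x => hE.1 ⟨x, rfl⟩, fun x y h => hf (congrArg Subtype.val h)⟩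
  · have hm : ∀ (a : A) (_ : a ∈ IsLocalRing.maximalIdeal A) (x : IsLocalRing.ResidueField A),
        a • x = 0 := by
      intro a ha x
      rw [Algebra.smul_def, IsLocalRing.ResidueField.algebraMap_eq,
        (IsLocalRing.residue_eq_zero_iff a).2 ha, zero_mul]
    let ev : (IsLocalRing.ResidueField A →ₗ[A] E) →ₗ[A] E := LinearMap.applyₗ 1
    have hev : Function.Injective ev := by
      intro g h hgh
      ext x
      obtain ⟨x, rfl⟩ := IsLocalRing.residue_surjective x
      have : IsLocalRing.residue A x = x • (1 : IsLocalRing.ResidueField A) := by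
        rw [Algebra.smul_def, mul_one]; rfl
      rw [this, map_smul, map_smul]
      exact congrArg (fun y : E => ((x • y : E) : J)) hgh
    have hsoc : ∀ g, (ev g : J) ∈ LinearMap.range f := by
      intro g
      by_cases h0 : (ev g : J) = 0
      · rw [h0]; exact zero_mem _
      obtain ⟨a, ha, ha0⟩ := hE.2 _ (ev g).2 h0
      have hu : IsUnit a := by
        by_contra hu
        apply ha0
        have : a • ev g = 0 := by
          change a • g 1 = 0
          rw [← map_smul, hm a ((IsLocalRing.mem_maximalIdeal a).2 hu), map_zero]
        exact congrArg Subtype.val this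
      obtain ⟨u, rfl⟩ := hu
      have := (LinearMap.range f).smul_mem (↑u⁻¹ : A) ha
      rwa [smul_smul, Units.inv_mul, one_smul] at this
    have : Module.Finite A (LinearMap.range f) := Module.Finite.range f
    exact Module.Finite.of_injective
      ((E.subtype ∘ₗ ev).codRestrict (LinearMap.range f) hsoc)
      (fun g h hgh => by
        have h1 : ((ev g : E) : J) = ev h := congrArg (fun y : LinearMap.range f => (y : J)) hgh
        exact hev (Subtype.ext h1))

namespace Module.IsDualizing

variable {A : Type} [CommRing A] [IsLocalRing A] {E : Type} [AddCommGroup E] [Module A E]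
  (hE : IsDualizing A E)
include hE

theorem exists_apply_ne_zero {M : Type} [AddCommGroup M] [Module A M] {x : M} (hx : x ≠ 0) :
    ∃ φ : M →ₗ[A] E, φ x ≠ 0 := by
  obtain ⟨f, hf⟩ := hE.exists_embedding
  have hle : LinearMap.ker (LinearMap.toSpanSingleton A M x) ≤ IsLocalRing.maximalIdeal A := by
    refine IsLocalRing.le_maximalIdeal fun h => hx ?_
    have : (1 : A) ∈ LinearMap.ker (LinearMap.toSpanSingleton A M x) := h ▸ Submodule.mem_top
    simpa using this
  let g : A ⧸ LinearMap.ker (LinearMap.toSpanSingleton A M x) →ₗ[A] E :=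
    f ∘ₗ Submodule.liftQ _ (Algebra.linearMap A (IsLocalRing.ResidueField A)) (by
      intro a ha
      exact (IsLocalRing.residue_eq_zero_iff a).2 (hle ha))
  obtain ⟨φ, hφ⟩ := hE.injective.out ((LinearMap.toSpanSingleton A M x).ker.liftQ
    (LinearMap.toSpanSingleton A M x) le_rfl)
    (by rw [← LinearMap.ker_eq_bot]; exact Submodule.ker_liftQ_eq_bot _ _ _ le_rfl) g
  refine ⟨φ, fun h => ?_⟩
  have h1 := hφ (Submodule.Quotient.mk 1)
  simp only [Submodule.liftQ_apply, LinearMap.toSpanSingleton_apply, one_smul, h] at h1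
  have h2 : f 1 = 0 := by
    rw [h1]
    change f 1 = f (algebraMap A _ 1)
    rw [map_one (algebraMap A (IsLocalRing.ResidueField A))]
  exact one_ne_zero (hf (h2.trans (map_zero f).symm))

theorem subsingleton_of_dual {M : Type} [AddCommGroup M] [Module A M]
    [Subsingleton (M →ₗ[A] E)] : Subsingleton M := by
  refine subsingleton_of_forall_eq 0 fun x => ?_
  by_contra hx
  obtain ⟨φ, hφ⟩ := hE.exists_apply_ne_zero hx
  exact hφ (by rw [Subsingleton.elim φ 0]; rfl)

theorem smul_eq_zero_of_dual {M : Type} [AddCommGroup M] [Module A M] {a : A}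
    (h : ∀ φ : M →ₗ[A] E, a • φ = 0) (x : M) : a • x = 0 := by
  by_contra hx
  obtain ⟨φ, hφ⟩ := hE.exists_apply_ne_zero hx
  refine hφ ?_
  rw [map_smul]
  exact LinearMap.congr_fun (h φ) x

theorem exact_lcomp {M₁ M₂ M₃ : Type} [AddCommGroup M₁] [Module A M₁] [AddCommGroup M₂]
    [Module A M₂] [AddCommGroup M₃] [Module A M₃] {f : M₁ →ₗ[A] M₂} {g : M₂ →ₗ[A] M₃}
    (hfg : Function.Exact f g) :
    Function.Exact (LinearMap.lcomp A E g) (LinearMap.lcomp A E f) := by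
  intro φ
  constructor
  · intro h
    obtain ⟨ψ, hψ⟩ := hE.injective.out ((LinearMap.ker g).liftQ g le_rfl)
      (by rw [← LinearMap.ker_eq_bot]; exact Submodule.ker_liftQ_eq_bot _ _ _ le_rfl)
      ((LinearMap.ker g).liftQ φ (by
        intro x hx
        obtain ⟨y, rfl⟩ := (hfg x).1 hx
        exact LinearMap.congr_fun h y))
    refine ⟨ψ, ?_⟩
    ext x
    simpa using hψ (Submodule.Quotient.mk x)
  · rintro ⟨ψ, rfl⟩
    ext x
    simp [hfg.apply_apply_eq_zero]

theorem lcomp_surjective {M₁ M₂ : Type} [AddCommGroup M₁] [Module A M₁] [AddCommGroup M₂]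
    [Module A M₂] {f : M₁ →ₗ[A] M₂} (hf : Function.Injective f) :
    Function.Surjective (LinearMap.lcomp A E f) := by
  intro φ
  obtain ⟨ψ, hψ⟩ := hE.injective.out f hf φ
  exact ⟨ψ, LinearMap.ext hψ⟩

end Module.IsDualizing

theorem smodEq_span_singleton_pow_iff {A : Type} [CommRing A] {M : Type} [AddCommGroup M]
    [Module A M] (x : A) (n : ℕ) (u v : M) :
    u ≡ v [SMOD (Ideal.span {x} ^ n • ⊤ : Submodule A M)] ↔ ∃ w, x ^ n • w = u - v := by
  rw [SModEq.sub_mem, Ideal.span_singleton_pow, Submodule.ideal_span_singleton_smul,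
    Submodule.mem_smul_pointwise_iff_exists]
  simp

theorem exists_limit_of_isAdicComplete {A : Type} [CommRing A] [IsLocalRing A] [IsNoetherianRing A]
    [IsAdicComplete (IsLocalRing.maximalIdeal A) A] {x : A} (hx : x ∈ IsLocalRing.maximalIdeal A)
    (f : ℕ → A) (hf : ∀ m n, m ≤ n → x ^ m ∣ f m - f n) : ∃ L, ∀ n, x ^ n ∣ f n - L := by
  obtain ⟨L, hL⟩ := IsPrecomplete.prec (I := IsLocalRing.maximalIdeal A) (M := A) inferInstance
    (f := f) (by
      intro m n hmn
      rw [SModEq.sub_mem, smul_eq_mul, Ideal.mul_top]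
      exact Ideal.mem_of_dvd _ (hf m n hmn) (Ideal.pow_mem_pow hx m))
  refine ⟨L, fun n => ?_⟩
  rw [← Ideal.mem_span_singleton, ← Ideal.Quotient.eq_zero_iff_mem]
  refine IsHausdorff.haus (I := IsLocalRing.maximalIdeal A) inferInstance _ fun k => ?_
  rw [SModEq.zero]
  have h1 := hL (max n k)
  rw [SModEq.sub_mem, smul_eq_mul, Ideal.mul_top] at h1
  have h2 : Ideal.Quotient.mk (Ideal.span {x ^ n}) (f n - L) =
      Ideal.Quotient.mk (Ideal.span {x ^ n}) (f (max n k) - L) := by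
    rw [Ideal.Quotient.eq, Ideal.mem_span_singleton]
    have := hf n (max n k) (le_max_left _ _)
    convert this using 1
    ring
  rw [h2, ← mul_one (f (max n k) - L), map_mul, ← Ideal.Quotient.algebraMap_eq,
    ← Algebra.smul_def]
  exact Submodule.smul_mem_smul (Ideal.pow_le_pow_right (le_max_right _ _) h1) Submodule.mem_top

theorem Module.Finite.of_quotSMulTop {A : Type} [CommRing A] [IsLocalRing A] [IsNoetherianRing A]
    [IsAdicComplete (IsLocalRing.maximalIdeal A) A] {x : A} (hx : x ∈ IsLocalRing.maximalIdeal A)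
    (K : Type) [AddCommGroup K] [Module A K] (hK : ∀ u : K, (∀ n : ℕ, ∃ w, x ^ n • w = u) → u = 0)
    [Module.Finite A (QuotSMulTop x K)] : Module.Finite A K := by
  obtain ⟨n, g, hg⟩ := Module.Finite.exists_fin' A (QuotSMulTop x K)
  obtain ⟨f, hf⟩ := Module.projective_lifting_property
    (Submodule.mkQ (x • (⊤ : Submodule A K))) g (Submodule.mkQ_surjective _)
  have : IsHausdorff (Ideal.span {x}) K := ⟨fun u hu => hK u fun n => by
    simpa using (smodEq_span_singleton_pow_iff x n u 0).1 (hu n)⟩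
  have : IsPrecomplete (Ideal.span {x}) (Fin n → A) := ⟨fun {s} hs => by
    have hs' : ∀ i, ∀ m n, m ≤ n → x ^ m ∣ s m i - s n i := by
      intro i m n hmn
      obtain ⟨w, hw⟩ := (smodEq_span_singleton_pow_iff x m _ _).1 (hs hmn)
      exact ⟨w i, by simpa using (congrFun hw i).symm⟩
    choose L hL using fun i => exists_limit_of_isAdicComplete hx (fun k => s k i) (hs' i)
    refine ⟨L, fun k => (smodEq_span_singleton_pow_iff x k _ _).2 ?_⟩
    choose w hw using fun i => hL i k
    exact ⟨w, by ext i; simp [hw i]⟩⟩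
  have key : ∀ S : Submodule A K, S = x • ⊤ → Function.Surjective (S.mkQ ∘ₗ f) := by
    rintro _ rfl
    rwa [hf]
  exact Module.Finite.of_surjective f (surjective_of_mkQ_comp_surjective (I := Ideal.span {x})
    (key _ (Submodule.ideal_span_singleton_smul _ _)))

/-- The functors `Hom(H^i(-), E)`. -/
abbrev LocalCohomologyTheory.K {A : Type} [CommRing A] {I : Ideal A}
    (T : LocalCohomologyTheory A I) (E : Type) [AddCommGroup E] [Module A E] (i : ℕ) (N : Type)
    [AddCommGroup N] [Module A N] : Type := T.H i N →ₗ[A] E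

namespace LocalCohomologyTheory

variable {A : Type} [CommRing A] {I : Ideal A} (T : LocalCohomologyTheory A I)
variable {N : Type} [AddCommGroup N] [Module A N] {E : Type} [AddCommGroup E] [Module A E]

theorem eq_zero_of_forall_exists_pow_smul (i : ℕ) {x : A} (hx : x ∈ I) (u : T.K E i N)
    (hu : ∀ n : ℕ, ∃ w : T.K E i N, x ^ n • w = u) : u = 0 := by
  ext z
  obtain ⟨n, hn⟩ := T.exists_pow_smul_eq_zero i hx z
  obtain ⟨w, rfl⟩ := hu n
  rw [LinearMap.smul_apply, ← _root_.map_smul, hn, map_zero, LinearMap.zero_apply]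

variable [IsLocalRing A] (hE : IsDualizing A E)
include hE

theorem exists_dual_connecting_of_isSMulRegular (i : ℕ) {x : A} (hx : IsSMulRegular N x) :
    ∃ (δ : T.K E (i + 1) N →ₗ[A] T.K E i (QuotSMulTop x N)),
      (∀ u, δ u = 0 ↔ ∃ w, x • w = u) ∧
      Function.Exact δ (LinearMap.lcomp A E (T.map i (Submodule.mkQ (x • (⊤ : Submodule A N))))) := by
  obtain ⟨δ, h1, h2⟩ := T.exists_connecting i (f := LinearMap.lsmul A N x) hx
    (exact_lsmul_mkQ x) (Submodule.mkQ_surjective _)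
  refine ⟨LinearMap.lcomp A E δ, fun u => ?_, hE.exact_lcomp h1⟩
  rw [hE.exact_lcomp h2 u]
  refine exists_congr fun w => ?_
  have : LinearMap.lcomp A E (T.map (i + 1) (LinearMap.lsmul A N x)) w = x • w := by
    ext z
    simp [T.map_lsmul]
  rw [this]

variable [IsNoetherianRing A]

theorem finite_dual_of_isSMulRegular [IsAdicComplete (IsLocalRing.maximalIdeal A) A]
    (hI : I ≤ IsLocalRing.maximalIdeal A) (i : ℕ) {x : A}
    (hx : IsSMulRegular N x) (hxI : x ∈ I) (h : Module.Finite A (T.K E i (QuotSMulTop x N))) :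
    Module.Finite A (T.K E (i + 1) N) := by
  obtain ⟨δ, h1, -⟩ := T.exists_dual_connecting_of_isSMulRegular hE i hx
  have : Module.Finite A (QuotSMulTop x (T.K E (i + 1) N)) := by
    refine Module.Finite.of_injective (Submodule.liftQ _ δ ?_) ?_
    · intro u hu
      rw [Submodule.mem_smul_pointwise_iff_exists] at hu
      obtain ⟨w, -, rfl⟩ := hu
      exact (h1 _).2 ⟨w, rfl⟩
    · rw [← LinearMap.ker_eq_bot]
      refine Submodule.ker_liftQ_eq_bot _ _ _ fun u hu => ?_
      obtain ⟨w, rfl⟩ := (h1 u).1 hu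
      exact Submodule.smul_mem_pointwise_smul _ _ _ Submodule.mem_top
  exact Module.Finite.of_quotSMulTop (hI hxI) _ (T.eq_zero_of_forall_exists_pow_smul (i + 1) hxI)

theorem finite_dual_of_exact (i : ℕ) {N₁ N₃ : Type} [AddCommGroup N₁] [Module A N₁]
    [AddCommGroup N₃] [Module A N₃] {f : N₁ →ₗ[A] N} {g : N →ₗ[A] N₃}
    (hf : Function.Injective f) (hfg : Function.Exact f g) (hg : Function.Surjective g)
    (h₁ : Module.Finite A (T.K E i N₁)) (h₃ : Module.Finite A (T.K E i N₃)) :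
    Module.Finite A (T.K E i N) := by
  have h := hE.exact_lcomp (T.exact_map i hf hfg hg)
  rw [LinearMap.exact_iff] at h
  have h1 : (LinearMap.range (LinearMap.lcomp A E (T.map i f))).FG :=
    IsNoetherian.noetherian _
  have h2 : (LinearMap.ker (LinearMap.lcomp A E (T.map i f))).FG := by
    rw [h]
    exact Module.Finite.iff_fg.1 (Module.Finite.range _)
  refine ⟨Submodule.fg_of_fg_map_of_fg_inf_ker (LinearMap.lcomp A E (T.map i f)) ?_ ?_⟩
  · rwa [Submodule.map_top]
  · rwa [top_inf_eq]

omit [IsLocalRing A] hE [IsNoetherianRing A] in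
theorem finite_dual_zero_of_subsingleton (i : ℕ) [Subsingleton (T.H i N)] :
    Module.Finite A (T.K E i N) := by
  have : Subsingleton (T.K E i N) := ⟨fun u v => by ext z; rw [Subsingleton.elim z 0]; simp⟩
  infer_instance

end LocalCohomologyTheory

theorem Module.exists_notMem_smul_eq_zero {A : Type} [CommRing A] {K : Type} [AddCommGroup K]
    [Module A K] [Module.Finite A K] {P : Ideal A} [P.IsPrime] {x s : A} (hx : x ∈ P) (hs : s ∉ P)
    (h : ∀ u : K, ∃ w : K, x • w = s • u) : ∃ t ∉ P, ∀ u : K, t • u = 0 := by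
  obtain ⟨p, hp, -, hcoeff, hp0⟩ :=
    LinearMap.exists_monic_and_natDegree_eq_and_coeff_mem_pow_and_aeval_eq_zero A
      (algebraMap A (Module.End A K) s) (Ideal.span {x}) (by
        rintro _ ⟨u, rfl⟩
        obtain ⟨w, hw⟩ := h u
        rw [Module.algebraMap_end_apply, ← hw]
        exact Submodule.smul_mem_smul (Ideal.mem_span_singleton_self x) Submodule.mem_top)
  refine ⟨p.eval s, fun hmem => hs ?_, fun u => ?_⟩
  · rw [Polynomial.eval_eq_sum_range, Finset.sum_range_succ, hp.coeff_natDegree, one_mul] at hmem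
    refine Ideal.IsPrime.mem_of_pow_mem ‹_› _ ((P.add_mem_iff_right (P.sum_mem fun k hk => ?_)).1 hmem)
    refine P.mul_mem_right _ ?_
    have h1 := Ideal.pow_le_self (by have := Finset.mem_range.1 hk; omega) (hcoeff k)
    exact ((Ideal.span_singleton_le_iff_mem P).2 hx) h1
  · rw [Polynomial.aeval_algebraMap_apply_eq_algebraMap_eval] at hp0
    exact LinearMap.congr_fun hp0 u

theorem IsLocalRing.eq_maximalIdeal_of_ringKrullDim_quotient_lt_one {A : Type} [CommRing A]
    [IsLocalRing A] {P : Ideal A} [P.IsPrime] (hP : ringKrullDim (A ⧸ P) < (0 + 1 : ℕ)) :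
    P = IsLocalRing.maximalIdeal A := by
  have : Ring.KrullDimLE 0 (A ⧸ P) := by
    rw [Ring.krullDimLE_iff]
    exact Order.le_of_lt_succ hP
  have hf : IsField (A ⧸ P) := Ring.KrullDimLE.isField_of_isDomain
  have hmax : P.IsMaximal := Ideal.Quotient.maximal_of_isField P hf
  exact IsLocalRing.eq_maximalIdeal hmax

namespace LocalCohomologyTheory

variable {A : Type} [CommRing A] {I : Ideal A} (T : LocalCohomologyTheory A I)
variable [IsLocalRing A] [IsNoetherianRing A] {E : Type} [AddCommGroup E] [Module A E]

omit [IsLocalRing A] [IsNoetherianRing A] in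
theorem smul_eq_zero_of_exact (i : ℕ) {N N₁ N₃ : Type} [AddCommGroup N] [Module A N]
    [AddCommGroup N₁] [Module A N₁]
    [AddCommGroup N₃] [Module A N₃] {f : N₁ →ₗ[A] N} {g : N →ₗ[A] N₃}
    (hf : Function.Injective f) (hfg : Function.Exact f g) (hg : Function.Surjective g) {s t : A}
    (h₁ : ∀ z : T.H i N₁, s • z = 0) (h₃ : ∀ z : T.H i N₃, t • z = 0) (z : T.H i N) :
    (s * t) • z = 0 := by
  obtain ⟨w, hw⟩ := (T.exact_map i hf hfg hg (t • z)).1 (by rw [_root_.map_smul, h₃])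
  rw [mul_smul, ← hw, ← _root_.map_smul, h₁, map_zero]

omit [IsNoetherianRing A] in
theorem finite_dual_zero_residue (hE : IsDualizing A E) {P : Ideal A}
    (hP : P = IsLocalRing.maximalIdeal A) : Module.Finite A (T.K E 0 (A ⧸ P)) := by
  subst hP
  obtain ⟨ι, hι, -⟩ := T.exists_embedding (A ⧸ IsLocalRing.maximalIdeal A)
  have := hE.finite_socle
  have h : Module.Finite A ((A ⧸ IsLocalRing.maximalIdeal A) →ₗ[A] E) := this
  exact Module.Finite.of_surjective _ (hE.lcomp_surjective hι)

theorem finite_dual_top [IsAdicComplete (IsLocalRing.maximalIdeal A) A] (hE : IsDualizing A E)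
    (hI : I ≤ IsLocalRing.maximalIdeal A) (n : ℕ) : ∀ (N : Type) [AddCommGroup N] [Module A N]
    [Module.Finite A N], supportDim A N < (n + 1 : ℕ) → Module.Finite A (T.K E n N) := by
  induction n with
  | zero =>
    intro N _ _ _ hN
    refine Module.Finite.devissage _
      (motive := fun N _ _ => Module.Finite A (T.K E 0 N)) ?_ ?_ ?_ N hN
    · intro N _ _ _
      have := T.subsingleton_of_subsingleton (N := N) 0
      exact T.finite_dual_zero_of_subsingleton 0
    · intro N₁ N₂ N₃ _ _ _ _ _ _ _ _ _ f g hf hg hfg _ h₁ h₃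
      exact T.finite_dual_of_exact hE 0 hf hfg hg h₁ h₃
    · intro P _ hP
      exact T.finite_dual_zero_residue hE
        (IsLocalRing.eq_maximalIdeal_of_ringKrullDim_quotient_lt_one hP)
  | succ n ih =>
    intro N _ _ _ hN
    refine Module.Finite.devissage _
      (motive := fun N _ _ => Module.Finite A (T.K E (n + 1) N)) ?_ ?_ ?_ N hN
    · intro N _ _ _
      have := T.subsingleton_of_subsingleton (N := N) (n + 1)
      exact T.finite_dual_zero_of_subsingleton _
    · intro N₁ N₂ N₃ _ _ _ _ _ _ _ _ _ f g hf hg hfg _ h₁ h₃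
      exact T.finite_dual_of_exact hE _ hf hfg hg h₁ h₃
    · intro P _ hP
      by_cases hIP : I ≤ P
      · have := T.subsingleton_quotient_of_le n hIP
        exact T.finite_dual_zero_of_subsingleton _
      · obtain ⟨x, hxI, hxP⟩ := SetLike.not_le_iff_exists.1 hIP
        have hreg := Ideal.Quotient.isSMulRegular_of_notMem hxP
        refine T.finite_dual_of_isSMulRegular hE hI n hreg hxI (ih _ ?_)
        refine supportDim_quotSMulTop_lt ?_ fun p hp => hreg.notMem_of_mem_minimalPrimes hp
        rwa [supportDim_quotient_eq_ringKrullDim]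

theorem exists_notMem_annihilates_top [IsAdicComplete (IsLocalRing.maximalIdeal A) A]
    (hE : IsDualizing A E) (hI : I ≤ IsLocalRing.maximalIdeal A) {Q : Ideal A} [Q.IsPrime]
    (hIQ : I ≤ Q) (hQ : Q ≠ IsLocalRing.maximalIdeal A) (n : ℕ) :
    ∀ (N : Type) [AddCommGroup N] [Module A N] [Module.Finite A N],
      supportDim A N < (n + 1 : ℕ) → ∃ s ∉ Q, ∀ z : T.H n N, s • z = 0 := by
  have hQ' : ¬ IsLocalRing.maximalIdeal A ≤ Q := fun h =>
    hQ (h.antisymm (IsLocalRing.le_maximalIdeal (Ideal.IsPrime.ne_top ‹_›))).symm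
  have hone : (1 : A) ∉ Q := fun h => Ideal.IsPrime.ne_top ‹_› ((Ideal.eq_top_iff_one _).2 h)
  have hquot : ∀ (n : ℕ) (P : Ideal A), ¬ P ≤ Q → ∃ s ∉ Q, ∀ z : T.H n (A ⧸ P), s • z = 0 := by
    intro n P hPQ
    obtain ⟨s, hs, hsQ⟩ := SetLike.not_le_iff_exists.1 hPQ
    refine ⟨s, hsQ, T.mem_smul_of_annihilates n fun m => ?_⟩
    obtain ⟨m, rfl⟩ := Ideal.Quotient.mk_surjective m
    rw [Algebra.smul_def, Ideal.Quotient.algebraMap_eq, Ideal.Quotient.eq_zero_iff_mem.2 hs,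
      zero_mul]
  have hexact : ∀ (n : ℕ) (N₁ N₂ N₃ : Type) [AddCommGroup N₁] [Module A N₁]
      [AddCommGroup N₂] [Module A N₂] [AddCommGroup N₃] [Module A N₃]
      (f : N₁ →ₗ[A] N₂) (g : N₂ →ₗ[A] N₃), Function.Injective f →
      Function.Surjective g → Function.Exact f g →
      (∃ s ∉ Q, ∀ z : T.H n N₁, s • z = 0) → (∃ s ∉ Q, ∀ z : T.H n N₃, s • z = 0) →
      ∃ s ∉ Q, ∀ z : T.H n N₂, s • z = 0 := by
    rintro n N₁ N₂ N₃ _ _ _ _ _ _ f g hf hg hfg ⟨s, hs, h₁⟩ ⟨t, ht, h₃⟩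
    exact ⟨s * t, fun h => (Ideal.IsPrime.mem_or_mem ‹_› h).elim hs ht,
      T.smul_eq_zero_of_exact n hf hfg hg h₁ h₃⟩
  induction n with
  | zero =>
    intro N _ _ _ hN
    refine Module.Finite.devissage _
      (motive := fun N _ _ => ∃ s ∉ Q, ∀ z : T.H 0 N, s • z = 0) ?_ ?_ ?_ N hN
    · intro N _ _ _
      have := T.subsingleton_of_subsingleton (N := N) 0
      exact ⟨1, hone, fun z => Subsingleton.elim _ _⟩
    · intro N₁ N₂ N₃ _ _ _ _ _ _ _ _ _ f g hf hg hfg _ h₁ h₃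
      exact hexact 0 N₁ N₂ N₃ f g hf hg hfg h₁ h₃
    · intro P _ hP
      refine hquot 0 P ?_
      rwa [IsLocalRing.eq_maximalIdeal_of_ringKrullDim_quotient_lt_one hP]
  | succ n ih =>
    intro N _ _ _ hN
    refine Module.Finite.devissage _
      (motive := fun N _ _ => ∃ s ∉ Q, ∀ z : T.H (n + 1) N, s • z = 0) ?_ ?_ ?_ N hN
    · intro N _ _ _
      have := T.subsingleton_of_subsingleton (N := N) (n + 1)
      exact ⟨1, hone, fun z => Subsingleton.elim _ _⟩
    · intro N₁ N₂ N₃ _ _ _ _ _ _ _ _ _ f g hf hg hfg _ h₁ h₃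
      exact hexact _ N₁ N₂ N₃ f g hf hg hfg h₁ h₃
    · intro P _ hP
      by_cases hPQ : P ≤ Q
      swap
      · exact hquot _ P hPQ
      by_cases hIP : I ≤ P
      · have := T.subsingleton_quotient_of_le n hIP
        exact ⟨1, hone, fun z => Subsingleton.elim _ _⟩
      · obtain ⟨x, hxI, hxP⟩ := SetLike.not_le_iff_exists.1 hIP
        have hreg := Ideal.Quotient.isSMulRegular_of_notMem hxP
        have hP' : supportDim A (A ⧸ P) < (n + 1 + 1 : ℕ) := by
          rwa [supportDim_quotient_eq_ringKrullDim]
        obtain ⟨s, hsQ, hs⟩ := ih (QuotSMulTop x (A ⧸ P))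
          (supportDim_quotSMulTop_lt hP' fun p hp => hreg.notMem_of_mem_minimalPrimes hp)
        obtain ⟨δ, hδ, -⟩ := T.exists_dual_connecting_of_isSMulRegular hE n hreg
        have := T.finite_dual_top hE hI (n + 1) (A ⧸ P) hP'
        obtain ⟨t, ht, h⟩ := Module.exists_notMem_smul_eq_zero (K := T.K E (n + 1) (A ⧸ P))
          (hIQ hxI) hsQ (fun u => (hδ _).1 (by
            ext z
            rw [_root_.map_smul, LinearMap.smul_apply, ← _root_.map_smul, hs, map_zero,
              LinearMap.zero_apply]))
        exact ⟨t, ht, hE.smul_eq_zero_of_dual h⟩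

/-- The Lichtenbaum-Hartshorne vanishing theorem. -/
theorem exists_prime_of_nontrivial_top [IsAdicComplete (IsLocalRing.maximalIdeal A) A]
    (hI : I ≤ IsLocalRing.maximalIdeal A) (n : ℕ)
    (N : Type) [AddCommGroup N] [Module A N] [Module.Finite A N]
    (hN : supportDim A N < (n + 1 : ℕ)) (hT : ¬ Subsingleton (T.H n N)) :
    ∃ q ∈ Module.support A N, ringKrullDim (A ⧸ q.asIdeal) = n ∧
      ∀ Q : Ideal A, Q.IsPrime → I ⊔ q.asIdeal ≤ Q → Q = IsLocalRing.maximalIdeal A := by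
  obtain ⟨E, _, _, hE⟩ := Module.exists_isDualizing A
  by_contra! hcon
  refine hT ?_
  clear hT
  have hres : ∀ (N : Type) [AddCommGroup N] [Module A N] [Module.Finite A N],
      supportDim A N < (n + 1 : ℕ) → (∀ q ∈ Module.support A N,
      ringKrullDim (A ⧸ q.asIdeal) = n → ∃ Q : Ideal A, Q.IsPrime ∧ I ⊔ q.asIdeal ≤ Q ∧
        Q ≠ IsLocalRing.maximalIdeal A) → Subsingleton (T.H n N) := by
    intro N _ _ _ hN
    refine Module.Finite.devissage _ (motive := fun N _ _ => (∀ q ∈ Module.support A N,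
      ringKrullDim (A ⧸ q.asIdeal) = n → ∃ Q : Ideal A, Q.IsPrime ∧ I ⊔ q.asIdeal ≤ Q ∧
        Q ≠ IsLocalRing.maximalIdeal A) → Subsingleton (T.H n N)) ?_ ?_ ?_ N hN
    · intro N _ _ _ _
      exact T.subsingleton_of_subsingleton n
    · intro N₁ N₂ N₃ _ _ _ _ _ _ _ _ _ f g hf hg hfg _ h₁ h₃ h
      exact T.subsingleton_of_exact n hf hfg hg
        (h₁ fun q hq => h q (Module.support_subset_of_injective f hf hq))
        (h₃ fun q hq => h q (Module.support_subset_of_surjective g hg hq))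
    · intro P hPp hP h
      by_cases hPn : ringKrullDim (A ⧸ P) = n
      · obtain ⟨Q, hQ, hIQ, hQm⟩ := h ⟨P, hPp⟩ (by
          rw [Module.support_eq_zeroLocus, Ideal.annihilator_quotient]
          exact (PrimeSpectrum.mem_zeroLocus _ _).2 subset_rfl) hPn
        obtain ⟨s, hs, h0⟩ := T.exists_notMem_annihilates_top hE hI (le_sup_left.trans hIQ) hQm n
          (A ⧸ P) (by rwa [supportDim_quotient_eq_ringKrullDim])
        refine subsingleton_of_forall_eq 0 fun z => ?_
        obtain ⟨w, rfl⟩ := T.smul_surjective_quotient hP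
          (fun h => hs (le_sup_right.trans hIQ h)) z
        exact h0 w
      · refine T.subsingleton_of_supportDim_lt n _ ?_ n le_rfl
        rw [supportDim_quotient_eq_ringKrullDim]
        push_cast at hP
        exact lt_of_le_of_ne (ENat.WithBot.lt_add_one_iff.1 hP) hPn
  exact hres N hN hcon

end LocalCohomologyTheory

theorem Module.ringKrullDim_quotient_le_supportDim {A : Type} [CommRing A] {N : Type}
    [AddCommGroup N] [Module A N] {q : PrimeSpectrum A} (hq : q ∈ Module.support A N) :
    ringKrullDim (A ⧸ q.asIdeal) ≤ supportDim A N := by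
  rw [ringKrullDim_quotient]
  refine Order.krullDim_le_of_strictMono
    (fun p => ⟨p.1, Module.mem_support_mono p.2 hq⟩) fun a b h => h

theorem Module.exists_mem_support_ringKrullDim_eq {A : Type} [CommRing A] {N : Type}
    [AddCommGroup N] [Module A N] {n : ℕ} (hN : supportDim A N = n) :
    ∃ q ∈ Module.support A N, ringKrullDim (A ⧸ q.asIdeal) = n := by
  obtain ⟨l, rfl⟩ := Order.le_krullDim_iff.1 (hN.ge : (n : WithBot ℕ∞) ≤ _)
  refine ⟨l.head.1, l.head.2, le_antisymm (hN ▸ ringKrullDim_quotient_le_supportDim l.head.2) ?_⟩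
  rw [ringKrullDim_quotient]
  exact Order.le_krullDim_iff.2 ⟨LTSeries.mk l.length
    (fun i => ⟨(l i).1, l.monotone (Fin.zero_le i)⟩) (fun a b h => l.strictMono h), rfl⟩

theorem Ideal.eq_of_le_of_ringKrullDim_quotient_lt {A : Type} [CommRing A] {P q : Ideal A}
    [P.IsPrime] (hPq : P ≤ q) {d : ℕ} (hP : ringKrullDim (A ⧸ P) < (d + 1 : ℕ))
    (hq : ringKrullDim (A ⧸ q) = d) : P = q := by
  refine hPq.antisymm fun y hy => ?_
  by_contra hyP
  have hreg := Ideal.Quotient.isSMulRegular_of_notMem hyP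
  rw [← supportDim_quotient_eq_ringKrullDim] at hP
  have h := supportDim_quotSMulTop_lt hP fun p hp => hreg.notMem_of_mem_minimalPrimes hp
  have hle : y • (⊤ : Submodule A (A ⧸ P)) ≤ LinearMap.ker (Submodule.factor hPq) := by
    intro z hz
    obtain ⟨w, -, rfl⟩ := (Submodule.mem_smul_pointwise_iff_exists _ _ _).1 hz
    obtain ⟨w, rfl⟩ := Submodule.mkQ_surjective _ w
    rw [LinearMap.mem_ker, ← _root_.map_smul]
    exact (Submodule.Quotient.mk_eq_zero q).2 (q.mul_mem_right w hy)
  have hsurj : Function.Surjective (Submodule.liftQ _ _ hle) := by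
    intro z
    obtain ⟨w, rfl⟩ := Submodule.mkQ_surjective _ z
    exact ⟨Submodule.mkQ _ (Submodule.mkQ _ w), rfl⟩
  have h2 := (supportDim_le_of_surjective _ hsurj).trans_lt h
  rw [supportDim_quotient_eq_ringKrullDim, hq] at h2
  exact lt_irrefl _ h2

namespace LocalCohomologyTheory

variable {A : Type} [CommRing A] {I : Ideal A} (T : LocalCohomologyTheory A I)
variable [IsNoetherianRing A]

theorem exists_smul_ne_zero_of_mem_support (d : ℕ) (q : PrimeSpectrum A)
    (hq : ringKrullDim (A ⧸ q.asIdeal) = d) (hT : ¬ Subsingleton (T.H d (A ⧸ q.asIdeal)))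
    (N : Type) [AddCommGroup N] [Module A N] [Module.Finite A N]
    (hN : supportDim A N < (d + 1 : ℕ)) :
    q ∈ Module.support A N → ∀ s ∉ q.asIdeal, ∃ z : T.H d N, s • z ≠ 0 := by
  refine Module.Finite.devissage _ (motive := fun N _ _ => q ∈ Module.support A N →
    ∀ s ∉ q.asIdeal, ∃ z : T.H d N, s • z ≠ 0) ?_ ?_ ?_ N hN
  · intro N _ _ _ h
    rw [Module.support_eq_empty] at h
    exact h.elim
  · intro N₁ N₂ N₃ _ _ _ _ _ _ _ _ _ f g hf hg hfg hN₂ h₁ h₃ h s hs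
    by_cases h3 : q ∈ Module.support A N₃
    · obtain ⟨z, hz⟩ := h₃ h3 s hs
      have := T.subsingleton_of_supportDim_lt (d + 1) N₁
        ((supportDim_le_of_injective f hf).trans_lt hN₂) (d + 1) le_rfl
      obtain ⟨w, rfl⟩ := T.map_surjective_of_exact d hf hfg hg this z
      refine ⟨w, fun h0 => hz ?_⟩
      rw [← _root_.map_smul, h0, map_zero]
    · have h1 : q ∈ Module.support A N₁ := by
        rw [Module.support_of_exact hfg hf hg] at h
        exact h.resolve_right h3
      rw [Module.mem_support_iff_of_finite] at h3
      obtain ⟨s', hs', hs'q⟩ := SetLike.not_le_iff_exists.1 h3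
      rw [Module.mem_annihilator] at hs'
      by_contra! hcon
      cases d with
      | zero =>
        obtain ⟨z, hz⟩ := h₁ h1 s hs
        refine hz (T.map_zero_injective f hf ?_)
        rw [_root_.map_smul, hcon, map_zero]
      | succ d =>
        obtain ⟨δ, -, hδ⟩ := T.exists_connecting d hf hfg hg
        obtain ⟨z, hz⟩ := h₁ h1 (s' * s) fun h => (q.2.mem_or_mem h).elim hs'q hs
        obtain ⟨w, hw⟩ := (hδ (s • z)).1 (by rw [_root_.map_smul, hcon])
        rw [mul_smul, ← hw, ← _root_.map_smul, T.mem_smul_of_annihilates d hs', map_zero] at hz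
        exact hz rfl
  · intro P _ hP h s hs
    have hPq : P = q.asIdeal := by
      refine Ideal.eq_of_le_of_ringKrullDim_quotient_lt ?_ hP hq
      rwa [Module.mem_support_iff_of_finite, Ideal.annihilator_quotient] at h
    subst hPq
    by_contra! hcon
    refine hT (subsingleton_of_forall_eq 0 fun z => ?_)
    obtain ⟨w, rfl⟩ := T.smul_surjective_quotient hP hs z
    exact hcon w

theorem not_subsingleton_of_mem_support (d : ℕ) (q : PrimeSpectrum A)
    (hq : ringKrullDim (A ⧸ q.asIdeal) = d) (hT : ¬ Subsingleton (T.H d (A ⧸ q.asIdeal)))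
    (N : Type) [AddCommGroup N] [Module A N] [Module.Finite A N]
    (hN : supportDim A N < (d + 1 : ℕ)) (hqN : q ∈ Module.support A N) :
    ¬ Subsingleton (T.H d N) := by
  intro h
  obtain ⟨z, hz⟩ := T.exists_smul_ne_zero_of_mem_support d q hq hT N hN hqN 1
    fun h => q.2.ne_top ((Ideal.eq_top_iff_one _).2 h)
  exact hz (Subsingleton.elim _ _)

variable [IsLocalRing A] {E : Type} [AddCommGroup E] [Module A E]

theorem finite_dual_of_support [IsAdicComplete (IsLocalRing.maximalIdeal A) A]
    (hE : IsDualizing A E) (hI : I ≤ IsLocalRing.maximalIdeal A) (n : ℕ) (i : ℕ) :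
    ∀ (N : Type) [AddCommGroup N] [Module A N] [Module.Finite A N], supportDim A N < n →
    (∀ p ∈ Module.support A N, I ≤ p.asIdeal → p.asIdeal = IsLocalRing.maximalIdeal A) →
    Module.Finite A (T.K E i N) := by
  induction i with
  | zero =>
    intro N _ _ _ hN
    refine Module.Finite.devissage _ (motive := fun N _ _ => (∀ p ∈ Module.support A N,
      I ≤ p.asIdeal → p.asIdeal = IsLocalRing.maximalIdeal A) →
      Module.Finite A (T.K E 0 N)) ?_ ?_ ?_ N hN
    · intro N _ _ _ _
      have := T.subsingleton_of_subsingleton (N := N) 0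
      exact T.finite_dual_zero_of_subsingleton 0
    · intro N₁ N₂ N₃ _ _ _ _ _ _ _ _ _ f g hf hg hfg _ h₁ h₃ h
      exact T.finite_dual_of_exact hE 0 hf hfg hg
        (h₁ fun q hq => h q (Module.support_subset_of_injective f hf hq))
        (h₃ fun q hq => h q (Module.support_subset_of_surjective g hg hq))
    · intro P hPp hP h
      by_cases hIP : I ≤ P
      · exact T.finite_dual_zero_residue hE (h ⟨P, hPp⟩ (by
          rw [Module.mem_support_iff_of_finite, Ideal.annihilator_quotient]) hIP)
      · obtain ⟨x, hxI, hxP⟩ := SetLike.not_le_iff_exists.1 hIP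
        have := T.subsingleton_zero_of_isSMulRegular
          (Ideal.Quotient.isSMulRegular_of_notMem hxP) hxI
        exact T.finite_dual_zero_of_subsingleton 0
  | succ i ih =>
    intro N _ _ _ hN
    refine Module.Finite.devissage _ (motive := fun N _ _ => (∀ p ∈ Module.support A N,
      I ≤ p.asIdeal → p.asIdeal = IsLocalRing.maximalIdeal A) →
      Module.Finite A (T.K E (i + 1) N)) ?_ ?_ ?_ N hN
    · intro N _ _ _ _
      have := T.subsingleton_of_subsingleton (N := N) (i + 1)
      exact T.finite_dual_zero_of_subsingleton _
    · intro N₁ N₂ N₃ _ _ _ _ _ _ _ _ _ f g hf hg hfg _ h₁ h₃ h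
      exact T.finite_dual_of_exact hE _ hf hfg hg
        (h₁ fun q hq => h q (Module.support_subset_of_injective f hf hq))
        (h₃ fun q hq => h q (Module.support_subset_of_surjective g hg hq))
    · intro P hPp hP h
      by_cases hIP : I ≤ P
      · have := T.subsingleton_quotient_of_le i hIP
        exact T.finite_dual_zero_of_subsingleton _
      · obtain ⟨x, hxI, hxP⟩ := SetLike.not_le_iff_exists.1 hIP
        have hsurj := Submodule.mkQ_surjective (x • (⊤ : Submodule A (A ⧸ P)))
        refine T.finite_dual_of_isSMulRegular hE hI i
          (Ideal.Quotient.isSMulRegular_of_notMem hxP) hxI (ih _ ?_ fun q hq => h q ?_)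
        · refine (supportDim_le_of_surjective _ hsurj).trans_lt ?_
          rwa [supportDim_quotient_eq_ringKrullDim]
        · exact Module.support_subset_of_surjective _ hsurj hq

theorem not_subsingleton_top_quotient [IsAdicComplete (IsLocalRing.maximalIdeal A) A]
    (hI : I ≤ IsLocalRing.maximalIdeal A) (d : ℕ) : ∀ (q : PrimeSpectrum A),
    ringKrullDim (A ⧸ q.asIdeal) = d →
    (∀ Q : Ideal A, Q.IsPrime → I ⊔ q.asIdeal ≤ Q → Q = IsLocalRing.maximalIdeal A) →
    ¬ Subsingleton (T.H d (A ⧸ q.asIdeal)) := by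
  obtain ⟨E, _, _, hE⟩ := Module.exists_isDualizing A
  induction d with
  | zero =>
    intro q hq _ hsub
    have hqm : q.asIdeal = IsLocalRing.maximalIdeal A :=
      IsLocalRing.eq_maximalIdeal_of_ringKrullDim_quotient_lt_one (by rw [hq]; norm_num)
    obtain ⟨ι, -, hι⟩ := T.exists_embedding (A ⧸ q.asIdeal)
    obtain ⟨z, hz⟩ := hι 1 ⟨1, fun r hr => by
      rw [pow_one] at hr
      rw [Algebra.smul_def, mul_one, Ideal.Quotient.algebraMap_eq, Ideal.Quotient.eq_zero_iff_mem,
        hqm]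
      exact hI hr⟩
    rw [Subsingleton.elim z 0, map_zero] at hz
    have : Nontrivial (A ⧸ q.asIdeal) := Ideal.Quotient.nontrivial_iff.2 q.2.ne_top
    exact zero_ne_one hz
  | succ n ih =>
    intro q hq hV hsub
    have hqd : supportDim A (A ⧸ q.asIdeal) = (n + 1 : ℕ) := by
      rwa [supportDim_quotient_eq_ringKrullDim]
    have hqlt : supportDim A (A ⧸ q.asIdeal) < (n + 1 + 1 : ℕ) := by
      rw [hqd]; exact_mod_cast Nat.lt_succ_self _
    have hfin := T.finite_dual_of_support hE hI (n + 1 + 1) n (A ⧸ q.asIdeal) hqlt (by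
      intro p hp hIp
      rw [Module.mem_support_iff_of_finite, Ideal.annihilator_quotient] at hp
      exact hV _ p.2 (sup_le hIp hp))
    let L := T.K E n (A ⧸ q.asIdeal)
    have hqL : ∀ p ∈ associatedPrimes A L, q.asIdeal ≤ p := by
      intro p hp r hr
      refine IsAssociatedPrime.annihilator_le hp ?_
      rw [Submodule.mem_annihilator]
      intro u _
      ext z
      rw [LinearMap.smul_apply, ← _root_.map_smul, T.mem_smul_of_annihilates n, map_zero,
        LinearMap.zero_apply]
      intro m
      obtain ⟨m, rfl⟩ := Ideal.Quotient.mk_surjective m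
      rw [Algebra.smul_def, Ideal.Quotient.algebraMap_eq, Ideal.Quotient.eq_zero_iff_mem.2 hr,
        zero_mul]
    obtain ⟨x, hxI, hxq, hxL⟩ : ∃ x ∈ I, x ∉ q.asIdeal ∧
        ∀ p ∈ associatedPrimes A L, x ∈ p → p = IsLocalRing.maximalIdeal A := by
      by_contra! hcon
      have hfinite : (insert q.asIdeal
          (associatedPrimes A L \ {IsLocalRing.maximalIdeal A})).Finite :=
        ((associatedPrimes.finite A L).sdiff).insert _
      obtain ⟨p, hp, hIp⟩ := (Ideal.subset_union_prime_finite hfinite (f := id) ⊤ ⊤ (by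
        rintro p (rfl | hp) - -
        · exact q.2
        · exact hp.1.1) (I := I)).1 (by
        intro x hx
        by_cases hxq : x ∈ q.asIdeal
        · exact Set.mem_biUnion (Set.mem_insert _ _) hxq
        · obtain ⟨p, hp, hxp, hpm⟩ := hcon x hx hxq
          exact Set.mem_biUnion (Set.mem_insert_of_mem _ ⟨hp, hpm⟩) hxp)
      rcases hp with rfl | hp
      · have h := hV _ q.2 (sup_le hIp le_rfl)
        have hf : IsField (A ⧸ q.asIdeal) :=
          (Ideal.Quotient.maximal_ideal_iff_isField_quotient _).1 (h ▸ inferInstance)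
        rw [ringKrullDim_eq_zero_of_isField hf] at hq
        exact absurd hq (by exact_mod_cast (Nat.succ_ne_zero n).symm)
      · exact hp.2 (hV _ hp.1.1 (sup_le hIp (hqL p hp.1)))
    have hreg := Ideal.Quotient.isSMulRegular_of_notMem hxq
    have hdim : supportDim A (QuotSMulTop x (A ⧸ q.asIdeal)) = n := by
      have h := supportDim_quotSMulTop_succ_eq_supportDim hreg (hI hxI)
      rw [hqd] at h
      push_cast at h
      exact (ENat.WithBot.add_one_cancel).1 h
    have hdimlt : supportDim A (QuotSMulTop x (A ⧸ q.asIdeal)) < (n + 1 : ℕ) := by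
      rw [hdim]; exact_mod_cast Nat.lt_succ_self _
    obtain ⟨q', hq', hq'd⟩ := Module.exists_mem_support_ringKrullDim_eq hdim
    have hqq' : q.asIdeal ≤ q'.asIdeal := by
      have := Module.support_subset_of_surjective _ (Submodule.mkQ_surjective _) hq'
      rwa [Module.mem_support_iff_of_finite, Ideal.annihilator_quotient] at this
    have hne := T.not_subsingleton_of_mem_support n q' hq'd
      (ih q' hq'd fun Q hQ h => hV Q hQ ((sup_le_sup_left hqq' I).trans h)) _ hdimlt hq'
    obtain ⟨δ, hδ, -⟩ := T.exists_connecting_of_isSMulRegular n hreg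
    have hsurj : Function.Surjective
        (T.map n (Submodule.mkQ (x • (⊤ : Submodule A (A ⧸ q.asIdeal))))) :=
      fun z => (hδ z).1 (Subsingleton.elim _ _)
    cases n with
    | zero =>
      have := T.subsingleton_zero_of_isSMulRegular hreg hxI
      exact hne hsurj.subsingleton
    | succ k =>
      let W := T.K E (k + 1) (QuotSMulTop x (A ⧸ q.asIdeal))
      let φ : W →ₗ[A] L := LinearMap.lcomp A E
        (T.map (k + 1) (Submodule.mkQ (x • (⊤ : Submodule A (A ⧸ q.asIdeal)))))
      have hφ : Function.Injective φ := LinearMap.lcomp_injective_of_surjective _ hsurj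
      have hW : Nontrivial W := by
        by_contra h
        rw [not_nontrivial_iff_subsingleton] at h
        exact hne (@IsDualizing.subsingleton_of_dual _ _ _ _ _ _ hE _ _ _ h)
      obtain ⟨p, hp⟩ := associatedPrimes.nonempty A W
      have hpm : p = IsLocalRing.maximalIdeal A := by
        refine hxL p (associatedPrimes.subset_of_injective hφ hp)
          (IsAssociatedPrime.annihilator_le hp ?_)
        rw [Submodule.mem_annihilator]
        intro u _
        ext z
        rw [LinearMap.smul_apply, ← _root_.map_smul, T.mem_smul_of_annihilates (k + 1), map_zero,
          LinearMap.zero_apply]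
        intro m
        obtain ⟨m, rfl⟩ := Submodule.mkQ_surjective _ m
        rw [← _root_.map_smul, Submodule.mkQ_apply, Submodule.Quotient.mk_eq_zero]
        exact Submodule.smul_mem_pointwise_smul _ _ _ Submodule.mem_top
      obtain ⟨y, hym, hy⟩ : ∃ y ∈ IsLocalRing.maximalIdeal A,
          ∀ p ∈ (Module.annihilator A (QuotSMulTop x (A ⧸ q.asIdeal))).minimalPrimes, y ∉ p := by
        by_contra! hcon
        obtain ⟨p, hp, hmp⟩ := (Ideal.subset_union_prime_finite
          (Ideal.finite_minimalPrimes_of_isNoetherianRing A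
            (Module.annihilator A (QuotSMulTop x (A ⧸ q.asIdeal)))) (f := id) ⊤ ⊤
          (fun p hp _ _ => hp.1.1) (I := IsLocalRing.maximalIdeal A)).1 (by
            intro y hy
            obtain ⟨p, hp, hyp⟩ := hcon y hy
            exact Set.mem_biUnion hp hyp)
        rw [Module.mem_support_iff_of_finite] at hq'
        have hpm := hmp.antisymm (IsLocalRing.le_maximalIdeal hp.1.1.ne_top)
        have h := hp.2 ⟨q'.2, hq'⟩ (by
          rw [← show _ = p from hpm]
          exact IsLocalRing.le_maximalIdeal q'.2.ne_top)
        have h2 : q'.asIdeal = IsLocalRing.maximalIdeal A :=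
          (IsLocalRing.le_maximalIdeal q'.2.ne_top).antisymm (hmp.trans h)
        have hf : IsField (A ⧸ q'.asIdeal) :=
          (Ideal.Quotient.maximal_ideal_iff_isField_quotient _).1 (h2 ▸ inferInstance)
        rw [ringKrullDim_eq_zero_of_isField hf] at hq'd
        exact absurd hq'd (by exact_mod_cast (Nat.succ_ne_zero k).symm)
      obtain ⟨hpp, w, hw⟩ := isAssociatedPrime_iff.1 hp
      have hyw : y • w = 0 := by
        rw [← hpm, hw, Submodule.mem_colon_singleton] at hym
        exact hym
      have hw0 : w = 0 := by
        ext z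
        obtain ⟨z, rfl⟩ := T.smul_surjective_of_supportDim_quotSMulTop_lt hdimlt
          (supportDim_quotSMulTop_lt hdimlt hy) z
        change w (y • z) = 0
        rw [_root_.map_smul, ← LinearMap.smul_apply, hyw, LinearMap.zero_apply]
      refine hpp.ne_top ((Ideal.eq_top_iff_one _).2 ?_)
      rw [hw, Submodule.mem_colon_singleton, hw0, smul_zero]
      exact Submodule.zero_mem _

/-- Nonvanishing criterion in the top degree over a complete local ring. -/
theorem nontrivial_top_iff [IsAdicComplete (IsLocalRing.maximalIdeal A) A]
    (hI : I ≤ IsLocalRing.maximalIdeal A) (n : ℕ)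
    (N : Type) [AddCommGroup N] [Module A N] [Module.Finite A N]
    (hN : supportDim A N < (n + 1 : ℕ)) :
    Nontrivial (T.H n N) ↔
    ∃ q ∈ Module.support A N, ringKrullDim (A ⧸ q.asIdeal) = n ∧
      ∀ Q : Ideal A, Q.IsPrime → I ⊔ q.asIdeal ≤ Q → Q = IsLocalRing.maximalIdeal A := by
  rw [← not_subsingleton_iff_nontrivial]
  refine ⟨T.exists_prime_of_nontrivial_top hI n N hN, ?_⟩
  rintro ⟨q, hqN, hq, hV⟩
  exact T.not_subsingleton_of_mem_support n q hq (T.not_subsingleton_top_quotient hI n q hq hV)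
    N hN hqN

end LocalCohomologyTheory

namespace CategoryTheory.ShortComplex

variable {D : Type 1} [Category.{0} D] [Abelian D] {S S' : ShortComplex D} {T : D}

/-- The functional on the homology of `S` induced by a morphism on the middle object. -/
noncomputable def homologyDesc (x : S.X₂ ⟶ T) (hx : S.f ≫ x = 0) : S.homology ⟶ T :=
  S.homologyι ≫ S.descOpcycles x hx

theorem homologyDesc_surjective [Injective T] (y : S.homology ⟶ T) :
    ∃ (x : S.X₂ ⟶ T) (hx : S.f ≫ x = 0), homologyDesc x hx = y := by
  refine ⟨S.pOpcycles ≫ Injective.factorThru y S.homologyι, by simp, ?_⟩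
  have : S.descOpcycles (S.pOpcycles ≫ Injective.factorThru y S.homologyι) (by simp) =
      Injective.factorThru y S.homologyι := by
    rw [← cancel_epi S.pOpcycles, p_descOpcycles]
  rw [homologyDesc, this, Injective.comp_factorThru]

theorem homologyDesc_eq_zero_iff [Injective T] (x : S.X₂ ⟶ T) (hx : S.f ≫ x = 0) :
    homologyDesc x hx = 0 ↔ ∃ w : S.X₃ ⟶ T, x = S.g ≫ w := by
  constructor
  · intro h
    have hex : (ShortComplex.mk S.homologyι S.fromOpcycles (by simp)).Exact :=
      ShortComplex.exact_of_f_is_kernel _ S.homologyIsKernel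
    refine ⟨hex.descToInjective (S.descOpcycles x hx) h, ?_⟩
    have h2 : S.fromOpcycles ≫ hex.descToInjective (S.descOpcycles x hx) h = S.descOpcycles x hx :=
      hex.comp_descToInjective (S.descOpcycles x hx) h
    have h3 := congrArg (fun t => S.pOpcycles ≫ t) h2
    simp only [p_descOpcycles, p_fromOpcycles_assoc] at h3
    exact h3.symm
  · rintro ⟨w, rfl⟩
    have : S.descOpcycles (S.g ≫ w) hx = S.fromOpcycles ≫ w := by
      rw [← cancel_epi S.pOpcycles, p_descOpcycles]
      simp
    rw [homologyDesc, this]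
    simp

theorem homologyDesc_naturality (f : S ⟶ S') (x : S'.X₂ ⟶ T) (hx : S'.f ≫ x = 0) :
    homologyMap f ≫ homologyDesc x hx =
      homologyDesc (f.τ₂ ≫ x) (by rw [← Category.assoc, ← f.comm₁₂, Category.assoc, hx, Limits.comp_zero]) := by
  rw [homologyDesc, homologyDesc, ← Category.assoc, homologyι_naturality, Category.assoc]
  congr 1
  rw [← cancel_epi S.pOpcycles]
  simp

theorem homologyDesc_add (x y : S.X₂ ⟶ T) (hx : S.f ≫ x = 0) (hy : S.f ≫ y = 0) :
    homologyDesc (x + y) (by rw [Preadditive.comp_add, hx, hy, add_zero]) =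
      homologyDesc x hx + homologyDesc y hy := by
  simp only [homologyDesc]
  refine Eq.trans ?_ (Preadditive.comp_add _ _ _ _ _ _)
  congr 1
  rw [← cancel_epi S.pOpcycles]
  simp

theorem homologyDesc_comp {T' : D} (x : S.X₂ ⟶ T) (hx : S.f ≫ x = 0) (r : T ⟶ T') :
    homologyDesc x hx ≫ r = homologyDesc (x ≫ r) (by rw [← Category.assoc, hx, Limits.zero_comp]) := by
  rw [homologyDesc, homologyDesc, Category.assoc]
  congr 1
  rw [← cancel_epi S.pOpcycles]
  simp

end CategoryTheory.ShortComplex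


namespace ModuleCat

variable {R : Type} [CommRing R]

/-- The morphism from the free module of rank one given by an element. -/
def ofElement {M : ModuleCat.{0} R} (m : M) : ModuleCat.of R R ⟶ M :=
  ModuleCat.ofHom (LinearMap.toSpanSingleton R M m)

theorem ofElement_apply_one {M : ModuleCat.{0} R} (m : M) : (ofElement m).hom 1 = m := by
  simp [ofElement]

theorem ofElement_hom_one {M : ModuleCat.{0} R} (f : ModuleCat.of R R ⟶ M) :
    ofElement (f.hom 1) = f := by
  ext
  simp [ofElement]

theorem ofElement_injective {M : ModuleCat.{0} R} {m m' : M} (h : ofElement m = ofElement m') :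
    m = m' := by
  rw [← ofElement_apply_one m, h, ofElement_apply_one]

theorem ofElement_comp {M N : ModuleCat.{0} R} (m : M) (f : M ⟶ N) :
    ofElement m ≫ f = ofElement (f.hom m) := by
  ext
  simp [ofElement]

theorem ofElement_add {M : ModuleCat.{0} R} (m m' : M) :
    ofElement (m + m') = ofElement m + ofElement m' := by
  ext
  simp [ofElement]

theorem ofElement_smul {M : ModuleCat.{0} R} (r : R) (m : M) :
    ofElement (r • m) = (r • 𝟙 (ModuleCat.of R R)) ≫ ofElement m := by
  ext
  simp [ofElement]

theorem ofElement_zero {M : ModuleCat.{0} R} : ofElement (0 : M) = 0 := by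
  ext
  simp [ofElement]

end ModuleCat

open Opposite

namespace ExtCocycle

variable {R : Type} [CommRing R] {X X' : ModuleCat.{0} R} (P : ProjectiveResolution X)
  (P' : ProjectiveResolution X')

noncomputable abbrev F (Y : ModuleCat.{0} R) : ModuleCat.{0} R ⥤ (ModuleCat.{0} R)ᵒᵖ :=
  ((linearYoneda R (ModuleCat.{0} R)).obj Y).rightOp

/-- The complex of morphisms to `Y`, in the opposite category. -/
noncomputable abbrev cpx (Y : ModuleCat.{0} R) : ChainComplex (ModuleCat.{0} R)ᵒᵖ ℕ :=
  ((F Y).mapHomologicalComplex _).obj P.complex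

/-- A cochain viewed as a functional on the opposite complex. -/
noncomputable def toFunctional {i : ℕ} {Y : ModuleCat.{0} R} (ζ : P.complex.X i ⟶ Y) :
    ((cpx P Y).sc i).X₂ ⟶ op (ModuleCat.of R R) :=
  (ModuleCat.ofElement (M := ((linearYoneda R (ModuleCat.{0} R)).obj Y).obj
    (op (P.complex.X i))) ζ).op

variable {P} in
theorem toFunctional_injective {i : ℕ} {Y : ModuleCat.{0} R} {ζ ζ' : P.complex.X i ⟶ Y}
    (h : toFunctional P ζ = toFunctional P ζ') : ζ = ζ' :=
  ModuleCat.ofElement_injective (M := ((linearYoneda R (ModuleCat.{0} R)).obj Y).obj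
    (op (P.complex.X i))) (Quiver.Hom.op_inj h)

theorem toFunctional_surjective {i : ℕ} {Y : ModuleCat.{0} R}
    (x : ((cpx P Y).sc i).X₂ ⟶ op (ModuleCat.of R R)) :
    ∃ ζ : P.complex.X i ⟶ Y, toFunctional P ζ = x :=
  ⟨(show ModuleCat.of R R ⟶ ((linearYoneda R (ModuleCat.{0} R)).obj Y).obj
    (op (P.complex.X i)) from x.unop).hom 1, Quiver.Hom.unop_inj (ModuleCat.ofElement_hom_one _)⟩

theorem toFunctional_add {i : ℕ} {Y : ModuleCat.{0} R} (ζ ζ' : P.complex.X i ⟶ Y) :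
    toFunctional P (ζ + ζ') = toFunctional P ζ + toFunctional P ζ' :=
  congrArg Quiver.Hom.op (ModuleCat.ofElement_add (M := ((linearYoneda R (ModuleCat.{0} R)).obj
    Y).obj (op (P.complex.X i))) ζ ζ')

theorem toFunctional_zero {i : ℕ} {Y : ModuleCat.{0} R} :
    toFunctional P (0 : P.complex.X i ⟶ Y) = 0 :=
  congrArg Quiver.Hom.op (ModuleCat.ofElement_zero (M := ((linearYoneda R (ModuleCat.{0} R)).obj
    Y).obj (op (P.complex.X i))))

theorem toFunctional_smul {i : ℕ} {Y : ModuleCat.{0} R} (r : R) (ζ : P.complex.X i ⟶ Y) :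
    toFunctional P (r • ζ) = toFunctional P ζ ≫ (r • 𝟙 (ModuleCat.of R R)).op :=
  congrArg Quiver.Hom.op (ModuleCat.ofElement_smul (M := ((linearYoneda R (ModuleCat.{0} R)).obj
    Y).obj (op (P.complex.X i))) r ζ)

theorem d_comp_toFunctional {i : ℕ} {Y : ModuleCat.{0} R} (ζ : P.complex.X i ⟶ Y) (j : ℕ) :
    (cpx P Y).d j i ≫ toFunctional P ζ = toFunctional P (i := j) (P.complex.d j i ≫ ζ) := by
  apply Quiver.Hom.unop_inj
  exact ModuleCat.ofElement_comp (M := ((linearYoneda R (ModuleCat.{0} R)).obj Y).obj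
    (op (P.complex.X i))) ζ (((linearYoneda R (ModuleCat.{0} R)).obj Y).map (P.complex.d j i).op)

theorem f_comp_toFunctional_iff {i : ℕ} {Y : ModuleCat.{0} R} (ζ : P.complex.X i ⟶ Y) :
    ((cpx P Y).sc i).f ≫ toFunctional P ζ = 0 ↔ P.complex.d (i + 1) i ≫ ζ = 0 := by
  have h := d_comp_toFunctional P ζ ((ComplexShape.down ℕ).prev i)
  have hp : (ComplexShape.down ℕ).prev i = i + 1 := ChainComplex.prev ℕ i
  have h1 : ((cpx P Y).sc i).f ≫ toFunctional P ζ =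
      toFunctional P (P.complex.d ((ComplexShape.down ℕ).prev i) i ≫ ζ) := h
  rw [h1]
  constructor
  · intro h0
    have := toFunctional_injective (h0.trans (toFunctional_zero P).symm)
    rwa [hp] at this
  · intro h0
    have : P.complex.d ((ComplexShape.down ℕ).prev i) i ≫ ζ = 0 := by rw [hp]; exact h0
    rw [this]
    exact toFunctional_zero P

/-- The `Ext` module, computed by a projective resolution. -/
noncomputable def extIso (i : ℕ) (Y : ModuleCat.{0} R) :
    op (((Ext R (ModuleCat.{0} R) i).obj (op X)).obj Y) ≅ ((cpx P Y).sc i).homology :=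
  P.isoLeftDerivedObj (F Y) i

/-- An element of an `Ext` module is represented by a cocycle. -/
def Rep {i : ℕ} {Y : ModuleCat.{0} R} (ζ : P.complex.X i ⟶ Y)
    (e : ((Ext R (ModuleCat.{0} R) i).obj (op X)).obj Y) : Prop :=
  ∃ hζ : ((cpx P Y).sc i).f ≫ toFunctional P ζ = 0,
    (ModuleCat.ofElement e).op = (extIso P i Y).hom ≫
      ShortComplex.homologyDesc (toFunctional P ζ) hζ

variable {P}

theorem Rep.cocycle {i : ℕ} {Y : ModuleCat.{0} R} {ζ : P.complex.X i ⟶ Y}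
    {e : ((Ext R (ModuleCat.{0} R) i).obj (op X)).obj Y} (h : Rep P ζ e) :
    P.complex.d (i + 1) i ≫ ζ = 0 :=
  (f_comp_toFunctional_iff P ζ).1 h.1

theorem exists_rep_of_cocycle {i : ℕ} {Y : ModuleCat.{0} R} {ζ : P.complex.X i ⟶ Y}
    (h : P.complex.d (i + 1) i ≫ ζ = 0) :
    ∃ e : ((Ext R (ModuleCat.{0} R) i).obj (op X)).obj Y, Rep P ζ e := by
  let y : op (((Ext R (ModuleCat.{0} R) i).obj (op X)).obj Y) ⟶ op (ModuleCat.of R R) :=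
    (extIso P i Y).hom ≫
      ShortComplex.homologyDesc (S := (cpx P Y).sc i) (toFunctional P ζ)
        ((f_comp_toFunctional_iff P ζ).2 h)
  exact ⟨y.unop.hom 1, (f_comp_toFunctional_iff P ζ).2 h,
    congrArg Quiver.Hom.op (ModuleCat.ofElement_hom_one y.unop)⟩

variable (P) in
theorem exists_rep {i : ℕ} {Y : ModuleCat.{0} R}
    (e : ((Ext R (ModuleCat.{0} R) i).obj (op X)).obj Y) :
    ∃ ζ : P.complex.X i ⟶ Y, Rep P ζ e := by
  obtain ⟨x, hx, hxe⟩ := ShortComplex.homologyDesc_surjective (S := (cpx P Y).sc i)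
    ((extIso P i Y).inv ≫ (ModuleCat.ofElement e).op)
  obtain ⟨ζ, rfl⟩ := toFunctional_surjective P x
  refine ⟨ζ, hx, ?_⟩
  rw [hxe, Iso.hom_inv_id_assoc]

theorem Rep.add {i : ℕ} {Y : ModuleCat.{0} R} {ζ ζ' : P.complex.X i ⟶ Y}
    {e e' : ((Ext R (ModuleCat.{0} R) i).obj (op X)).obj Y} (h : Rep P ζ e) (h' : Rep P ζ' e') :
    Rep P (ζ + ζ') (e + e') := by
  obtain ⟨h1, h2⟩ := h
  obtain ⟨h1', h2'⟩ := h'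
  refine ⟨by rw [toFunctional_add, Preadditive.comp_add, h1, h1', add_zero], ?_⟩
  simp only [toFunctional_add]
  rw [ShortComplex.homologyDesc_add _ _ h1 h1', Preadditive.comp_add, ← h2, ← h2',
    ModuleCat.ofElement_add]
  rfl

theorem Rep.smul {i : ℕ} {Y : ModuleCat.{0} R} {ζ : P.complex.X i ⟶ Y}
    {e : ((Ext R (ModuleCat.{0} R) i).obj (op X)).obj Y} (r : R) (h : Rep P ζ e) :
    Rep P (r • ζ) (r • e) := by
  obtain ⟨h1, h2⟩ := h
  refine ⟨by rw [toFunctional_smul, ← Category.assoc, h1, Limits.zero_comp], ?_⟩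
  simp only [toFunctional_smul]
  rw [← ShortComplex.homologyDesc_comp _ h1, ← Category.assoc, ← h2, ModuleCat.ofElement_smul]
  rfl

theorem Rep.eq_zero_iff {i : ℕ} {Y : ModuleCat.{0} R} {ζ : P.complex.X i ⟶ Y}
    {e : ((Ext R (ModuleCat.{0} R) i).obj (op X)).obj Y} (h : Rep P ζ e) :
    e = 0 ↔ ∃ (j : ℕ) (w : P.complex.X j ⟶ Y), ζ = P.complex.d i j ≫ w := by
  obtain ⟨h1, h2⟩ := h
  have h3 : e = 0 ↔ ShortComplex.homologyDesc (S := (cpx P Y).sc i) (toFunctional P ζ) h1 = 0 := by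
    constructor
    · rintro rfl
      rw [← cancel_epi (extIso P i Y).hom, ← h2, ModuleCat.ofElement_zero,
        Limits.comp_zero]
      rfl
    · intro h0
      rw [h0, Limits.comp_zero] at h2
      refine ModuleCat.ofElement_injective ((Quiver.Hom.op_inj h2).trans ?_)
      exact ModuleCat.ofElement_zero.symm
  rw [h3, ShortComplex.homologyDesc_eq_zero_iff]
  constructor
  · rintro ⟨w, hw⟩
    obtain ⟨w, rfl⟩ := toFunctional_surjective P (i := (ComplexShape.down ℕ).next i) w
    exact ⟨_, w, toFunctional_injective (hw.trans (d_comp_toFunctional P w i))⟩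
  · rintro ⟨j, w, rfl⟩
    by_cases hj : (ComplexShape.down ℕ).Rel i j
    · obtain rfl := (ComplexShape.down ℕ).next_eq' hj
      exact ⟨toFunctional P w, (d_comp_toFunctional P w i).symm⟩
    · refine ⟨0, ?_⟩
      rw [P.complex.shape i j hj, Limits.zero_comp, Limits.comp_zero]
      exact toFunctional_zero P

theorem extIso_hom_map {i : ℕ} {Y Y' : ModuleCat.{0} R} (f : Y ⟶ Y') :
    (((Ext R (ModuleCat.{0} R) i).obj (op X)).map f).op ≫ (extIso P i Y).hom =
      (extIso P i Y').hom ≫ ShortComplex.homologyMap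
        ((HomologicalComplex.shortComplexFunctor _ (ComplexShape.down ℕ) i).map
          ((NatTrans.mapHomologicalComplex (NatTrans.rightOp
            ((linearYoneda R (ModuleCat.{0} R)).map f)) _).app P.complex)) := by
  have key : ∀ {D : Type 1} [Category.{0} D] {A B A' B' : D} {u : A ⟶ A'} {e : A ≅ B}
      {e' : A' ≅ B'} {m : B ⟶ B'}, u = e.hom ≫ m ≫ e'.inv → u ≫ e'.hom = e.hom ≫ m := by
    rintro D _ A B A' B' u e e' m rfl
    simp
  exact key (e := extIso P i Y') (e' := extIso P i Y) (P.leftDerived_app_eq (NatTrans.rightOp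
    ((linearYoneda R (ModuleCat.{0} R)).map f)) i)

theorem Rep.map {i : ℕ} {Y Y' : ModuleCat.{0} R} {ζ : P.complex.X i ⟶ Y}
    {e : ((Ext R (ModuleCat.{0} R) i).obj (op X)).obj Y} (f : Y ⟶ Y') (h : Rep P ζ e) :
    Rep P (ζ ≫ f) ((((Ext R (ModuleCat.{0} R) i).obj (op X)).map f).hom e) := by
  obtain ⟨h1, h2⟩ := h
  refine ⟨(f_comp_toFunctional_iff P _).2 ?_, ?_⟩
  · rw [← Category.assoc, (f_comp_toFunctional_iff P ζ).1 h1, Limits.zero_comp]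
  · have h3 := congrArg (fun t => (((Ext R (ModuleCat.{0} R) i).obj (op X)).map f).op ≫ t) h2
    have h4 := congrArg Quiver.Hom.op (ModuleCat.ofElement_comp e
      (((Ext R (ModuleCat.{0} R) i).obj (op X)).map f))
    rw [op_comp] at h4
    rw [← Category.assoc, extIso_hom_map, Category.assoc,
      ShortComplex.homologyDesc_naturality] at h3
    rw [← h4]
    refine h3.trans ?_
    congr 2
    exact congrArg Quiver.Hom.op (ModuleCat.ofElement_comp
      (M := ((linearYoneda R (ModuleCat.{0} R)).obj Y).obj (op (P.complex.X i))) ζ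
        (((linearYoneda R (ModuleCat.{0} R)).map f).app (op (P.complex.X i))))

theorem extIso_hom_precomp {i : ℕ} {Y : ModuleCat.{0} R} (g : X ⟶ X')
    (φ : P.complex ⟶ P'.complex) (comm : φ.f 0 ≫ P'.π.f 0 = P.π.f 0 ≫ g) :
    (((Ext R (ModuleCat.{0} R) i).map g.op).app Y).op ≫ (extIso P' i Y).hom =
      (extIso P i Y).hom ≫ ShortComplex.homologyMap
        ((HomologicalComplex.shortComplexFunctor _ (ComplexShape.down ℕ) i).map
          (((F Y).mapHomologicalComplex _).map φ)) :=
  ProjectiveResolution.isoLeftDerivedObj_hom_naturality g P P' φ comm (F Y) i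

theorem Rep.precomp {P' : ProjectiveResolution X'} {i : ℕ} {Y : ModuleCat.{0} R}
    {ζ : P'.complex.X i ⟶ Y}
    {e : ((Ext R (ModuleCat.{0} R) i).obj (op X')).obj Y} (h : Rep P' ζ e) (g : X ⟶ X')
    (φ : P.complex ⟶ P'.complex) (comm : φ.f 0 ≫ P'.π.f 0 = P.π.f 0 ≫ g) :
    Rep P (φ.f i ≫ ζ) ((((Ext R (ModuleCat.{0} R) i).map g.op).app Y).hom e) := by
  obtain ⟨h1, h2⟩ := h
  refine ⟨(f_comp_toFunctional_iff P _).2 ?_, ?_⟩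
  · rw [← Category.assoc, ← φ.comm, Category.assoc, (f_comp_toFunctional_iff P' ζ).1 h1,
      Limits.comp_zero]
  · have h3 := congrArg (fun t => (((Ext R (ModuleCat.{0} R) i).map g.op).app Y).op ≫ t) h2
    have h4 := congrArg Quiver.Hom.op (ModuleCat.ofElement_comp e
      (((Ext R (ModuleCat.{0} R) i).map g.op).app Y))
    rw [op_comp] at h4
    rw [← Category.assoc, extIso_hom_precomp _ g φ comm, Category.assoc,
      ShortComplex.homologyDesc_naturality] at h3
    rw [← h4]
    refine h3.trans ?_
    congr 2

end ExtCocycle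

namespace localCohomology

variable {R : Type} [CommRing R] (a : Ideal R)

/-- A projective resolution of `R ⧸ a ^ n`. -/
noncomputable def powRes (n : ℕ) : ProjectiveResolution (ModuleCat.of R (R ⧸ a ^ n)) :=
  projectiveResolution _

/-- The projection `R ⧸ a ^ m ⟶ R ⧸ a ^ n`. -/
noncomputable def powProj {n m : ℕ} (h : n ≤ m) :
    ModuleCat.of R (R ⧸ a ^ m) ⟶ ModuleCat.of R (R ⧸ a ^ n) :=
  ModuleCat.ofHom (Submodule.mapQ _ _ LinearMap.id (Ideal.pow_le_pow_right h))

/-- The lift of the projection `R ⧸ a ^ m ⟶ R ⧸ a ^ n` to the resolutions. -/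
noncomputable def powLift {n m : ℕ} (h : n ≤ m) :
    (powRes a m).complex ⟶ (powRes a n).complex :=
  ProjectiveResolution.lift (powProj a h) _ _

theorem powLift_comm {n m : ℕ} (h : n ≤ m) :
    (powLift a h).f 0 ≫ (powRes a n).π.f 0 = (powRes a m).π.f 0 ≫ powProj a h :=
  ProjectiveResolution.lift_commutes_zero _ _ _

/-- The structure morphism to local cohomology. -/
noncomputable def toLC (n i : ℕ) (Y : ModuleCat.{0} R) :
    ((Ext R (ModuleCat.{0} R) i).obj (op (ModuleCat.of R (R ⧸ a ^ n)))).obj Y ⟶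
      (localCohomology a i).obj Y :=
  (Limits.colimit.ι (diagram (idealPowersDiagram a) i) (op (op n))).app Y

theorem toLC_naturality (n i : ℕ) {Y Y' : ModuleCat.{0} R} (f : Y ⟶ Y') :
    ((Ext R (ModuleCat.{0} R) i).obj (op (ModuleCat.of R (R ⧸ a ^ n)))).map f ≫ toLC a n i Y' =
      toLC a n i Y ≫ (localCohomology a i).map f :=
  (Limits.colimit.ι (diagram (idealPowersDiagram a) i) (op (op n))).naturality f

/-- Local cohomology as a colimit. -/
noncomputable def isColimitEval (i : ℕ) (Y : ModuleCat.{0} R) :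
    Limits.IsColimit (((evaluation (ModuleCat.{0} R) (ModuleCat.{0} R)).obj Y).mapCocone
      (Limits.colimit.cocone (diagram (idealPowersDiagram a) i))) :=
  Limits.isColimitOfPreserves _ (Limits.colimit.isColimit _)

theorem toLC_transition {n m : ℕ} (h : n ≤ m) (i : ℕ) (Y : ModuleCat.{0} R) :
    ((Ext R (ModuleCat.{0} R) i).map (powProj a h).op).app Y ≫ toLC a m i Y = toLC a n i Y :=
  congrArg (fun t => NatTrans.app t Y)
    (Limits.colimit.w (diagram (idealPowersDiagram a) i)
      (show op (op n) ⟶ op (op m) from (homOfLE h).op.op))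

theorem exists_toLC (i : ℕ) (Y : ModuleCat.{0} R) (z : (localCohomology a i).obj Y) :
    ∃ (n : ℕ) (e : ((Ext R (ModuleCat.{0} R) i).obj (op (ModuleCat.of R (R ⧸ a ^ n)))).obj Y),
      (toLC a n i Y).hom e = z := by
  obtain ⟨⟨⟨n⟩⟩, e, he⟩ := Limits.Concrete.isColimit_exists_rep _ (isColimitEval a i Y) z
  exact ⟨n, e, he⟩

theorem exists_map_eq_zero_of_isColimit {J : Type} [SmallCategory J] [IsFiltered J]
    {G : J ⥤ ModuleCat.{0} R} {c : Limits.Cocone G} (hc : Limits.IsColimit c) {j : J}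
    (x : G.obj j) (hx : (c.ι.app j).hom x = 0) : ∃ (k : J) (f : j ⟶ k), (G.map f).hom x = 0 := by
  obtain ⟨k, f, g, hfg⟩ := (Limits.Concrete.isColimit_rep_eq_iff_exists G hc x (0 : G.obj j)).1
    (hx.trans (map_zero (c.ι.app j).hom).symm)
  exact ⟨k, f, hfg.trans (map_zero (G.map g).hom)⟩

theorem toLC_eq_zero {n i : ℕ} {Y : ModuleCat.{0} R}
    {e : ((Ext R (ModuleCat.{0} R) i).obj (op (ModuleCat.of R (R ⧸ a ^ n)))).obj Y}
    (he : (toLC a n i Y).hom e = 0) :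
    ∃ (m : ℕ) (h : n ≤ m), (((Ext R (ModuleCat.{0} R) i).map (powProj a h).op).app Y).hom e = 0 := by
  obtain ⟨⟨⟨m⟩⟩, f, hf⟩ := exists_map_eq_zero_of_isColimit (isColimitEval a i Y)
    (j := op (op n)) e he
  exact ⟨m, leOfHom f.unop.unop, hf⟩

/-- A class in local cohomology is represented by a cocycle. -/
def Rep (n : ℕ) {i : ℕ} {Y : ModuleCat.{0} R} (ζ : (powRes a n).complex.X i ⟶ Y)
    (z : (localCohomology a i).obj Y) : Prop :=
  ∃ e, ExtCocycle.Rep (powRes a n) ζ e ∧ (toLC a n i Y).hom e = z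

variable {a}
variable {n m i : ℕ} {Y Y' : ModuleCat.{0} R}

variable (a) in
theorem exists_rep (z : (localCohomology a i).obj Y) :
    ∃ (n : ℕ) (ζ : (powRes a n).complex.X i ⟶ Y), Rep a n ζ z := by
  obtain ⟨n, e, he⟩ := exists_toLC a i Y z
  obtain ⟨ζ, hζ⟩ := ExtCocycle.exists_rep (powRes a n) e
  exact ⟨n, ζ, e, hζ, he⟩

theorem exists_rep_of_cocycle {ζ : (powRes a n).complex.X i ⟶ Y}
    (h : (powRes a n).complex.d (i + 1) i ≫ ζ = 0) :
    ∃ z : (localCohomology a i).obj Y, Rep a n ζ z := by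
  obtain ⟨e, he⟩ := ExtCocycle.exists_rep_of_cocycle h
  exact ⟨_, e, he, rfl⟩

theorem Rep.cocycle {ζ : (powRes a n).complex.X i ⟶ Y} {z : (localCohomology a i).obj Y}
    (h : Rep a n ζ z) : (powRes a n).complex.d (i + 1) i ≫ ζ = 0 := by
  obtain ⟨e, he, -⟩ := h
  exact he.cocycle

theorem Rep.add {ζ ζ' : (powRes a n).complex.X i ⟶ Y} {z z' : (localCohomology a i).obj Y}
    (h : Rep a n ζ z) (h' : Rep a n ζ' z') : Rep a n (ζ + ζ') (z + z') := by
  obtain ⟨e, he, rfl⟩ := h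
  obtain ⟨e', he', rfl⟩ := h'
  exact ⟨e + e', he.add he', map_add _ _ _⟩

theorem Rep.smul {ζ : (powRes a n).complex.X i ⟶ Y} {z : (localCohomology a i).obj Y} (r : R)
    (h : Rep a n ζ z) : Rep a n (r • ζ) (r • z) := by
  obtain ⟨e, he, rfl⟩ := h
  exact ⟨r • e, he.smul r, map_smul _ _ _⟩

theorem Rep.neg {ζ : (powRes a n).complex.X i ⟶ Y} {z : (localCohomology a i).obj Y}
    (h : Rep a n ζ z) : Rep a n (-ζ) (-z) := by
  simpa using h.smul (-1)

theorem Rep.sub {ζ ζ' : (powRes a n).complex.X i ⟶ Y} {z z' : (localCohomology a i).obj Y}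
    (h : Rep a n ζ z) (h' : Rep a n ζ' z') : Rep a n (ζ - ζ') (z - z') := by
  simpa [sub_eq_add_neg] using h.add h'.neg

theorem Rep.map {ζ : (powRes a n).complex.X i ⟶ Y} {z : (localCohomology a i).obj Y}
    (h : Rep a n ζ z) (f : Y ⟶ Y') : Rep a n (ζ ≫ f) (((localCohomology a i).map f).hom z) := by
  obtain ⟨e, he, rfl⟩ := h
  exact ⟨_, he.map f, congrArg (fun t => t.hom e) (toLC_naturality a n i f)⟩

theorem Rep.lift {ζ : (powRes a n).complex.X i ⟶ Y} {z : (localCohomology a i).obj Y}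
    (h : Rep a n ζ z) (hnm : n ≤ m) : Rep a m ((powLift a hnm).f i ≫ ζ) z := by
  obtain ⟨e, he, rfl⟩ := h
  exact ⟨_, he.precomp (powProj a hnm) (powLift a hnm) (powLift_comm a hnm),
    congrArg (fun t => t.hom e) (toLC_transition a hnm i Y)⟩

theorem Rep.eq_zero {j : ℕ} {w : (powRes a n).complex.X j ⟶ Y}
    {z : (localCohomology a i).obj Y} (h : Rep a n ((powRes a n).complex.d i j ≫ w) z) : z = 0 := by
  obtain ⟨e, he, rfl⟩ := h
  rw [he.eq_zero_iff.2 ⟨j, w, rfl⟩, map_zero]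

theorem Rep.exists_eq {ζ : (powRes a n).complex.X i ⟶ Y} (h : Rep a n ζ 0) :
    ∃ (m : ℕ) (hnm : n ≤ m) (j : ℕ) (w : (powRes a m).complex.X j ⟶ Y),
      (powLift a hnm).f i ≫ ζ = (powRes a m).complex.d i j ≫ w := by
  obtain ⟨e, he, h0⟩ := h
  obtain ⟨m, hnm, hm⟩ := toLC_eq_zero a h0
  obtain ⟨j, w, hw⟩ := (he.precomp (powProj a hnm) (powLift a hnm)
    (powLift_comm a hnm)).eq_zero_iff.1 hm
  exact ⟨m, hnm, j, w, hw⟩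

end localCohomology

/-- A total additive relation that is single valued at zero is the graph of a homomorphism. -/
theorem AddMonoidHom.exists_of_relation {A B : Type*} [AddCommGroup A] [AddCommGroup B]
    (Q : A → B → Prop) (add : ∀ {a a' b b'}, Q a b → Q a' b' → Q (a + a') (b + b'))
    (total : ∀ a, ∃ b, Q a b) (zero : ∀ {b}, Q 0 b → b = 0) :
    ∃ f : A →+ B, ∀ a b, Q a b ↔ f a = b := by
  have uniq : ∀ {a b b'}, Q a b → Q a b' → b = b' := by
    intro a b b' h h'
    obtain ⟨c, hc⟩ := total (-a)
    have h1 := zero (by simpa using add h hc)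
    have h2 := zero (by simpa using add h' hc)
    exact add_right_cancel (h1.trans h2.symm)
  choose f hf using total
  refine ⟨AddMonoidHom.mk' f fun a a' => uniq (hf _) (add (hf a) (hf a')), fun a b => ⟨fun h =>
    uniq (hf a) h, ?_⟩⟩
  rintro rfl
  exact hf a

namespace ModuleCat

variable {R : Type} [CommRing R] {X Y₁ Y₂ Y₃ : ModuleCat.{0} R}

theorem exists_comp_eq_of_projective [Projective X] {g : Y₂ ⟶ Y₃} (hg : Function.Surjective g.hom)
    (ζ : X ⟶ Y₃) : ∃ η : X ⟶ Y₂, η ≫ g = ζ := by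
  have : Epi g := (ModuleCat.epi_iff_surjective g).2 hg
  exact ⟨Projective.factorThru ζ g, Projective.factorThru_comp ζ g⟩

theorem exists_comp_eq_of_exact {f : Y₁ ⟶ Y₂} {g : Y₂ ⟶ Y₃} (hf : Function.Injective f.hom)
    (hfg : Function.Exact f.hom g.hom) (η : X ⟶ Y₂) (hη : η ≫ g = 0) :
    ∃ ξ : X ⟶ Y₁, ξ ≫ f = η := by
  have h : ∀ x, η.hom x ∈ LinearMap.range f.hom := fun x =>
    (hfg (η.hom x)).1 (congrArg (fun t => t.hom x) hη)
  refine ⟨ModuleCat.ofHom ((LinearEquiv.ofInjective f.hom hf).symm.toLinearMap ∘ₗ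
    η.hom.codRestrict _ h), ?_⟩
  ext x
  exact congrArg Subtype.val ((LinearEquiv.ofInjective f.hom hf).apply_symm_apply
    (η.hom.codRestrict _ h x))

theorem eq_of_comp_eq {f : Y₁ ⟶ Y₂} (hf : Function.Injective f.hom) {ξ ξ' : X ⟶ Y₁}
    (h : ξ ≫ f = ξ' ≫ f) : ξ = ξ' := by
  ext x
  exact hf (congrArg (fun t => t.hom x) h)

theorem comp_eq_zero_of_exact {f : Y₁ ⟶ Y₂} {g : Y₂ ⟶ Y₃}
    (hfg : Function.Exact f.hom g.hom) : f ≫ g = 0 := by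
  ext x
  exact hfg.apply_apply_eq_zero x

end ModuleCat

namespace localCohomology

variable {R : Type} [CommRing R] {a : Ideal R} {n m i : ℕ} {Y Y' Y₁ Y₂ Y₃ : ModuleCat.{0} R}

theorem powLift_d {n m : ℕ} (h : n ≤ m) (i j : ℕ) {Y : ModuleCat.{0} R}
    (w : (powRes a n).complex.X j ⟶ Y) :
    (powLift a h).f i ≫ (powRes a n).complex.d i j ≫ w =
      (powRes a m).complex.d i j ≫ (powLift a h).f j ≫ w := by
  rw [← Category.assoc, ← Category.assoc, (powLift a h).comm]

theorem Rep.unique {ζ : (powRes a n).complex.X i ⟶ Y} {z z' : (localCohomology a i).obj Y}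
    (h : Rep a n ζ z) (h' : Rep a n ζ z') : z = z' := by
  have := h.sub h'
  rw [sub_self, ← Limits.comp_zero (f := (powRes a n).complex.d i 0)] at this
  exact sub_eq_zero.1 this.eq_zero

theorem rep_coboundary {j : ℕ} (w : (powRes a n).complex.X j ⟶ Y) :
    Rep a n ((powRes a n).complex.d i j ≫ w) (0 : (localCohomology a i).obj Y) := by
  obtain ⟨z, hz⟩ := exists_rep_of_cocycle (a := a) (n := n) (i := i)
    (ζ := (powRes a n).complex.d i j ≫ w) (by simp)
  obtain rfl := hz.eq_zero
  exact hz

theorem Rep.sub_coboundary {j : ℕ} {ζ : (powRes a n).complex.X i ⟶ Y}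
    {z : (localCohomology a i).obj Y} (h : Rep a n ζ z) (w : (powRes a n).complex.X j ⟶ Y) :
    Rep a n (ζ - (powRes a n).complex.d i j ≫ w) z := by
  simpa using h.sub (rep_coboundary w)

theorem map_add_hom (f g : Y ⟶ Y') :
    (localCohomology a i).map (f + g) = (localCohomology a i).map f + (localCohomology a i).map g := by
  ext z
  obtain ⟨n, ζ, h⟩ := exists_rep a z
  have h1 := h.map (f + g)
  rw [Preadditive.comp_add] at h1
  exact h1.unique ((h.map f).add (h.map g))

theorem map_smul_hom (r : R) (f : Y ⟶ Y') :
    (localCohomology a i).map (r • f) = r • (localCohomology a i).map f := by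
  ext z
  obtain ⟨n, ζ, h⟩ := exists_rep a z
  have h1 := h.map (r • f)
  rw [Linear.comp_smul] at h1
  exact h1.unique ((h.map f).smul r)

theorem map_zero_hom : (localCohomology a i).map (0 : Y ⟶ Y') = 0 := by
  have := map_smul_hom (a := a) (i := i) (0 : R) (0 : Y ⟶ Y')
  rwa [zero_smul, zero_smul] at this

theorem exact_map {f : Y₁ ⟶ Y₂} {g : Y₂ ⟶ Y₃} (hf : Function.Injective f.hom)
    (hfg : Function.Exact f.hom g.hom) (hg : Function.Surjective g.hom) :
    Function.Exact ((localCohomology a i).map f).hom ((localCohomology a i).map g).hom := by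
  intro z
  constructor
  · intro hz
    obtain ⟨n, ζ, h⟩ := exists_rep a z
    have h1 := h.map g
    rw [hz] at h1
    obtain ⟨m, hnm, j, w, hw⟩ := h1.exists_eq
    obtain ⟨w', rfl⟩ := ModuleCat.exists_comp_eq_of_projective
      (X := (powRes a m).complex.X j) hg w
    have h2 := (h.lift hnm).sub_coboundary w'
    obtain ⟨ξ, hξ⟩ := ModuleCat.exists_comp_eq_of_exact hf hfg
      ((powLift a hnm).f i ≫ ζ - (powRes a m).complex.d i j ≫ w') (by
        rw [Preadditive.sub_comp, Category.assoc, hw, Category.assoc, sub_self])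
    obtain ⟨y, hy⟩ := exists_rep_of_cocycle (a := a) (ζ := ξ) (ModuleCat.eq_of_comp_eq hf (by
      rw [Category.assoc, hξ, h2.cocycle, Limits.zero_comp]))
    have h3 := hy.map f
    rw [hξ] at h3
    exact ⟨y, h3.unique h2⟩
  · rintro ⟨y, rfl⟩
    have h : (localCohomology a i).map f ≫ (localCohomology a i).map g = 0 := by
      rw [← Functor.map_comp, ModuleCat.comp_eq_zero_of_exact hfg, map_zero_hom]
    exact congrArg (fun t => t.hom y) h

variable (a i) in
/-- The graph of the connecting homomorphism. -/
def Connects (f : Y₁ ⟶ Y₂) (g : Y₂ ⟶ Y₃) (z : (localCohomology a i).obj Y₃)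
    (y : (localCohomology a (i + 1)).obj Y₁) : Prop :=
  ∃ (n : ℕ) (η : (powRes a n).complex.X i ⟶ Y₂) (ξ : (powRes a n).complex.X (i + 1) ⟶ Y₁),
    Rep a n (η ≫ g) z ∧ Rep a n ξ y ∧ ξ ≫ f = (powRes a n).complex.d (i + 1) i ≫ η

theorem Connects.exists_lift {f : Y₁ ⟶ Y₂} {g : Y₂ ⟶ Y₃} {z : (localCohomology a i).obj Y₃}
    {y : (localCohomology a (i + 1)).obj Y₁} (h : Connects a i f g z y) :
    ∃ n₀ : ℕ, ∀ n, n₀ ≤ n → ∃ (η : (powRes a n).complex.X i ⟶ Y₂)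
      (ξ : (powRes a n).complex.X (i + 1) ⟶ Y₁),
    Rep a n (η ≫ g) z ∧ Rep a n ξ y ∧ ξ ≫ f = (powRes a n).complex.d (i + 1) i ≫ η := by
  obtain ⟨n, η, ξ, h1, h2, h3⟩ := h
  refine ⟨n, fun m hnm => ⟨(powLift a hnm).f i ≫ η, (powLift a hnm).f (i + 1) ≫ ξ, ?_, h2.lift hnm,
    ?_⟩⟩
  · rw [Category.assoc]
    exact h1.lift hnm
  · rw [Category.assoc, h3, powLift_d]

theorem Connects.map {f : Y₁ ⟶ Y₂} {g : Y₂ ⟶ Y₃} {z : (localCohomology a i).obj Y₃}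
    {y : (localCohomology a (i + 1)).obj Y₁} (h : Connects a i f g z y)
    {Y₁' Y₂' Y₃' : ModuleCat.{0} R} {f' : Y₁' ⟶ Y₂'} {g' : Y₂' ⟶ Y₃'} {u₁ : Y₁ ⟶ Y₁'}
    {u₂ : Y₂ ⟶ Y₂'} {u₃ : Y₃ ⟶ Y₃'} (hf : f ≫ u₂ = u₁ ≫ f') (hg : g ≫ u₃ = u₂ ≫ g') :
    Connects a i f' g' (((localCohomology a i).map u₃).hom z)
      (((localCohomology a (i + 1)).map u₁).hom y) := by
  obtain ⟨n, η, ξ, h1, h2, h3⟩ := h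
  refine ⟨n, η ≫ u₂, ξ ≫ u₁, ?_, h2.map u₁, ?_⟩
  · rw [Category.assoc, ← hg, ← Category.assoc]
    exact h1.map u₃
  · rw [Category.assoc, ← hf, ← Category.assoc, h3, Category.assoc]

theorem Rep.exists_eq_succ {ζ : (powRes a n).complex.X (i + 1) ⟶ Y} (h : Rep a n ζ 0) :
    ∃ (m : ℕ) (hnm : n ≤ m) (w : (powRes a m).complex.X i ⟶ Y),
      (powLift a hnm).f (i + 1) ≫ ζ = (powRes a m).complex.d (i + 1) i ≫ w := by
  obtain ⟨m, hnm, j, w, hw⟩ := h.exists_eq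
  by_cases hj : j + 1 = i + 1
  · obtain rfl : j = i := by omega
    exact ⟨m, hnm, w, hw⟩
  · refine ⟨m, hnm, 0, ?_⟩
    rw [hw, (powRes a m).complex.shape _ _ hj, Limits.zero_comp, Limits.comp_zero]

theorem Rep.exists_eq_zero {ζ : (powRes a n).complex.X 0 ⟶ Y} (h : Rep a n ζ 0) :
    ∃ (m : ℕ) (hnm : n ≤ m), (powLift a hnm).f 0 ≫ ζ = 0 := by
  obtain ⟨m, hnm, j, w, hw⟩ := h.exists_eq
  refine ⟨m, hnm, ?_⟩
  rw [hw, (powRes a m).complex.shape _ _ (Nat.succ_ne_zero j), Limits.zero_comp]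

variable (a i) in
theorem exists_connecting {f : Y₁ ⟶ Y₂} {g : Y₂ ⟶ Y₃} (hf : Function.Injective f.hom)
    (hfg : Function.Exact f.hom g.hom) (hg : Function.Surjective g.hom) :
    ∃ δ : (localCohomology a i).obj Y₃ →+ (localCohomology a (i + 1)).obj Y₁,
      (∀ z y, Connects a i f g z y ↔ δ z = y) ∧
      Function.Exact ((localCohomology a i).map g).hom δ ∧
      Function.Exact δ ((localCohomology a (i + 1)).map f).hom := by
  have total : ∀ n (η : (powRes a n).complex.X i ⟶ Y₂) (z : (localCohomology a i).obj Y₃),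
      Rep a n (η ≫ g) z → ∃ y, Connects a i f g z y := by
    intro n η z h
    obtain ⟨ξ, hξ⟩ := ModuleCat.exists_comp_eq_of_exact hf hfg
      ((powRes a n).complex.d (i + 1) i ≫ η) (by rw [Category.assoc, h.cocycle])
    obtain ⟨y, hy⟩ := exists_rep_of_cocycle (a := a) (ζ := ξ) (ModuleCat.eq_of_comp_eq hf (by
      rw [Category.assoc, hξ]; simp))
    exact ⟨y, n, η, ξ, h, hy, hξ⟩
  obtain ⟨δ, hδ⟩ := AddMonoidHom.exists_of_relation (Connects a i f g) (by
    intro z z' y y' h h'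
    obtain ⟨n, hn⟩ := h.exists_lift
    obtain ⟨n', hn'⟩ := h'.exists_lift
    obtain ⟨η, ξ, h1, h2, h3⟩ := hn (max n n') (le_max_left _ _)
    obtain ⟨η', ξ', h1', h2', h3'⟩ := hn' (max n n') (le_max_right _ _)
    refine ⟨_, η + η', ξ + ξ', ?_, h2.add h2', ?_⟩
    · rw [Preadditive.add_comp]
      exact h1.add h1'
    · rw [Preadditive.add_comp, h3, h3', Preadditive.comp_add]) (by
    intro z
    obtain ⟨n, ζ, h⟩ := exists_rep a z
    obtain ⟨η, rfl⟩ := ModuleCat.exists_comp_eq_of_projective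
      (X := (powRes a n).complex.X i) hg ζ
    exact total n η z h) (by
    rintro y ⟨n, η, ξ, h1, h2, h3⟩
    obtain ⟨m, hnm, j, w, hw⟩ := h1.exists_eq
    obtain ⟨w', rfl⟩ := ModuleCat.exists_comp_eq_of_projective
      (X := (powRes a m).complex.X j) hg w
    obtain ⟨θ, hθ⟩ := ModuleCat.exists_comp_eq_of_exact hf hfg
      ((powLift a hnm).f i ≫ η - (powRes a m).complex.d i j ≫ w') (by
        rw [Preadditive.sub_comp, Category.assoc, hw, Category.assoc, sub_self])
    have h4 : (powLift a hnm).f (i + 1) ≫ ξ = (powRes a m).complex.d (i + 1) i ≫ θ := by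
      apply ModuleCat.eq_of_comp_eq hf
      rw [Category.assoc, h3, Category.assoc, hθ, powLift_d]
      simp
    have h5 := h2.lift hnm
    rw [h4] at h5
    exact h5.eq_zero)
  refine ⟨δ, hδ, fun z => ⟨fun hz => ?_, ?_⟩, fun y => ⟨fun hy => ?_, ?_⟩⟩
  · obtain ⟨n, η, ξ, h1, h2, h3⟩ := (hδ z 0).2 hz
    obtain ⟨m, hnm, w, hw⟩ := h2.exists_eq_succ
    obtain ⟨x, hx⟩ := exists_rep_of_cocycle (a := a) (n := m) (i := i)
      (ζ := (powLift a hnm).f i ≫ η - w ≫ f) (by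
        rw [Preadditive.comp_sub, ← powLift_d, ← h3, ← Category.assoc, hw, Category.assoc,
          sub_self])
    refine ⟨x, (hx.map g).unique (z' := z) ?_⟩
    have h4 := h1.lift hnm
    rw [Preadditive.sub_comp, Category.assoc, Category.assoc,
      ModuleCat.comp_eq_zero_of_exact hfg, Limits.comp_zero, sub_zero]
    exact h4
  · rintro ⟨x, rfl⟩
    obtain ⟨n, ζ, h⟩ := exists_rep a x
    refine (hδ _ _).1 ⟨n, ζ, 0, h.map g, ?_, ?_⟩
    · have := rep_coboundary (a := a) (i := i + 1) (n := n) (j := 0) (0 : _ ⟶ Y₁)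
      rwa [Limits.comp_zero] at this
    · rw [Limits.zero_comp, h.cocycle]
  · obtain ⟨n, ξ, h⟩ := exists_rep a y
    have h1 := h.map f
    rw [hy] at h1
    obtain ⟨m, hnm, η, hη⟩ := h1.exists_eq_succ
    obtain ⟨z, hz⟩ := exists_rep_of_cocycle (a := a) (n := m) (i := i) (ζ := η ≫ g) (by
      rw [← Category.assoc, ← hη, Category.assoc, Category.assoc,
        ModuleCat.comp_eq_zero_of_exact hfg, Limits.comp_zero, Limits.comp_zero])
    exact ⟨z, (hδ _ _).1 ⟨m, η, _, hz, h.lift hnm, by rw [Category.assoc, hη]⟩⟩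
  · rintro ⟨z, rfl⟩
    obtain ⟨n, η, ξ, h1, h2, h3⟩ := (hδ z _).2 rfl
    have h4 := h2.map f
    rw [h3] at h4
    exact h4.eq_zero

theorem map_zero_injective {f : Y ⟶ Y'} (hf : Function.Injective f.hom) :
    Function.Injective ((localCohomology a 0).map f).hom := by
  rw [injective_iff_map_eq_zero]
  intro z hz
  obtain ⟨n, ζ, h⟩ := exists_rep a z
  have h1 := h.map f
  rw [hz] at h1
  obtain ⟨m, hnm, hm⟩ := h1.exists_eq_zero
  have h2 := h.lift hnm
  have h3 : (powLift a hnm).f 0 ≫ ζ = (powRes a m).complex.d 0 0 ≫ 0 := by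
    rw [Limits.comp_zero]
    apply ModuleCat.eq_of_comp_eq hf
    rw [Category.assoc, hm, Limits.zero_comp]
  rw [h3] at h2
  exact h2.eq_zero

variable (a n) in
/-- The augmentation of the resolution of `R ⧸ a ^ n`. -/
noncomputable def powAug : (powRes a n).complex.X 0 ⟶ ModuleCat.of R (R ⧸ a ^ n) :=
  (powRes a n).π.f 0

theorem smul_quotient_eq_zero {r : R} (hr : r ∈ a ^ n) (x : R ⧸ a ^ n) : r • x = 0 := by
  obtain ⟨x, rfl⟩ := Ideal.Quotient.mk_surjective x
  rw [← Ideal.Quotient.mk_eq_mk, ← Submodule.Quotient.mk_smul, Submodule.Quotient.mk_eq_zero]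
  exact Ideal.mul_mem_right _ _ hr

theorem exists_homotopy {r : R} (hr : r ∈ a ^ n) :
    Nonempty (Homotopy (r • 𝟙 (powRes a n).complex) 0) := by
  refine ⟨ProjectiveResolution.liftHomotopyZero _ ?_⟩
  apply HomologicalComplex.to_single_hom_ext
  have h2 : r • powAug a n = 0 := by
    ext y
    exact smul_quotient_eq_zero hr _
  rw [Linear.smul_comp, Category.id_comp]
  exact h2

theorem torsion (z : (localCohomology a i).obj Y) : ∃ n : ℕ, ∀ r ∈ a ^ n, r • z = 0 := by
  obtain ⟨n, ζ, h⟩ := exists_rep a z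
  refine ⟨n, fun r hr => ?_⟩
  obtain ⟨H⟩ := exists_homotopy hr
  have h1 := h.smul r
  have h2 := congrArg (fun t => t ≫ ζ) (H.comm i)
  have h3 : r • ζ = (powRes a n).complex.d i _ ≫ H.hom ((ComplexShape.down ℕ).next i) i ≫ ζ := by
    simp only [HomologicalComplex.smul_f_apply, HomologicalComplex.id_f, Linear.smul_comp,
      Category.id_comp, HomologicalComplex.zero_f, add_zero, Preadditive.add_comp] at h2
    rw [h2]
    have h4 : prevD i H.hom ≫ ζ = 0 := by
      rw [prevD_eq H.hom (show (ComplexShape.down ℕ).Rel (i + 1) i from rfl), Category.assoc, h.cocycle,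
        Limits.comp_zero]
    rw [h4, add_zero, dNext, AddMonoidHom.mk'_apply, Category.assoc]
  rw [h3] at h1
  exact h1.eq_zero

theorem subsingleton_of_injective [Injective Y] : Subsingleton ((localCohomology a (i + 1)).obj Y) := by
  refine subsingleton_of_forall_eq 0 fun z => ?_
  obtain ⟨n, ζ, h⟩ := exists_rep a z
  have h1 := ((powRes a n).exact_succ i).comp_descToInjective ζ h.cocycle
  dsimp at h1
  rw [← h1] at h
  exact h.eq_zero

end localCohomology

namespace localCohomology

variable {R : Type} [CommRing R] {a : Ideal R} {n m i : ℕ} {Y Y' Y₁ Y₂ Y₃ : ModuleCat.{0} R}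

theorem powAug_surjective : Function.Surjective (powAug a n).hom := by
  have : Epi (powAug a n) := inferInstanceAs (Epi ((powRes a n).π.f 0))
  exact (ModuleCat.epi_iff_surjective _).1 this

theorem powAug_comp (f : ModuleCat.of R (R ⧸ a ^ n) ⟶ Y) :
    (powRes a n).complex.d 1 0 ≫ powAug a n ≫ f = 0 := by
  have h : (powRes a n).complex.d 1 0 ≫ powAug a n = 0 := (powRes a n).complex_d_comp_π_f_zero
  rw [← Category.assoc, h, Limits.zero_comp]

theorem apply_eq_zero_of_cocycle {ζ : (powRes a n).complex.X 0 ⟶ Y}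
    (h : (powRes a n).complex.d 1 0 ≫ ζ = 0) {x : (powRes a n).complex.X 0}
    (hx : (powAug a n).hom x = 0) : ζ.hom x = 0 := by
  have h0 := (powRes a n).exact₀
  obtain ⟨y, rfl⟩ := (ShortComplex.moduleCat_exact_iff _).1 h0 x hx
  exact congrArg (fun t => t.hom y) h

theorem apply_eq_of_cocycle {ζ : (powRes a n).complex.X 0 ⟶ Y}
    (h : (powRes a n).complex.d 1 0 ≫ ζ = 0) {x y : (powRes a n).complex.X 0}
    (hx : (powAug a n).hom x = (powAug a n).hom y) : ζ.hom x = ζ.hom y := by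
  rw [← sub_eq_zero, ← map_sub]
  exact apply_eq_zero_of_cocycle h (by rw [map_sub, hx, sub_self])

theorem powAug_powLift (h : n ≤ m) {x : (powRes a m).complex.X 0}
    (hx : (powAug a m).hom x = Ideal.Quotient.mk _ 1) :
    (powAug a n).hom (((powLift a h).f 0).hom x) = Ideal.Quotient.mk _ 1 := by
  have h1 : (powAug a n).hom (((powLift a h).f 0).hom x) = (powProj a h).hom ((powAug a m).hom x) :=
    congrArg (fun t => t.hom x) (powLift_comm a h)
  rw [h1, hx]
  rfl

variable (a) in
/-- The relation between a class of degree zero and the corresponding element. -/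
def Evaluates (z : (localCohomology a 0).obj Y) (y : Y) : Prop :=
  ∃ (n : ℕ) (ζ : (powRes a n).complex.X 0 ⟶ Y), Rep a n ζ z ∧
    ∃ x, (powAug a n).hom x = Ideal.Quotient.mk _ 1 ∧ ζ.hom x = y

theorem exists_powAug_eq_one (n : ℕ) :
    ∃ x, (powAug a n).hom x = Ideal.Quotient.mk (a ^ n) 1 := powAug_surjective _

theorem Evaluates.lift {z : (localCohomology a 0).obj Y} {y : Y} (h : Evaluates a z y) :
    ∃ n₀, ∀ n, n₀ ≤ n → ∃ (ζ : (powRes a n).complex.X 0 ⟶ Y), Rep a n ζ z ∧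
      ∀ x, (powAug a n).hom x = Ideal.Quotient.mk _ 1 → ζ.hom x = y := by
  obtain ⟨n, ζ, h1, x, hx, rfl⟩ := h
  refine ⟨n, fun m hnm => ⟨_, h1.lift hnm, fun x' hx' => ?_⟩⟩
  exact apply_eq_of_cocycle h1.cocycle ((powAug_powLift hnm hx').trans hx.symm)

theorem Evaluates.map {z : (localCohomology a 0).obj Y} {y : Y} (h : Evaluates a z y)
    (f : Y ⟶ Y') : Evaluates a (((localCohomology a 0).map f).hom z) (f.hom y) := by
  obtain ⟨n, ζ, h1, x, hx, rfl⟩ := h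
  exact ⟨n, _, h1.map f, x, hx, rfl⟩

theorem exists_smul_powAug {x : (powRes a n).complex.X 0}
    (hx : (powAug a n).hom x = Ideal.Quotient.mk _ 1) (y : (powRes a n).complex.X 0) :
    ∃ r : R, (powAug a n).hom y = (powAug a n).hom (r • x) := by
  obtain ⟨r, hr⟩ := Ideal.Quotient.mk_surjective ((powAug a n).hom y)
  refine ⟨r, ?_⟩
  rw [map_smul, hx, ← hr]
  change _ = Ideal.Quotient.mk _ (r * 1)
  rw [mul_one]

variable (a Y) in
theorem exists_evaluation : ∃ ι : (localCohomology a 0).obj Y →+ Y,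
    (∀ z y, Evaluates a z y ↔ ι z = y) ∧ Function.Injective ι ∧
      ∀ y : Y, (∃ n : ℕ, ∀ r ∈ a ^ n, r • y = 0) → ∃ z, ι z = y := by
  obtain ⟨ι, hι⟩ := AddMonoidHom.exists_of_relation (Evaluates a (Y := Y)) (by
    intro z z' y y' h h'
    obtain ⟨n, hn⟩ := h.lift
    obtain ⟨n', hn'⟩ := h'.lift
    obtain ⟨ζ, h1, h2⟩ := hn (max n n') (le_max_left _ _)
    obtain ⟨ζ', h1', h2'⟩ := hn' (max n n') (le_max_right _ _)
    obtain ⟨x, hx⟩ := exists_powAug_eq_one (a := a) (max n n')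
    refine ⟨_, _, h1.add h1', x, hx, ?_⟩
    rw [← h2 x hx, ← h2' x hx]
    rfl) (by
    intro z
    obtain ⟨n, ζ, h⟩ := exists_rep a z
    obtain ⟨x, hx⟩ := exists_powAug_eq_one (a := a) n
    exact ⟨_, n, ζ, h, x, hx, rfl⟩) (by
    rintro y ⟨n, ζ, h, x, hx, rfl⟩
    obtain ⟨m, hnm, hm⟩ := h.exists_eq_zero
    obtain ⟨x', hx'⟩ := exists_powAug_eq_one (a := a) m
    rw [apply_eq_of_cocycle h.cocycle (hx.trans (powAug_powLift hnm hx').symm)]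
    exact congrArg (fun t => t.hom x') hm)
  refine ⟨ι, hι, ?_, ?_⟩
  · rw [injective_iff_map_eq_zero]
    intro z hz
    obtain ⟨n, ζ, h, x, hx, h0⟩ := (hι z 0).2 hz
    have h1 : ζ = (powRes a n).complex.d 0 0 ≫ 0 := by
      rw [Limits.comp_zero]
      ext y
      obtain ⟨r, hr⟩ := exists_smul_powAug hx y
      rw [apply_eq_of_cocycle h.cocycle hr, map_smul, h0, smul_zero]
      rfl
    rw [h1] at h
    exact h.eq_zero
  · rintro y ⟨n, hn⟩
    let f : (R ⧸ a ^ n) →ₗ[R] Y := (a ^ n).liftQ (LinearMap.toSpanSingleton R Y y) fun r hr => by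
      change r • y = 0
      exact hn r hr
    obtain ⟨z, hz⟩ := exists_rep_of_cocycle (a := a) (powAug_comp (ModuleCat.ofHom f))
    obtain ⟨x, hx⟩ := exists_powAug_eq_one (a := a) n
    refine ⟨z, (hι _ _).1 ⟨n, _, hz, x, hx, ?_⟩⟩
    change f ((powAug a n).hom x) = y
    rw [hx]
    change LinearMap.toSpanSingleton R Y y 1 = y
    simp

theorem _root_.Submodule.injective_mkQ_exact {Y : ModuleCat.{0} R} (N : Submodule R Y) :
    Function.Injective (ModuleCat.ofHom N.subtype).hom ∧
      Function.Exact (ModuleCat.ofHom N.subtype).hom (ModuleCat.ofHom N.mkQ).hom ∧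
      Function.Surjective (ModuleCat.ofHom N.mkQ).hom :=
  ⟨N.injective_subtype, LinearMap.exact_subtype_mkQ N, N.mkQ_surjective⟩

variable (Y) in
theorem exists_injective_embedding : ∃ (J : ModuleCat.{0} R) (f : Y ⟶ J),
    Injective J ∧ Function.Injective f.hom :=
  ⟨Injective.under Y, Injective.ι Y, inferInstance,
    (ModuleCat.mono_iff_injective _).1 inferInstance⟩

theorem _root_.Submodule.exists_fg_map_eq {M N : Type} [AddCommGroup M] [Module R M]
    [AddCommGroup N] [Module R N] (g : M →ₗ[R] N) (hg : Function.Surjective g) (C : Submodule R N)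
    (hC : C.FG) : ∃ P : Submodule R M, P.FG ∧ P.map g = C := by
  obtain ⟨s, hs, rfl⟩ := Submodule.fg_def.1 hC
  refine ⟨Submodule.span R (Set.image (Function.surjInv hg) s), Submodule.fg_span (hs.image _), ?_⟩
  rw [Submodule.map_span, Set.image_image]
  simp [Function.surjInv_eq]

section Finiteness

variable [IsNoetherianRing R]

/-- Every local cohomology class comes from a finitely generated submodule. -/
theorem exists_finite_submodule (i : ℕ) : ∀ (Y : ModuleCat.{0} R) (z : (localCohomology a i).obj Y),
    ∃ (N : Submodule R Y) (z' : (localCohomology a i).obj (ModuleCat.of R N)), N.FG ∧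
      ((localCohomology a i).map (ModuleCat.ofHom N.subtype)).hom z' = z := by
  induction i with
  | zero =>
    intro Y z
    obtain ⟨n, ζ, h⟩ := exists_rep a z
    obtain ⟨x, hx⟩ := exists_powAug_eq_one (a := a) n
    let N := Submodule.span R {ζ.hom x}
    have hN : ∀ y, ζ.hom y ∈ N := by
      intro y
      obtain ⟨r, hr⟩ := exists_smul_powAug hx y
      rw [apply_eq_of_cocycle h.cocycle hr, map_smul]
      exact N.smul_mem _ (Submodule.mem_span_singleton_self _)
    let ζ' : (powRes a n).complex.X 0 ⟶ ModuleCat.of R N :=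
      ModuleCat.ofHom (ζ.hom.codRestrict N hN)
    have hζ : ζ' ≫ ModuleCat.ofHom N.subtype = ζ := rfl
    obtain ⟨z', hz'⟩ := exists_rep_of_cocycle (a := a) (ζ := ζ')
      (ModuleCat.eq_of_comp_eq N.injective_mkQ_exact.1 (by
        rw [Category.assoc, hζ, h.cocycle, Limits.zero_comp]))
    exact ⟨N, z', Submodule.fg_span_singleton _, (hz'.map _).unique h⟩
  | succ i ih =>
    intro Y z
    obtain ⟨J, f, hJ, hf⟩ := exists_injective_embedding Y
    let C := ModuleCat.of R (J ⧸ LinearMap.range f.hom)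
    let g : J ⟶ C := ModuleCat.ofHom (LinearMap.range f.hom).mkQ
    have hg : Function.Surjective g.hom := Submodule.mkQ_surjective _
    have hfg : Function.Exact f.hom g.hom := LinearMap.exact_map_mkQ_range f.hom
    obtain ⟨δ, hδ, -, hδ'⟩ := exists_connecting a i hf hfg hg
    obtain ⟨c, rfl⟩ := (hδ' z).1 (by
      have := subsingleton_of_injective (a := a) (i := i) (Y := J)
      exact Subsingleton.elim _ _)
    obtain ⟨C', c', hC', rfl⟩ := ih C c
    obtain ⟨J', hJ', rfl⟩ := Submodule.exists_fg_map_eq g.hom hg C' hC'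
    have : Module.Finite R J' := Module.Finite.iff_fg.2 hJ'
    let N := J'.comap f.hom
    let f' : ModuleCat.of R N ⟶ ModuleCat.of R J' :=
      ModuleCat.ofHom (f.hom.restrict fun x hx => hx)
    let g' : ModuleCat.of R J' ⟶ ModuleCat.of R (J'.map g.hom) :=
      ModuleCat.ofHom (g.hom.submoduleMap J')
    have hf' : Function.Injective f'.hom := fun x y hxy =>
      Subtype.ext (hf (congrArg Subtype.val hxy))
    have hg' : Function.Surjective g'.hom := LinearMap.submoduleMap_surjective _ _
    have hfg' : Function.Exact f'.hom g'.hom := by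
      intro x
      constructor
      · intro hx
        obtain ⟨y, hy⟩ := (hfg x.1).1 (congrArg Subtype.val hx)
        exact ⟨⟨y, by rw [Submodule.mem_comap, hy]; exact x.2⟩, Subtype.ext hy⟩
      · rintro ⟨y, rfl⟩
        exact Subtype.ext (hfg.apply_apply_eq_zero y.1)
    obtain ⟨δ', hδ₁, -, -⟩ := exists_connecting a i hf' hfg' hg'
    have : IsNoetherian R N := isNoetherian_of_injective f'.hom hf'
    refine ⟨N, δ' c', Module.Finite.iff_fg.1 inferInstance, Eq.symm ?_⟩
    rw [← hδ]
    exact ((hδ₁ _ _).2 rfl).map (u₁ := ModuleCat.ofHom N.subtype) (u₂ := ModuleCat.ofHom J'.subtype)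
      (u₃ := ModuleCat.ofHom (J'.map g.hom).subtype) rfl rfl

end Finiteness

/-- A relative extension property with control over the annihilator. -/
theorem exists_extension_torsion [IsNoetherianRing R] (J : Type) [AddCommGroup J] [Module R J]
    [Module.Injective R J] (I : Ideal R) (g : I →ₗ[R] J)
    (hg : ∀ x : I, ∃ n : ℕ, ∀ r ∈ a ^ n, r • g x = 0) :
    ∃ y : J, (∃ n : ℕ, ∀ r ∈ a ^ n, r • y = 0) ∧ ∀ x : I, g x = (x : R) • y := by
  obtain ⟨k, hk⟩ : ∃ k : ℕ, ∀ x : I, ∀ r ∈ a ^ k, r • g x = 0 := by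
    have hfin : (⊤ : Submodule R I).FG := Module.Finite.fg_top
    obtain ⟨s, hs⟩ := hfin
    choose n hn using hg
    refine ⟨s.sup n, fun x r hr => ?_⟩
    have hx : x ∈ Submodule.span R (s : Set I) := by rw [hs]; trivial
    induction hx using Submodule.span_induction with
    | mem x hx => exact hn x r (Ideal.pow_le_pow_right (Finset.le_sup hx) hr)
    | zero => simp
    | add x y _ _ hx hy => rw [map_add, smul_add, hx, hy, add_zero]
    | smul t x _ hx => rw [map_smul, smul_comm, hx, smul_zero]
  obtain ⟨c, hc⟩ := a.exists_pow_inf_eq_pow_smul (I : Submodule R R)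
  have hker : ∀ x : I, (x : R) ∈ a ^ (k + c) → g x = 0 := by
    intro x hx
    have h1 : (x : R) ∈ a ^ k • (a ^ c • ⊤ ⊓ (I : Submodule R R)) := by
      have := hc (k + c) (by omega)
      rw [Nat.add_sub_cancel] at this
      rw [← this]
      exact ⟨by simpa using hx, x.2⟩
    have h2 : (x : R) ∈ a ^ k • (I : Submodule R R) := Submodule.smul_mono le_rfl inf_le_right h1
    have h3 : ∀ y (hy : y ∈ a ^ k • (I : Submodule R R)), ∃ hy' : y ∈ I, g ⟨y, hy'⟩ = 0 := by
      intro y hy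
      induction hy using Submodule.smul_induction_on' with
      | smul r hr y hy =>
        refine ⟨I.mul_mem_left r hy, ?_⟩
        have : (⟨r • y, I.mul_mem_left r hy⟩ : I) = r • ⟨y, hy⟩ := rfl
        rw [this, map_smul, hk _ r hr]
      | add y _ y' _ hy hy' =>
        obtain ⟨h, h0⟩ := hy
        obtain ⟨h', h0'⟩ := hy'
        refine ⟨I.add_mem h h', ?_⟩
        have : (⟨y + y', I.add_mem h h'⟩ : I) = ⟨y, h⟩ + ⟨y', h'⟩ := rfl
        rw [this, map_add, h0, h0', add_zero]
    exact (h3 x h2).2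
  let u : I →ₗ[R] R ⧸ a ^ (k + c) := (a ^ (k + c) : Submodule R R).mkQ ∘ₗ I.subtype
  have hu : LinearMap.ker u ≤ LinearMap.ker g := by
    intro x hx
    refine hker x ?_
    exact Ideal.Quotient.eq_zero_iff_mem.1 hx
  obtain ⟨h, hh⟩ := Module.Injective.out ((LinearMap.ker u).liftQ u le_rfl)
    (LinearMap.ker_eq_bot.1 (Submodule.ker_liftQ_eq_bot _ _ _ le_rfl))
    ((LinearMap.ker u).liftQ g hu)
  refine ⟨h (Ideal.Quotient.mk _ 1), ⟨k + c, fun r hr => ?_⟩, fun x => ?_⟩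
  · rw [← map_smul, smul_quotient_eq_zero hr, map_zero]
  · have := hh ((LinearMap.ker u).mkQ x)
    rw [← map_smul]
    refine Eq.trans ?_ (this.symm.trans (congrArg h ?_))
    · simp
    · change Ideal.Quotient.mk _ (x : R) = Ideal.Quotient.mk _ ((x : R) * 1)
      rw [mul_one]

section Vanishing

variable [IsNoetherianRing R]

variable (a) in
/-- The submodule of elements annihilated by a power of `a`. -/
def torsionSubmodule (J : Type) [AddCommGroup J] [Module R J] : Submodule R J where
  carrier := {y | ∃ n : ℕ, ∀ r ∈ a ^ n, r • y = 0}
  zero_mem' := ⟨0, by simp⟩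
  add_mem' := by
    rintro x y ⟨n, hn⟩ ⟨m, hm⟩
    refine ⟨max n m, fun r hr => ?_⟩
    rw [smul_add, hn r (Ideal.pow_le_pow_right (le_max_left _ _) hr),
      hm r (Ideal.pow_le_pow_right (le_max_right _ _) hr), add_zero]
  smul_mem' := by
    rintro s x ⟨n, hn⟩
    exact ⟨n, fun r hr => by rw [smul_comm, hn r hr, smul_zero]⟩

theorem injective_torsionSubmodule (J : Type) [AddCommGroup J] [Module R J] [Module.Injective R J] :
    Module.Injective R (torsionSubmodule a J) := by
  apply Module.Baer.injective
  intro I g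
  obtain ⟨y, hy, h⟩ := exists_extension_torsion (a := a) J I
    ((torsionSubmodule a J).subtype ∘ₗ g) (fun x => (g x).2)
  refine ⟨LinearMap.toSpanSingleton R _ ⟨y, hy⟩, fun x hx => ?_⟩
  exact Subtype.ext (h ⟨x, hx⟩).symm

theorem vanishing (i : ℕ) : ∀ (Y : ModuleCat.{0} R), (∀ y : Y, ∃ n : ℕ, ∀ r ∈ a ^ n, r • y = 0) →
    Subsingleton ((localCohomology a (i + 1)).obj Y) := by
  induction i with
  | zero => ?_
  | succ i ih => ?_
  all_goals
    intro Y hY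
    obtain ⟨J, f, hJ, hf⟩ := exists_injective_embedding Y
    have hJ' : Module.Injective R J := Module.injective_module_of_injective_object R J
    have hT' := injective_torsionSubmodule (a := a) J
    let T := ModuleCat.of R (torsionSubmodule a J)
    have hT : Injective T := Module.injective_object_of_injective_module R _
    let f' : Y ⟶ T := ModuleCat.ofHom (f.hom.codRestrict _ fun y => by
      obtain ⟨n, hn⟩ := hY y
      exact ⟨n, fun r hr => by rw [← map_smul, hn r hr, map_zero]⟩)
    have hf' : Function.Injective f'.hom := fun x y hxy => hf (congrArg Subtype.val hxy)
    let C := ModuleCat.of R (T ⧸ LinearMap.range f'.hom)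
    let g : T ⟶ C := ModuleCat.ofHom (LinearMap.range f'.hom).mkQ
    have hg : Function.Surjective g.hom := Submodule.mkQ_surjective _
    have hfg : Function.Exact f'.hom g.hom := LinearMap.exact_map_mkQ_range f'.hom
    refine subsingleton_of_forall_eq 0 fun z => ?_
  · obtain ⟨δ, -, hδ, hδ'⟩ := exists_connecting a 0 hf' hfg hg
    obtain ⟨c, rfl⟩ := (hδ' z).1 (by
      have := subsingleton_of_injective (a := a) (i := 0) (Y := T)
      exact Subsingleton.elim _ _)
    obtain ⟨ι, h₁, h₂, h₃⟩ := exists_evaluation a C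
    obtain ⟨ι', h₁', h₂', h₃'⟩ := exists_evaluation a T
    obtain ⟨t, ht⟩ := hg (ι c)
    obtain ⟨z', rfl⟩ := h₃' t (by
      obtain ⟨n, hn⟩ := t.2
      exact ⟨n, fun r hr => Subtype.ext (hn r hr)⟩)
    have h4 := (h₁ _ _).1 (((h₁' z' _).2 rfl).map g)
    rw [ht] at h4
    rw [← h₂ h4]
    exact hδ.apply_apply_eq_zero z'
  · obtain ⟨δ, -, hδ, hδ'⟩ := exists_connecting a (i + 1) hf' hfg hg
    obtain ⟨c, rfl⟩ := (hδ' z).1 (by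
      have := subsingleton_of_injective (a := a) (i := i + 1) (Y := T)
      exact Subsingleton.elim _ _)
    have := ih C (by
      intro c
      obtain ⟨t, rfl⟩ := hg c
      obtain ⟨n, hn⟩ := t.2
      exact ⟨n, fun r hr => by rw [← map_smul, show r • t = 0 from Subtype.ext (hn r hr), map_zero]⟩)
    rw [Subsingleton.elim c 0, map_zero]

end Vanishing

end localCohomology

namespace localCohomology

variable {R : Type} [CommRing R] (a : Ideal R) (S : Type) [CommRing S] [Algebra R S]

/-- An `S`-module viewed as an `R`-module. -/
noncomputable abbrev res (N : Type) [AddCommGroup N] [Module S N] : ModuleCat.{0} R :=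
  (ModuleCat.restrictScalars (algebraMap R S)).obj (ModuleCat.of S N)

variable {S} in
/-- An `S`-linear map viewed as an `R`-linear map. -/
noncomputable abbrev resMap {N N' : Type} [AddCommGroup N] [Module S N] [AddCommGroup N'] [Module S N']
    (f : N →ₗ[S] N') : (res S N : ModuleCat.{0} R) ⟶ res S N' :=
  (ModuleCat.restrictScalars (algebraMap R S)).map (ModuleCat.ofHom f)

/-- Local cohomology of an `S`-module with respect to an ideal of `R`. -/
def Lift (i : ℕ) (N : Type) [AddCommGroup N] [Module S N] : Type :=
  (localCohomology a i).obj (res S N)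

variable (i : ℕ) (N : Type) [AddCommGroup N] [Module S N]

noncomputable instance : AddCommGroup (Lift a S i N) :=
  inferInstanceAs (AddCommGroup ((localCohomology a i).obj (res S N)))

variable {S} {N} {N' : Type} [AddCommGroup N'] [Module S N'] {N'' : Type} [AddCommGroup N'']
  [Module S N'']

noncomputable def liftMap (f : N →ₗ[S] N') : Lift a S i N →+ Lift a S i N' :=
  ((localCohomology a i).map (resMap f)).hom.toAddMonoidHom

theorem liftMap_id (z : Lift a S i N) : liftMap a i (LinearMap.id : N →ₗ[S] N) z = z :=
  congrArg (fun t => t.hom z) ((localCohomology a i).map_id (res S N))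

theorem liftMap_comp (f : N →ₗ[S] N') (g : N' →ₗ[S] N'') (z : Lift a S i N) :
    liftMap a i (g ∘ₗ f) z = liftMap a i g (liftMap a i f z) :=
  congrArg (fun t => t.hom z) ((localCohomology a i).map_comp (resMap f) (resMap g))

theorem liftMap_add (f g : N →ₗ[S] N') (z : Lift a S i N) :
    liftMap a i (f + g) z = liftMap a i f z + liftMap a i g z :=
  congrArg (fun t => t.hom z) (map_add_hom (a := a) (i := i) (resMap f) (resMap g))

theorem liftMap_zero (z : Lift a S i N) : liftMap a i (0 : N →ₗ[S] N') z = 0 :=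
  congrArg (fun t => t.hom z) (map_zero_hom (a := a) (i := i) (Y := res S N) (Y' := res S N'))

theorem liftMap_algebraMap (r : R) (z : Lift a S i N) :
    liftMap a i (algebraMap R S r • (LinearMap.id : N →ₗ[S] N)) z =
      (show Lift a S i N from (r • (show (localCohomology a i).obj (res S N) from z))) := by
  have h := map_smul_hom (a := a) (i := i) r (𝟙 (res S N))
  rw [CategoryTheory.Functor.map_id] at h
  exact congrArg (fun t => t.hom z) h

noncomputable instance : Module S (Lift a S i N) where
  smul s z := liftMap a i (s • LinearMap.id) z
  one_smul z := by
    change liftMap a i ((1 : S) • LinearMap.id) z = z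
    rw [one_smul, liftMap_id]
  mul_smul s t z := by
    change liftMap a i ((s * t) • LinearMap.id) z =
      liftMap a i (s • LinearMap.id) (liftMap a i (t • LinearMap.id) z)
    rw [← liftMap_comp, LinearMap.smul_comp, LinearMap.comp_smul, LinearMap.id_comp, mul_smul]
  smul_zero s := map_zero _
  smul_add s := map_add _
  add_smul s t z := by
    change liftMap a i ((s + t) • LinearMap.id) z =
      liftMap a i (s • LinearMap.id) z + liftMap a i (t • LinearMap.id) z
    rw [← liftMap_add, add_smul]
  zero_smul z := by
    change liftMap a i ((0 : S) • LinearMap.id) z = 0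
    rw [zero_smul, liftMap_zero]

/-- The linear map induced by a linear map. -/
noncomputable def liftLinearMap (f : N →ₗ[S] N') : Lift a S i N →ₗ[S] Lift a S i N' where
  __ := liftMap a i f
  map_smul' s z := by
    change liftMap a i f (liftMap a i (s • LinearMap.id) z) =
      liftMap a i (s • LinearMap.id) (liftMap a i f z)
    rw [← liftMap_comp, ← liftMap_comp, LinearMap.smul_comp, LinearMap.comp_smul,
      LinearMap.id_comp, LinearMap.comp_id]

theorem algebraMap_pow_mem {r : R} {n : ℕ} (hr : r ∈ a ^ n) :
    algebraMap R S r ∈ (a.map (algebraMap R S)) ^ n := by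
  rw [← Ideal.map_pow]
  exact Ideal.mem_map_of_mem _ hr

variable (S) in
/-- Local cohomology over an algebra. -/
noncomputable def theory [IsNoetherianRing R] :
    LocalCohomologyTheory S (a.map (algebraMap R S)) where
  H i N _ _ := ModuleCat.of S (Lift a S i N)
  map i _ _ _ _ _ _ f := liftLinearMap a i f
  map_id i N _ _ := LinearMap.ext (liftMap_id a i)
  map_comp i _ _ _ _ _ _ _ _ _ f g := LinearMap.ext (liftMap_comp a i f g)
  map_smul i _ _ _ _ _ _ r f := by
    ext z
    change liftMap a i (r • f) z = liftMap a i (r • LinearMap.id) (liftMap a i f z)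
    rw [← liftMap_comp]
    congr 1
  exact_map i _ _ _ _ _ _ _ _ _ f g hf hfg hg :=
    exact_map (f := resMap f) (g := resMap g) hf hfg hg
  exists_connecting i _ _ _ _ _ _ _ _ _ f g hf hfg hg := by
    obtain ⟨δ, h1, h2, h3⟩ := exists_connecting a i (f := resMap f) (g := resMap g) hf hfg hg
    refine ⟨{ δ with map_smul' := fun s z => ?_ }, h2, h3⟩
    refine (h1 _ _).1 (((h1 z _).2 rfl).map (u₁ := resMap (s • LinearMap.id))
      (u₂ := resMap (s • LinearMap.id)) (u₃ := resMap (s • LinearMap.id)) ?_ ?_)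
    · ext x
      exact (map_smul f s x).symm
    · ext x
      exact (map_smul g s x).symm
  map_zero_injective f hf := map_zero_injective (f := resMap f) hf
  exists_embedding N _ _ := by
    obtain ⟨ι, h1, h2, h3⟩ := exists_evaluation a (res S N)
    refine ⟨{ ι with map_smul' := fun s z => ?_ }, h2, ?_⟩
    · exact (h1 _ _).1 (((h1 z _).2 rfl).map (resMap (s • LinearMap.id)))
    · rintro m ⟨n, hn⟩
      obtain ⟨z, hz⟩ := h3 m ⟨n, fun r hr => hn _ (algebraMap_pow_mem a hr)⟩
      exact ⟨z, hz⟩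
  torsion i N _ _ z := by
    obtain ⟨n, hn⟩ := torsion (a := a) (i := i) (Y := res S N) z
    refine ⟨n, fun s hs => ?_⟩
    rw [← Ideal.map_pow] at hs
    induction hs using Submodule.span_induction with
    | mem s hs =>
      obtain ⟨r, hr, rfl⟩ := hs
      exact (liftMap_algebraMap a i r z).trans (hn r hr)
    | zero => exact zero_smul S (show Lift a S i N from z)
    | add s t _ _ hs ht => rw [add_smul, hs, ht, add_zero]
    | smul t s _ hs => rw [smul_eq_mul, mul_smul, hs, smul_zero]
  vanishing i N _ _ h := vanishing (a := a) i (res S N) fun m => by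
    obtain ⟨n, hn⟩ := h m
    exact ⟨n, fun r hr => hn _ (algebraMap_pow_mem a hr)⟩

/-- The theory over `R` itself computes the local cohomology modules. -/
noncomputable def theoryIso [IsNoetherianRing R] (N : Type) [AddCommGroup N] [Module R N] :
    (theory a R).H i N ≃ₗ[R] TopLC R a i N where
  toFun z := z
  invFun z := z
  left_inv _ := rfl
  right_inv _ := rfl
  map_add' _ _ := rfl
  map_smul' r z := liftMap_algebraMap a i r z

end localCohomology

namespace Ideal

variable {R S : Type*} [CommRing R] [CommRing S] [Algebra R S] (I : Ideal R) (𝔞 : Ideal S)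

theorem algebraMap_mem_map_pow {r : R} {n : ℕ} (hr : r ∈ I ^ n) :
    algebraMap R S r ∈ (I.map (algebraMap R S)) ^ n := by
  rw [← Ideal.map_pow]
  exact Ideal.mem_map_of_mem _ hr

/-- The elements of `I ^ n` that agree with an element of `𝔞` modulo `(I S) ^ (n + 1)`. -/
def initialFiltration : I.Filtration R where
  N n :=
    { carrier := {r | r ∈ I ^ n ∧ ∃ s ∈ 𝔞, s - algebraMap R S r ∈ (I.map (algebraMap R S)) ^ (n + 1)}
      add_mem' := by
        rintro r r' ⟨h, s, hs, e⟩ ⟨h', s', hs', e'⟩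
        refine ⟨add_mem h h', s + s', add_mem hs hs', ?_⟩
        rw [map_add, add_sub_add_comm]
        exact add_mem e e'
      zero_mem' := ⟨zero_mem _, 0, zero_mem _, by simp⟩
      smul_mem' := by
        rintro t r ⟨h, s, hs, e⟩
        refine ⟨Ideal.mul_mem_left _ _ h, algebraMap R S t * s, Ideal.mul_mem_left _ _ hs, ?_⟩
        rw [smul_eq_mul, map_mul, ← mul_sub]
        exact Ideal.mul_mem_left _ _ e }
  mono n := by
    rintro r ⟨h, -⟩
    refine ⟨Ideal.pow_le_pow_right n.le_succ h, 0, zero_mem _, ?_⟩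
    rw [zero_sub, neg_mem_iff]
    exact algebraMap_mem_map_pow I h
  smul_le n := by
    rw [Submodule.smul_le]
    rintro t ht r ⟨h, s, hs, e⟩
    refine ⟨?_, algebraMap R S t * s, Ideal.mul_mem_left _ _ hs, ?_⟩
    · rw [pow_succ', smul_eq_mul]
      exact Ideal.mul_mem_mul ht h
    · rw [smul_eq_mul, map_mul, ← mul_sub, pow_succ']
      exact Ideal.mul_mem_mul (Ideal.mem_map_of_mem _ ht) e

theorem initialFiltration_stable [IsNoetherianRing R] : (initialFiltration I 𝔞).Stable := by
  refine (Ideal.stableFiltration_stable I (⊤ : Submodule R R)).of_le fun n r hr => ?_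
  simpa [Ideal.stableFiltration] using hr.1

theorem exists_fg_lift [IsNoetherianRing R] (n : ℕ) : ∃ 𝔟 : Ideal S, 𝔟.FG ∧ 𝔟 ≤ 𝔞 ∧
    ∀ r ∈ (initialFiltration I 𝔞).N n, ∃ s ∈ 𝔟,
      s - algebraMap R S r ∈ (I.map (algebraMap R S)) ^ (n + 1) := by
  classical
  obtain ⟨T, hT⟩ := IsNoetherian.noetherian ((initialFiltration I 𝔞).N n)
  have h : ∀ r : T, ∃ s ∈ 𝔞, s - algebraMap R S r ∈ (I.map (algebraMap R S)) ^ (n + 1) := fun r =>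
    (hT ▸ Submodule.subset_span r.2 : (r : R) ∈ (initialFiltration I 𝔞).N n).2
  choose g hg hg' using h
  refine ⟨Ideal.span (Set.range g), ⟨Finset.univ.image g, by simp [Ideal.span]⟩, ?_, ?_⟩
  · rw [Ideal.span_le]
    rintro _ ⟨r, rfl⟩
    exact hg r
  · intro r hr
    rw [← hT] at hr
    induction hr using Submodule.span_induction with
    | mem r hr => exact ⟨g ⟨r, hr⟩, Ideal.subset_span ⟨_, rfl⟩, hg' ⟨r, hr⟩⟩
    | zero => exact ⟨0, zero_mem _, by simp⟩
    | add r r' _ _ h h' =>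
      obtain ⟨s, hs, e⟩ := h
      obtain ⟨s', hs', e'⟩ := h'
      refine ⟨s + s', add_mem hs hs', ?_⟩
      rw [map_add, add_sub_add_comm]
      exact add_mem e e'
    | smul t r _ h =>
      obtain ⟨s, hs, e⟩ := h
      refine ⟨algebraMap R S t * s, Ideal.mul_mem_left _ _ hs, ?_⟩
      rw [smul_eq_mul, map_mul, ← mul_sub]
      exact Ideal.mul_mem_left _ _ e

variable {I}

theorem exists_sub_algebraMap_mem_pow
    (h : ∀ s : S, ∃ r : R, s - algebraMap R S r ∈ I.map (algebraMap R S)) (n : ℕ) (s : S)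
    (hs : s ∈ (I.map (algebraMap R S)) ^ n) :
    ∃ r ∈ I ^ n, s - algebraMap R S r ∈ (I.map (algebraMap R S)) ^ (n + 1) := by
  have hs' := hs
  rw [← Ideal.map_pow] at hs
  refine Submodule.span_induction (p := fun s _ =>
    ∃ r ∈ I ^ n, s - algebraMap R S r ∈ (I.map (algebraMap R S)) ^ (n + 1)) ?_ ?_ ?_ ?_ hs
  · rintro _ ⟨r, hr, rfl⟩
    exact ⟨r, hr, by simp⟩
  · exact ⟨0, zero_mem _, by simp⟩
  · rintro s s' _ _ ⟨r, hr, e⟩ ⟨r', hr', e'⟩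
    refine ⟨r + r', add_mem hr hr', ?_⟩
    rw [map_add, add_sub_add_comm]
    exact add_mem e e'
  · rintro t s _ ⟨r, hr, e⟩
    obtain ⟨u, hu⟩ := h t
    refine ⟨u * r, Ideal.mul_mem_left _ _ hr, ?_⟩
    have : t • s - algebraMap R S (u * r) =
        t * (s - algebraMap R S r) + (t - algebraMap R S u) * algebraMap R S r := by
      rw [map_mul, smul_eq_mul]; ring
    rw [this]
    refine add_mem (Ideal.mul_mem_left _ _ e) ?_
    rw [pow_succ']
    exact Ideal.mul_mem_mul hu (algebraMap_mem_map_pow I hr)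

theorem exists_fg_approximation [IsNoetherianRing R]
    (h : ∀ s : S, ∃ r : R, s - algebraMap R S r ∈ I.map (algebraMap R S)) :
    ∃ (𝔟 : Ideal S) (n₀ : ℕ), 𝔟.FG ∧ 𝔟 ≤ 𝔞 ∧ ∀ n, ∀ z ∈ 𝔞, z ∈ (I.map (algebraMap R S)) ^ n →
      ∃ y ∈ (I.map (algebraMap R S)) ^ (n - n₀) * 𝔟,
        z - y ∈ (I.map (algebraMap R S)) ^ (n + 1) := by
  obtain ⟨n₀, hn₀⟩ := (initialFiltration_stable I 𝔞).exists_pow_smul_eq_of_ge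
  choose 𝔟 h1 h2 h3 using exists_fg_lift I 𝔞
  refine ⟨⨆ i ∈ Finset.range (n₀ + 1), 𝔟 i, n₀, Submodule.fg_biSup _ _ fun i _ => h1 i,
    iSup₂_le fun i _ => h2 i, fun n z hz hzn => ?_⟩
  have hle : ∀ i ≤ n₀, 𝔟 i ≤ ⨆ i ∈ Finset.range (n₀ + 1), 𝔟 i := fun i hi =>
    le_iSup₂ (f := fun i (_ : i ∈ Finset.range (n₀ + 1)) => 𝔟 i) i (by simpa using by omega)
  obtain ⟨r, hr, e⟩ := exists_sub_algebraMap_mem_pow h n z hzn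
  have hrn : r ∈ (initialFiltration I 𝔞).N n := ⟨hr, z, hz, e⟩
  suffices H : ∃ y ∈ (I.map (algebraMap R S)) ^ (n - n₀) * ⨆ i ∈ Finset.range (n₀ + 1), 𝔟 i,
      y - algebraMap R S r ∈ (I.map (algebraMap R S)) ^ (n + 1) by
    obtain ⟨y, hy, e'⟩ := H
    refine ⟨y, hy, ?_⟩
    rw [← sub_sub_sub_cancel_right z y (algebraMap R S r)]
    exact sub_mem e e'
  rcases le_total n n₀ with hn | hn
  · obtain ⟨s, hs, e'⟩ := h3 n r hrn
    refine ⟨s, ?_, e'⟩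
    rw [Nat.sub_eq_zero_of_le hn, pow_zero, one_mul]
    exact hle n hn hs
  · rw [hn₀ n hn] at hrn
    refine Submodule.smul_induction_on hrn ?_ ?_
    · intro t ht r hr
      obtain ⟨s, hs, hsr₂⟩ := h3 n₀ r hr
      refine ⟨algebraMap R S t * s,
        Ideal.mul_mem_mul (algebraMap_mem_map_pow I ht) (hle n₀ le_rfl hs), ?_⟩
      have hn' : n + 1 = (n - n₀) + (n₀ + 1) := by omega
      rw [smul_eq_mul, map_mul, ← mul_sub, hn', pow_add]
      exact Ideal.mul_mem_mul (algebraMap_mem_map_pow I ht) hsr₂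
    · rintro r r' ⟨s, hs, e⟩ ⟨s', hs', hsr₂⟩
      refine ⟨s + s', add_mem hs hs', ?_⟩
      rw [map_add, add_sub_add_comm]
      exact add_mem e hsr₂

/-- An algebra over a Noetherian ring that is complete and generated modulo the ideal of
completion is Noetherian. -/
theorem isNoetherianRing_of_isAdicComplete [IsNoetherianRing R]
    [IsAdicComplete (I.map (algebraMap R S)) S]
    (h : ∀ s : S, ∃ r : R, s - algebraMap R S r ∈ I.map (algebraMap R S)) :
    IsNoetherianRing S := by
  refine ⟨fun 𝔞 => ?_⟩
  set J := I.map (algebraMap R S) with hJ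
  obtain ⟨𝔟, n₀, ⟨T, rfl⟩, hle, H⟩ := exists_fg_approximation 𝔞 h
  suffices 𝔞 ≤ Submodule.span S (T : Set S) from this.antisymm hle ▸ ⟨T, rfl⟩
  intro z hz
  have step : ∀ n (x : {x : S // x ∈ 𝔞 ∧ x ∈ J ^ n}), ∃ c : T → S,
      (∀ i, c i ∈ J ^ (n - n₀)) ∧ x.1 - ∑ i, c i * i ∈ 𝔞 ∧ x.1 - ∑ i, c i * i ∈ J ^ (n + 1) := by
    rintro n ⟨x, hx, hxn⟩
    obtain ⟨y, hy, e⟩ := H n x hx hxn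
    have hy' : y ∈ J ^ (n - n₀) • Submodule.span S (Set.range fun i : T => (i : S)) := by
      simpa using hy
    obtain ⟨c, hc, rfl⟩ := (Submodule.mem_ideal_smul_span_iff_exists_sum _ _ _).1 hy'
    have hsum : (c.sum fun i c => c • (i : S)) = ∑ i, c i * i := by
      rw [Finsupp.sum_fintype _ _ (by simp)]; rfl
    rw [hsum] at e
    exact ⟨c, hc, sub_mem hx (Submodule.sum_mem _ fun i _ => Ideal.mul_mem_left _ _
      (hle (Submodule.subset_span i.2))), e⟩
  choose c hc h1 h2 using step
  let x : ∀ n, {x : S // x ∈ 𝔞 ∧ x ∈ J ^ n} := fun n =>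
    Nat.rec ⟨z, hz, by simp⟩ (fun n y => ⟨y.1 - ∑ i, c n y i * i, h1 n y, h2 n y⟩) n
  let s : ℕ → T → S := fun n i => ∑ k ∈ Finset.range n, c k (x k) i
  have hs : ∀ n, (x n).1 = z - ∑ i, s n i * i := by
    intro n
    induction n with
    | zero => simp [s, x]
    | succ n ih =>
      change (x n).1 - _ = _
      rw [ih, sub_sub]
      congr 1
      rw [← Finset.sum_add_distrib]
      refine Finset.sum_congr rfl fun i _ => ?_
      rw [← add_mul]
      simp only [s, Finset.sum_range_succ]
      rfl
  have hlim : ∀ i, ∃ L, ∀ n, s (n + n₀) i - L ∈ J ^ n := by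
    intro i
    have hc : ∀ {m n : ℕ}, m ≤ n → s (m + n₀) i ≡ s (n + n₀) i [SMOD J ^ m • (⊤ : Submodule S S)] := by
      intro m n hmn
      rw [SModEq.sub_mem, smul_eq_mul, Ideal.mul_top, ← neg_mem_iff, neg_sub]
      have : s (n + n₀) i - s (m + n₀) i =
          ∑ k ∈ Finset.Ico (m + n₀) (n + n₀), c k (x k) i :=
        (Finset.sum_Ico_eq_sub _ (by omega)).symm
      rw [this]
      refine Submodule.sum_mem _ fun k hk => Ideal.pow_le_pow_right ?_ (hc k (x k) i)
      rw [Finset.mem_Ico] at hk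
      omega
    obtain ⟨L, hL⟩ := IsPrecomplete.prec (inferInstance : IsPrecomplete J S) hc
    refine ⟨L, fun n => ?_⟩
    have := hL n
    rwa [SModEq.sub_mem, smul_eq_mul, Ideal.mul_top] at this
  choose L hL using hlim
  have hzL : z - ∑ i, L i * i = 0 := by
    refine IsHausdorff.haus (inferInstance : IsHausdorff J S) _ fun n => ?_
    rw [SModEq.zero, smul_eq_mul, Ideal.mul_top]
    have : z - ∑ i, L i * i = (x (n + n₀)).1 + ∑ i, (s (n + n₀) i - L i) * i := by
      rw [hs]
      simp only [sub_mul, Finset.sum_sub_distrib]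
      ring
    rw [this]
    exact add_mem (Ideal.pow_le_pow_right (by omega) (x (n + n₀)).2.2)
      (Submodule.sum_mem _ fun i _ => Ideal.mul_mem_right _ _ (hL i n))
  rw [sub_eq_zero.1 hzL]
  exact Submodule.sum_mem _ fun i _ => Ideal.mul_mem_left _ _ (Submodule.subset_span i.2)

end Ideal

theorem AdicCompletion.exists_sub_algebraMap_mem {R : Type*} [CommRing R] [IsNoetherianRing R]
    (I : Ideal R) (s : AdicCompletion I R) :
    ∃ r : R, s - algebraMap R (AdicCompletion I R) r ∈
      I.map (algebraMap R (AdicCompletion I R)) := by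
  obtain ⟨r, hr⟩ := Ideal.Quotient.mk_surjective (AdicCompletion.evalOneₐ I s)
  refine ⟨r, ?_⟩
  have h := AdicCompletion.ker_evalOneₐ_eq_map I (IsNoetherian.noetherian I)
  refine h.le (RingHom.mem_ker.2 ?_)
  rw [map_sub]
  exact sub_eq_zero.2 hr.symm

instance AdicCompletion.isNoetherianRing_of_isLocalRing {R : Type*} [CommRing R] [IsNoetherianRing R]
    [IsLocalRing R] :
    IsNoetherianRing (AdicCompletion (IsLocalRing.maximalIdeal R) R) := by
  have := AdicCompletion.isAdicComplete_self (I := IsLocalRing.maximalIdeal R)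
    (IsNoetherian.noetherian _)
  exact Ideal.isNoetherianRing_of_isAdicComplete (I := IsLocalRing.maximalIdeal R)
    (AdicCompletion.exists_sub_algebraMap_mem _)

namespace LocalCohomologyTheory

variable {A : Type} [CommRing A] {I : Ideal A} (T : LocalCohomologyTheory A I)

/-- The cohomology modules commute with directed unions, and the maps between them are additive. -/
structure IsFinitary : Prop where
  map_add : ∀ (i : ℕ) {N N' : Type} [AddCommGroup N] [Module A N] [AddCommGroup N'] [Module A N']
    (f g : N →ₗ[A] N'), T.map i (f + g) = T.map i f + T.map i g
  exists_submodule : ∀ (i : ℕ) (N : Type) [AddCommGroup N] [Module A N] (z : T.H i N),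
    ∃ (L : Submodule A N) (w : T.H i L), L.FG ∧ T.map i L.subtype w = z

variable {T}

theorem map_zero_apply (i : ℕ) {N N' : Type} [AddCommGroup N] [Module A N] [AddCommGroup N']
    [Module A N'] (z : T.H i N) : T.map i (0 : N →ₗ[A] N') z = 0 := by
  have := T.map_smul i (0 : A) (0 : N →ₗ[A] N')
  rw [zero_smul, zero_smul] at this
  rw [this, LinearMap.zero_apply]

theorem IsFinitary.subsingleton_of_annihilator_le [IsNoetherianRing A] (hT : T.IsFinitary)
    {M : Type} [AddCommGroup M] [Module A M] [Module.Finite A M] {n : ℕ}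
    (hM : supportDim A M < n) {N : Type} [AddCommGroup N] [Module A N]
    (hN : annihilator A M ≤ annihilator A N) : Subsingleton (T.H n N) := by
  refine subsingleton_of_forall_eq 0 fun z => ?_
  obtain ⟨L, w, hL, rfl⟩ := hT.exists_submodule n N z
  have : Module.Finite A L := Module.Finite.iff_fg.2 hL
  have hdim : supportDim A L < n := by
    refine lt_of_le_of_lt ?_ hM
    have h : Module.support A L ⊆ Module.support A M := by
      rw [support_eq_zeroLocus (M := L), support_eq_zeroLocus (M := M)]
      refine PrimeSpectrum.zeroLocus_anti_mono (hN.trans ?_)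
      exact LinearMap.annihilator_le_of_injective L.subtype L.injective_subtype
    exact Order.krullDim_le_of_strictMono (Set.inclusion h) fun _ _ h => h
  have := T.subsingleton_of_supportDim_lt n L hdim n le_rfl
  rw [Subsingleton.elim w 0, map_zero]

theorem IsFinitary.map_surjective [IsNoetherianRing A] (hT : T.IsFinitary)
    {M : Type} [AddCommGroup M] [Module A M] [Module.Finite A M] {n : ℕ}
    (hM : supportDim A M < (n + 1 : ℕ)) {X Y : Type} [AddCommGroup X] [Module A X] [AddCommGroup Y]
    [Module A Y] (hX : annihilator A M ≤ annihilator A X) (g : X →ₗ[A] Y)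
    (hg : Function.Surjective g) : Function.Surjective (T.map n g) :=
  T.map_surjective_of_exact n (LinearMap.ker g).injective_subtype
    (LinearMap.exact_subtype_ker_map g) hg
    (hT.subsingleton_of_annihilator_le hM (hX.trans
      (LinearMap.annihilator_le_of_injective _ (LinearMap.ker g).injective_subtype)))

theorem IsFinitary.exact_map_of_surjective [IsNoetherianRing A] (hT : T.IsFinitary)
    {M : Type} [AddCommGroup M] [Module A M] [Module.Finite A M] {n : ℕ}
    (hM : supportDim A M < (n + 1 : ℕ)) {X Y Z : Type} [AddCommGroup X] [Module A X]
    [AddCommGroup Y] [Module A Y] [AddCommGroup Z] [Module A Z]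
    (hX : annihilator A M ≤ annihilator A X) (f : X →ₗ[A] Y) (g : Y →ₗ[A] Z)
    (hfg : Function.Exact f g) (hg : Function.Surjective g) :
    Function.Exact (T.map n f) (T.map n g) := by
  let f' : X →ₗ[A] LinearMap.ker g := f.codRestrict _ fun x => hfg.apply_apply_eq_zero x
  have hf' : Function.Surjective f' := by
    rintro ⟨y, hy⟩
    obtain ⟨x, rfl⟩ := (hfg y).1 hy
    exact ⟨x, rfl⟩
  have hf : f = (LinearMap.ker g).subtype ∘ₗ f' := rfl
  have h := T.exact_map n (LinearMap.ker g).injective_subtype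
    (LinearMap.exact_subtype_ker_map g) hg
  intro y
  rw [h y, hf, T.map_comp]
  constructor
  · rintro ⟨w, rfl⟩
    obtain ⟨x, rfl⟩ := hT.map_surjective hM hX f' hf' w
    exact ⟨x, rfl⟩
  · rintro ⟨x, rfl⟩
    exact ⟨_, rfl⟩

/-- The canonical map from a tensor product with the cohomology module. -/
noncomputable def IsFinitary.tensorMap (hT : T.IsFinitary) (i : ℕ) (N M : Type) [AddCommGroup N]
    [Module A N] [AddCommGroup M] [Module A M] : N ⊗[A] (T.H i M) →ₗ[A] T.H i (N ⊗[A] M) :=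
  TensorProduct.lift
    { toFun := fun n => T.map i (TensorProduct.mk A N M n)
      map_add' := fun n n' => by rw [_root_.map_add, hT.map_add]
      map_smul' := fun r n => by rw [_root_.map_smul, T.map_smul, RingHom.id_apply] }

theorem IsFinitary.tensorMap_tmul (hT : T.IsFinitary) (i : ℕ) {N M : Type} [AddCommGroup N]
    [Module A N] [AddCommGroup M] [Module A M] (n : N) (z : T.H i M) :
    hT.tensorMap i N M (n ⊗ₜ z) = T.map i (TensorProduct.mk A N M n) z := rfl

theorem IsFinitary.tensorMap_rTensor (hT : T.IsFinitary) (i : ℕ) {N N' M : Type} [AddCommGroup N]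
    [Module A N] [AddCommGroup N'] [Module A N'] [AddCommGroup M] [Module A M] (f : N →ₗ[A] N')
    (z : N ⊗[A] T.H i M) :
    hT.tensorMap i N' M (f.rTensor _ z) = T.map i (f.rTensor M) (hT.tensorMap i N M z) := by
  induction z with
  | zero => simp only [_root_.map_zero]
  | add x y hx hy => simp only [_root_.map_add, hx, hy]
  | tmul n z =>
    rw [LinearMap.rTensor_tmul, tensorMap_tmul, tensorMap_tmul,
      ← LinearMap.comp_apply (f := T.map i _), ← T.map_comp]
    rfl

/-- The coordinate maps of a tensor product with a free module. -/
noncomputable abbrev coordTensor (ι M : Type) [AddCommGroup M] [Module A M] (i : ι) :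
    (ι →₀ A) ⊗[A] M →ₗ[A] M :=
  (TensorProduct.lid A M).toLinearMap ∘ₗ (Finsupp.lapply i).rTensor M

theorem exists_finset_sum_coordTensor {ι M : Type} [AddCommGroup M] [Module A M]
    (z : (ι →₀ A) ⊗[A] M) : ∃ s : Finset ι, ∀ t, s ⊆ t →
      ∑ i ∈ t, (Finsupp.single i (1 : A)) ⊗ₜ[A] coordTensor ι M i z = z := by
  classical
  induction z with
  | zero => exact ⟨∅, fun t _ => by simp⟩
  | add x y hx hy =>
    obtain ⟨s, hs⟩ := hx
    obtain ⟨s', hs'⟩ := hy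
    refine ⟨s ∪ s', fun t ht => ?_⟩
    simp only [_root_.map_add, TensorProduct.tmul_add, Finset.sum_add_distrib]
    rw [hs t (Finset.union_subset_left ht), hs' t (Finset.union_subset_right ht)]
  | tmul f m =>
    refine ⟨f.support, fun t ht => ?_⟩
    have h : f = ∑ i ∈ t, Finsupp.single i (f i) := by
      conv_lhs => rw [← Finsupp.sum_single f]
      exact Finsupp.sum_of_support_subset f ht _ (by simp)
    conv_rhs => rw [h, TensorProduct.sum_tmul]
    refine Finset.sum_congr rfl fun i _ => ?_
    simp only [LinearMap.comp_apply, LinearMap.rTensor_tmul, LinearEquiv.coe_coe,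
      TensorProduct.lid_tmul, Finsupp.lapply_apply]
    rw [← TensorProduct.smul_tmul, Finsupp.smul_single, smul_eq_mul, mul_one]

theorem IsFinitary.map_sum (hT : T.IsFinitary) (i : ℕ) {N N' ι : Type} [AddCommGroup N] [Module A N]
    [AddCommGroup N'] [Module A N'] (s : Finset ι) (f : ι → N →ₗ[A] N') (z : T.H i N) :
    T.map i (∑ j ∈ s, f j) z = ∑ j ∈ s, T.map i (f j) z := by
  classical
  induction s using Finset.induction_on with
  | empty => simp [map_zero_apply]
  | insert j s hj ih => rw [Finset.sum_insert hj, Finset.sum_insert hj, hT.map_add,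
      LinearMap.add_apply, ih]

theorem IsFinitary.exists_finset_sum_map (hT : T.IsFinitary) (n : ℕ) {ι M Y : Type}
    [AddCommGroup M] [Module A M] [AddCommGroup Y] [Module A Y] (e : ι → M →ₗ[A] Y)
    (c : ι → Y →ₗ[A] M) (h : ∀ y, ∃ s : Finset ι, ∀ t, s ⊆ t → ∑ i ∈ t, e i (c i y) = y)
    (z : T.H n Y) : ∃ (t : Finset ι) (w : ι → T.H n M), ∑ i ∈ t, T.map n (e i) (w i) = z := by
  classical
  obtain ⟨L, w, ⟨G, hG⟩, rfl⟩ := hT.exists_submodule n _ z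
  choose s hs using h
  let t := G.biUnion s
  have h : L.subtype = ∑ i ∈ t, e i ∘ₗ c i ∘ₗ L.subtype := by
    ext ⟨y, hy⟩
    simp only [LinearMap.sum_apply, LinearMap.comp_apply, Submodule.subtype_apply]
    rw [← hG] at hy
    induction hy using Submodule.span_induction with
    | mem y hy => exact (hs y t (Finset.subset_biUnion_of_mem s hy)).symm
    | zero => simp
    | add x y _ _ hx hy =>
      simp only [_root_.map_add, Finset.sum_add_distrib]
      congr 1
    | smul r x _ hx =>
      simp only [_root_.map_smul, ← Finset.smul_sum]
      congr 1
  refine ⟨t, fun i => T.map n (c i ∘ₗ L.subtype) w, ?_⟩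
  conv_rhs => rw [h, hT.map_sum]
  refine Finset.sum_congr rfl fun i _ => ?_
  rw [← LinearMap.comp_apply, ← T.map_comp]

theorem IsFinitary.tensorMap_bijective_free (hT : T.IsFinitary) (n : ℕ) (ι M : Type)
    [AddCommGroup M] [Module A M] : Function.Bijective (hT.tensorMap n (ι →₀ A) M) := by
  constructor
  · rw [injective_iff_map_eq_zero]
    intro z hz
    obtain ⟨s, hs⟩ := exists_finset_sum_coordTensor z
    rw [← hs s subset_rfl]
    refine Finset.sum_eq_zero fun i _ => ?_
    have h : ∀ z, coordTensor ι (T.H n M) i z =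
        T.map n (coordTensor ι M i) (hT.tensorMap n (ι →₀ A) M z) := by
      intro z
      induction z with
      | zero => simp only [_root_.map_zero]
      | add x y hx hy => simp only [_root_.map_add, hx, hy]
      | tmul f z =>
        rw [tensorMap_tmul, ← LinearMap.comp_apply (f := T.map n _), ← T.map_comp]
        have : coordTensor ι M i ∘ₗ TensorProduct.mk A (ι →₀ A) M f = f i • LinearMap.id := by
          ext m
          simp
        rw [this, T.map_smul, T.map_id]
        simp
    rw [h, hz, _root_.map_zero, TensorProduct.tmul_zero]
  · intro z
    obtain ⟨t, w, rfl⟩ := hT.exists_finset_sum_map n (M := M) (Y := (ι →₀ A) ⊗[A] M)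
      (fun i => TensorProduct.mk A (ι →₀ A) M (Finsupp.single i 1)) (coordTensor ι M)
      exists_finset_sum_coordTensor z
    refine ⟨∑ i ∈ t, Finsupp.single i 1 ⊗ₜ w i, ?_⟩
    rw [_root_.map_sum]
    rfl

theorem annihilator_le_annihilator_tensorProduct (N M : Type) [AddCommGroup N] [Module A N]
    [AddCommGroup M] [Module A M] : annihilator A M ≤ annihilator A (N ⊗[A] M) := by
  intro r hr
  rw [mem_annihilator] at hr ⊢
  intro z
  induction z with
  | zero => simp
  | add x y hx hy => rw [smul_add, hx, hy, add_zero]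
  | tmul n m => rw [← TensorProduct.tmul_smul, hr, TensorProduct.tmul_zero]

variable [IsNoetherianRing A]

theorem IsFinitary.tensorMap_surjective (hT : T.IsFinitary) {n : ℕ} (N M : Type) [AddCommGroup N]
    [Module A N] [AddCommGroup M] [Module A M] [Module.Finite A M]
    (hM : supportDim A M < (n + 1 : ℕ)) : Function.Surjective (hT.tensorMap n N M) := by
  intro z
  have hp : Function.Surjective (Finsupp.linearCombination A (id : N → N)) :=
    fun x => ⟨Finsupp.single x 1, by simp⟩
  obtain ⟨w, rfl⟩ := hT.map_surjective hM (annihilator_le_annihilator_tensorProduct (N →₀ A) M)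
    ((Finsupp.linearCombination A (id : N → N)).rTensor M) (LinearMap.rTensor_surjective M hp) z
  obtain ⟨u, rfl⟩ := (hT.tensorMap_bijective_free n N M).2 w
  exact ⟨_, hT.tensorMap_rTensor n _ u⟩

theorem IsFinitary.tensorMap_injective_of_exact (hT : T.IsFinitary) {n : ℕ} {K F N : Type}
    [AddCommGroup K] [Module A K] [AddCommGroup F] [Module A F] [AddCommGroup N]
    [Module A N] (M : Type) [AddCommGroup M] [Module A M] [Module.Finite A M]
    (hM : supportDim A M < (n + 1 : ℕ)) (j : K →ₗ[A] F) (p : F →ₗ[A] N)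
    (hjp : Function.Exact j p) (hp : Function.Surjective p)
    (hF : Function.Injective (hT.tensorMap n F M)) : Function.Injective (hT.tensorMap n N M) := by
  rw [injective_iff_map_eq_zero]
  intro z hz
  obtain ⟨w, rfl⟩ := LinearMap.rTensor_surjective _ hp z
  rw [hT.tensorMap_rTensor] at hz
  obtain ⟨u, hu⟩ := (hT.exact_map_of_surjective hM
    (annihilator_le_annihilator_tensorProduct K M) (j.rTensor M) (p.rTensor M)
    (rTensor_exact M hjp hp) (LinearMap.rTensor_surjective M hp) _).1 hz
  obtain ⟨v, rfl⟩ := hT.tensorMap_surjective K M hM u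
  rw [← hT.tensorMap_rTensor] at hu
  rw [← hF hu]
  exact (rTensor_exact _ hjp hp).apply_apply_eq_zero v

theorem IsFinitary.tensorMap_bijective (hT : T.IsFinitary) {n : ℕ} (N M : Type) [AddCommGroup N]
    [Module A N] [AddCommGroup M] [Module A M] [Module.Finite A M]
    (hM : supportDim A M < (n + 1 : ℕ)) : Function.Bijective (hT.tensorMap n N M) :=
  ⟨hT.tensorMap_injective_of_exact M hM _ (Finsupp.linearCombination A (id : N → N))
    (LinearMap.exact_subtype_ker_map _) (fun x => ⟨Finsupp.single x 1, by simp⟩)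
    (hT.tensorMap_bijective_free n N M).1, hT.tensorMap_surjective N M hM⟩

end LocalCohomologyTheory

namespace localCohomology

variable {R : Type} [CommRing R] [IsNoetherianRing R] (a : Ideal R)

theorem theory_isFinitary : (theory a R).IsFinitary where
  map_add i _ _ _ _ _ _ f g := LinearMap.ext (liftMap_add a i f g)
  exists_submodule i N _ _ z := by
    obtain ⟨L, w, hL, hw⟩ := exists_finite_submodule (a := a) i (res R N) z
    exact ⟨L, w, hL, hw⟩

theorem nontrivial_theory_iff (S : Type) [CommRing S] [Algebra R S] (n : ℕ) (N : Type)
    [AddCommGroup N] [Module R N] [Module S N] [IsScalarTower R S N] :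
    Nontrivial ((theory a S).H n N) ↔ Nontrivial ((theory a R).H n N) := by
  let f : (res S N : ModuleCat.{0} R) →ₗ[R] (res R N : ModuleCat.{0} R) :=
    { AddEquiv.refl N with
      map_smul' := fun r x => algebraMap_smul S r (show N from x) }
  let e : (res S N : ModuleCat.{0} R) ≅ res R N :=
    (LinearEquiv.ofBijective f (AddEquiv.refl N).bijective).toModuleIso
  exact ((localCohomology a n).mapIso e).toLinearEquiv.toEquiv.nontrivial_congr

theorem nontrivial_theory_tensorProduct_iff (S : Type) [CommRing S] [Algebra R S] (n : ℕ)
    (M : Type) [AddCommGroup M] [Module R M] [Module.Finite R M]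
    (hM : supportDim R M < (n + 1 : ℕ)) :
    Nontrivial ((theory a S).H n (S ⊗[R] M)) ↔ Nontrivial (S ⊗[R] TopLC R a n M) := by
  rw [nontrivial_theory_iff, ← (Equiv.ofBijective _
    ((theory_isFinitary a).tensorMap_bijective S M hM)).nontrivial_congr]
  exact (LinearEquiv.lTensor S (theoryIso a n M)).toEquiv.nontrivial_congr

end localCohomology

section BaseChange

variable {R S : Type*} [CommRing R] [CommRing S] [Algebra R S]

theorem Module.mem_support_tensorProduct_iff (M : Type*) [AddCommGroup M] [Module R M]
    [Module.Finite R M] (q : PrimeSpectrum S) :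
    q ∈ Module.support S (S ⊗[R] M) ↔
      PrimeSpectrum.comap (algebraMap R S) q ∈ Module.support R M := by
  set P : PrimeSpectrum R := PrimeSpectrum.comap (algebraMap R S) q with hP
  have : q.asIdeal.LiesOver P.asIdeal := ⟨rfl⟩
  rw [mem_support_iff_nontrivial_residueField_tensorProduct,
    mem_support_iff_nontrivial_residueField_tensorProduct]
  have hPq : P.asIdeal = q.asIdeal.comap (algebraMap R S) := rfl
  let K := q.asIdeal.ResidueField
  let k := P.asIdeal.ResidueField
  let _ : Algebra k K :=
    (Ideal.ResidueField.map P.asIdeal q.asIdeal (algebraMap R S) hPq).toAlgebra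
  have : IsScalarTower R k K := IsScalarTower.of_algebraMap_eq fun r =>
    (IsScalarTower.algebraMap_apply R S K r).trans
      (Ideal.ResidueField.map_algebraMap P.asIdeal q.asIdeal (algebraMap R S) hPq r).symm
  rw [(AlgebraTensorModule.cancelBaseChange R S S K M).toEquiv.nontrivial_congr,
    ← (AlgebraTensorModule.cancelBaseChange R k k K M).toEquiv.nontrivial_congr,
    Module.FaithfullyFlat.nontrivial_tensorProduct_iff_right]

theorem Ideal.ringKrullDim_quotient_le_of_le {I J : Ideal R} (h : I ≤ J) :
    ringKrullDim (R ⧸ J) ≤ ringKrullDim (R ⧸ I) :=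
  ringKrullDim_le_of_surjective (Ideal.Quotient.factor h) (Ideal.Quotient.factor_surjective h)

theorem IsLocalRing.ringKrullDim_le_of_map_maximalIdeal_eq [IsLocalRing R] [IsLocalRing S]
    [IsNoetherianRing R] [IsNoetherianRing S]
    (h : IsLocalRing.maximalIdeal S = (IsLocalRing.maximalIdeal R).map (algebraMap R S)) :
    ringKrullDim S ≤ ringKrullDim R := by
  have : (IsLocalRing.maximalIdeal S).LiesOver (IsLocalRing.maximalIdeal R) := by
    refine ⟨?_⟩
    refine (IsLocalRing.maximalIdeal.isMaximal R).eq_of_le (Ideal.comap_ne_top _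
      (IsLocalRing.maximalIdeal.isMaximal S).ne_top) ?_
    rw [Ideal.under_def, ← Ideal.map_le_iff_le_comap, h]
  have h1 := Ideal.height_le_height_add_of_liesOver (IsLocalRing.maximalIdeal R)
    (IsLocalRing.maximalIdeal S)
  have h2 : (IsLocalRing.maximalIdeal S).map (Ideal.Quotient.mk
      ((IsLocalRing.maximalIdeal R).map (algebraMap R S))) = ⊥ := by
    rw [← h, Ideal.map_quotient_self]
  have : Nontrivial (S ⧸ (IsLocalRing.maximalIdeal R).map (algebraMap R S)) := by
    rw [← h]; exact Ideal.Quotient.nontrivial_iff.mpr (IsLocalRing.maximalIdeal.isMaximal S).ne_top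
  rw [h2, Ideal.height_bot, add_zero] at h1
  rw [← IsLocalRing.maximalIdeal_height_eq_ringKrullDim,
    ← IsLocalRing.maximalIdeal_height_eq_ringKrullDim]
  exact_mod_cast h1

theorem IsLocalRing.ringKrullDim_quotient_le_comap [IsLocalRing R] [IsLocalRing S]
    [IsNoetherianRing R] [IsNoetherianRing S]
    (h : IsLocalRing.maximalIdeal S = (IsLocalRing.maximalIdeal R).map (algebraMap R S))
    (q : Ideal S) [q.IsPrime] :
    ringKrullDim (S ⧸ q) ≤ ringKrullDim (R ⧸ q.comap (algebraMap R S)) := by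
  let : Algebra (R ⧸ q.comap (algebraMap R S)) (S ⧸ q) :=
    (Ideal.quotientMap q (algebraMap R S) le_rfl).toAlgebra
  have : Nontrivial (R ⧸ q.comap (algebraMap R S)) :=
    Ideal.Quotient.nontrivial_iff.mpr (Ideal.IsPrime.ne_top inferInstance)
  have : Nontrivial (S ⧸ q) := Ideal.Quotient.nontrivial_iff.mpr (Ideal.IsPrime.ne_top ‹_›)
  have : IsLocalRing (R ⧸ q.comap (algebraMap R S)) :=
    IsLocalRing.of_surjective' (Ideal.Quotient.mk _) Ideal.Quotient.mk_surjective
  have : IsLocalRing (S ⧸ q) :=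
    IsLocalRing.of_surjective' (Ideal.Quotient.mk _) Ideal.Quotient.mk_surjective
  refine IsLocalRing.ringKrullDim_le_of_map_maximalIdeal_eq ?_
  have hS : (IsLocalRing.maximalIdeal S).map (Ideal.Quotient.mk q) =
      IsLocalRing.maximalIdeal (S ⧸ q) := by
    refine IsLocalRing.eq_maximalIdeal (Ideal.IsMaximal.map_of_surjective_of_ker_le
      Ideal.Quotient.mk_surjective ?_)
    rw [Ideal.mk_ker]; exact IsLocalRing.le_maximalIdeal (Ideal.IsPrime.ne_top ‹_›)
  have hR : (IsLocalRing.maximalIdeal R).map (Ideal.Quotient.mk (q.comap (algebraMap R S))) =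
      IsLocalRing.maximalIdeal (R ⧸ q.comap (algebraMap R S)) := by
    refine IsLocalRing.eq_maximalIdeal (Ideal.IsMaximal.map_of_surjective_of_ker_le
      Ideal.Quotient.mk_surjective ?_)
    rw [Ideal.mk_ker]; exact IsLocalRing.le_maximalIdeal (Ideal.IsPrime.ne_top inferInstance)
  rw [← hS, ← hR, h, Ideal.map_map, Ideal.map_map]
  rfl

theorem IsLocalization.ringKrullDim_quotient_le_comap (W : Submonoid R) [IsLocalization W S]
    (Q : Ideal S) :
    ringKrullDim (S ⧸ Q) ≤ ringKrullDim (R ⧸ Q.comap (algebraMap R S)) := by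
  rw [ringKrullDim_quotient, ringKrullDim_quotient]
  let f : PrimeSpectrum.zeroLocus (Q : Set S) →
      PrimeSpectrum.zeroLocus ((Q.comap (algebraMap R S) : Ideal R) : Set R) :=
    fun x => ⟨PrimeSpectrum.comap (algebraMap R S) x.1, fun r hr => x.2 hr⟩
  refine Order.krullDim_le_of_strictMono f fun x y hxy => ?_
  refine lt_of_le_of_ne (fun r hr => hxy.le hr) fun e => hxy.ne (Subtype.ext ?_)
  exact PrimeSpectrum.localization_comap_injective S W (congrArg Subtype.val e)

end BaseChange

section FaithfullyFlat

variable {R : Type} [CommRing R] (p : PrimeSpectrum R) (S : Type) [CommRing S]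
  [Algebra R S] [Algebra (Localization.AtPrime p.asIdeal) S]
  [IsScalarTower R (Localization.AtPrime p.asIdeal) S]

theorem Module.mem_support_iff_nontrivial_of_faithfullyFlat
    [Module.FaithfullyFlat (Localization.AtPrime p.asIdeal) S]
    (X : Type) [AddCommGroup X] [Module R X] :
    p ∈ Module.support R X ↔ Nontrivial (S ⊗[R] X) := by
  rw [Module.mem_support_iff,
    (LocalizedModule.equivTensorProduct p.asIdeal.primeCompl X).nontrivial_congr,
    ← Module.FaithfullyFlat.nontrivial_tensorProduct_iff_right (Localization.AtPrime p.asIdeal)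
      (M := S),
    (AlgebraTensorModule.cancelBaseChange R (Localization.AtPrime p.asIdeal) S S X).nontrivial_congr]

end FaithfullyFlat

section Assh

variable {R : Type} [CommRing R] [IsNoetherianRing R] {N N' : Type} [AddCommGroup N] [Module R N]
  [Module.Finite R N] [AddCommGroup N'] [Module R N'] [Module.Finite R N']

theorem exists_mem_Assh_le {d : ℕ} (hN : moduleDim R N = d) {P : PrimeSpectrum R}
    (hP : P ∈ Module.support R N) (hd : (d : WithBot ℕ∞) ≤ ringKrullDim (R ⧸ P.asIdeal)) :
    ∃ P₀ ∈ Assh R N, P₀ ≤ P.asIdeal := by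
  rw [Module.mem_support_iff_of_finite] at hP
  obtain ⟨P₀, hP₀, hle⟩ := Ideal.exists_minimalPrimes_le hP
  refine ⟨P₀, ⟨Module.associatedPrimes.minimalPrimes_annihilator_subset_associatedPrimes _ _ hP₀, le_antisymm ?_ ?_⟩, hle⟩
  · exact Module.ringKrullDim_quotient_le_supportDim (q := ⟨P₀, hP₀.1.1⟩)
      (Module.mem_support_iff_of_finite.mpr hP₀.1.2)
  · rw [hN]
    exact hd.trans (Ideal.ringKrullDim_quotient_le_of_le hle)

omit [IsNoetherianRing R] in
theorem mem_support_of_mem_Assh {P₀ : Ideal R} (h : P₀ ∈ Assh R N) {P : PrimeSpectrum R}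
    (hle : P₀ ≤ P.asIdeal) : P ∈ Module.support R N :=
  Module.mem_support_iff_of_finite.mpr 
    ((Submodule.annihilator_top.symm.trans_le (IsAssociatedPrime.annihilator_le h.1)).trans hle)

theorem mem_support_of_Assh_subset (h : Assh R N ⊆ Assh R N') {d : ℕ} (hN : moduleDim R N = d)
    {P : PrimeSpectrum R} (hP : P ∈ Module.support R N)
    (hd : (d : WithBot ℕ∞) ≤ ringKrullDim (R ⧸ P.asIdeal)) : P ∈ Module.support R N' := by
  obtain ⟨P₀, h₀, hle⟩ := exists_mem_Assh_le hN hP hd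
  exact mem_support_of_mem_Assh (h h₀) hle

omit [Module.Finite R N'] in
theorem moduleDim_eq_of_Assh_subset (h : Assh R N ⊆ Assh R N') {d : ℕ}
    (hN : moduleDim R N = d) : moduleDim R N' = d := by
  obtain ⟨P, hP, hd⟩ := Module.exists_mem_support_ringKrullDim_eq (A := R) (N := N) (n := d) hN
  obtain ⟨P₀, h₀, -⟩ := exists_mem_Assh_le hN hP hd.ge
  rw [← (h h₀).2, h₀.2, hN]

end Assh

theorem ringKrullDim_quotient_eq_zero_iff {S : Type} [CommRing S] [IsLocalRing S] {J : Ideal S}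
    (hJ : J ≤ IsLocalRing.maximalIdeal S) :
    ringKrullDim (S ⧸ J) = 0 ↔
      ∀ Q : Ideal S, Q.IsPrime → J ≤ Q → Q = IsLocalRing.maximalIdeal S := by
  have hne : J ≠ ⊤ := fun h => (IsLocalRing.maximalIdeal.isMaximal S).ne_top (top_le_iff.mp (h ▸ hJ))
  have : Nontrivial (S ⧸ J) := Ideal.Quotient.nontrivial_iff.mpr hne
  have : IsLocalRing (S ⧸ J) :=
    IsLocalRing.of_surjective' (Ideal.Quotient.mk _) Ideal.Quotient.mk_surjective
  constructor
  · intro h Q hQ hJQ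
    have : Ring.KrullDimLE 0 (S ⧸ J) := by
      rw [Ring.krullDimLE_iff]; exact h.le
    have h1 : (Q.map (Ideal.Quotient.mk J)).IsPrime :=
      Ideal.map_isPrime_of_surjective Ideal.Quotient.mk_surjective (by rwa [Ideal.mk_ker])
    have h2 : (Q.map (Ideal.Quotient.mk J)).IsMaximal := Ideal.IsPrime.isMaximal' h1
    have h3 := Ideal.comap_isMaximal_of_surjective (Ideal.Quotient.mk J)
      Ideal.Quotient.mk_surjective (K := Q.map (Ideal.Quotient.mk J))
    rw [Ideal.comap_map_of_surjective _ Ideal.Quotient.mk_surjective, ← RingHom.ker_eq_comap_bot,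
      Ideal.mk_ker, sup_eq_left.mpr hJQ] at h3
    exact IsLocalRing.eq_maximalIdeal h3
  · intro h
    refine le_antisymm ?_ ringKrullDim_nonneg_of_nontrivial
    have : Ring.KrullDimLE 0 (S ⧸ J) := by
      refine Ring.KrullDimLE.mk₀ fun I hI => ?_
      have h1 := h (I.comap (Ideal.Quotient.mk J)) inferInstance (by
        intro x hx
        rw [Ideal.mem_comap, Ideal.Quotient.eq_zero_iff_mem.mpr hx]
        exact I.zero_mem)
      have h2 : (I.comap (Ideal.Quotient.mk J)).IsMaximal := h1 ▸ inferInstance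
      rw [← Ideal.map_comap_of_surjective _ Ideal.Quotient.mk_surjective I]
      exact Ideal.IsMaximal.map_of_surjective_of_ker_le Ideal.Quotient.mk_surjective
        (by rw [Ideal.mk_ker, h1]; exact hJ)
    exact Order.krullDimLE_iff _ _ |>.mp this

section CompletedLocalization

variable {R : Type} [CommRing R] [IsNoetherianRing R] (p : PrimeSpectrum R) (S : Type) [CommRing S]
  [IsNoetherianRing S] [IsLocalRing S]
  [Algebra R S] [Algebra (Localization.AtPrime p.asIdeal) S]
  [IsScalarTower R (Localization.AtPrime p.asIdeal) S]

omit [IsNoetherianRing R] [IsNoetherianRing S] [IsLocalRing S] in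
theorem comap_algebraMap_le_of_tower (q : Ideal S) [q.IsPrime] :
    q.comap (algebraMap R S) ≤ p.asIdeal := by
  intro r hr
  by_contra h
  have h1 : IsUnit (algebraMap R (Localization.AtPrime p.asIdeal) r) :=
    IsLocalization.map_units (M := p.asIdeal.primeCompl) _ ⟨r, h⟩
  have h2 := h1.map (algebraMap (Localization.AtPrime p.asIdeal) S)
  rw [← IsScalarTower.algebraMap_apply] at h2
  exact Ideal.IsPrime.ne_top ‹q.IsPrime› (Ideal.eq_top_of_isUnit_mem q hr h2)

variable (hm : IsLocalRing.maximalIdeal S =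
  (IsLocalRing.maximalIdeal (Localization.AtPrime p.asIdeal)).map
    (algebraMap (Localization.AtPrime p.asIdeal) S))

include hm

omit [IsNoetherianRing R] [IsNoetherianRing S] in
theorem comap_maximalIdeal_of_tower :
    (IsLocalRing.maximalIdeal S).comap (algebraMap R S) = p.asIdeal := by
  refine le_antisymm (comap_algebraMap_le_of_tower p S _) fun r hr => ?_
  rw [Ideal.mem_comap, IsScalarTower.algebraMap_apply R (Localization.AtPrime p.asIdeal) S, hm]
  exact Ideal.mem_map_of_mem _ ((IsLocalization.AtPrime.to_map_mem_maximal_iff _ p.asIdeal r).mpr hr)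

theorem ringKrullDim_quotient_le_comap_of_tower (q : Ideal S) [q.IsPrime] :
    ringKrullDim (S ⧸ q) ≤ ringKrullDim (R ⧸ q.comap (algebraMap R S)) := by
  have h := (IsLocalRing.ringKrullDim_quotient_le_comap hm q).trans
    (IsLocalization.ringKrullDim_quotient_le_comap (R := R) p.asIdeal.primeCompl _)
  rwa [Ideal.comap_comap, ← IsScalarTower.algebraMap_eq] at h

theorem supportDim_tensorProduct_lt (N : Type) [AddCommGroup N] [Module R N] [Module.Finite R N]
    {d : ℕ} (hN : moduleDim R N = d) : supportDim S (S ⊗[R] N) < (d + 1 : ℕ) := by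
  have htop : supportDim S (S ⊗[R] N) < ⊤ :=
    (supportDim_le_ringKrullDim S _).trans_lt ringKrullDim_lt_top
  push_cast
  rw [ENat.WithBot.lt_add_one_iff]
  rcases h : supportDim S (S ⊗[R] N) with _ | _ | n
  · exact bot_le
  · rw [h] at htop
    exact absurd htop (lt_irrefl _)
  · obtain ⟨q, hq, hqn⟩ := Module.exists_mem_support_ringKrullDim_eq (A := S) (n := n) h
    have h1 := ringKrullDim_quotient_le_comap_of_tower p S hm q.asIdeal
    rw [hqn] at h1
    rw [Module.mem_support_tensorProduct_iff] at hq
    exact h1.trans ((Module.ringKrullDim_quotient_le_supportDim hq).trans hN.le)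

theorem mem_support_topLC_iff [IsAdicComplete (IsLocalRing.maximalIdeal S) S]
    [Module.FaithfullyFlat (Localization.AtPrime p.asIdeal) S] (a : Ideal R) {d : ℕ}
    {N N' : Type} [AddCommGroup N] [Module R N]
    [Module.Finite R N] [AddCommGroup N'] [Module R N'] [Module.Finite R N']
    (hN : moduleDim R N = d) (h : Assh R N = Assh R N') :
    p ∈ Module.support R (TopLC R a d N) ↔
      Module.annihilator R N' ⊔ a ≤ p.asIdeal ∧
      ∃ q ∈ Module.support S (S ⊗[R] N'), ringKrullDim (S ⧸ q.asIdeal) = d ∧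
        ringKrullDim (S ⧸ (a.map (algebraMap R S) ⊔ q.asIdeal)) = 0 := by
  have hN' : moduleDim R N' = d := moduleDim_eq_of_Assh_subset h.subset hN
  have key (q : PrimeSpectrum S) (hq : ringKrullDim (S ⧸ q.asIdeal) = d) :
      q ∈ Module.support S (S ⊗[R] N) ↔ q ∈ Module.support S (S ⊗[R] N') := by
    have hd := ringKrullDim_quotient_le_comap_of_tower p S hm q.asIdeal
    rw [hq] at hd
    rw [Module.mem_support_tensorProduct_iff, Module.mem_support_tensorProduct_iff]
    exact ⟨fun hs => mem_support_of_Assh_subset h.subset hN hs hd,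
      fun hs => mem_support_of_Assh_subset h.superset hN' hs hd⟩
  have haS (hap : a ≤ p.asIdeal) : a.map (algebraMap R S) ≤ IsLocalRing.maximalIdeal S := by
    rw [Ideal.map_le_iff_le_comap, comap_maximalIdeal_of_tower p S hm]
    exact hap
  have htop (hap : a ≤ p.asIdeal) : p ∈ Module.support R (TopLC R a d N) ↔
      ∃ q ∈ Module.support S (S ⊗[R] N'), ringKrullDim (S ⧸ q.asIdeal) = d ∧
        ringKrullDim (S ⧸ (a.map (algebraMap R S) ⊔ q.asIdeal)) = 0 := by
    have hlt : supportDim R N < (d + 1 : ℕ) := by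
      push_cast
      rw [ENat.WithBot.lt_add_one_iff]
      exact hN.le
    rw [Module.mem_support_iff_nontrivial_of_faithfullyFlat p S,
      ← localCohomology.nontrivial_theory_tensorProduct_iff a S d N hlt,
      (localCohomology.theory a S).nontrivial_top_iff (haS hap) d _
        (supportDim_tensorProduct_lt p S hm N hN)]
    refine exists_congr fun q => ?_
    have hJ : a.map (algebraMap R S) ⊔ q.asIdeal ≤ IsLocalRing.maximalIdeal S :=
      sup_le (haS hap) (IsLocalRing.le_maximalIdeal q.2.ne_top)
    rw [ringKrullDim_quotient_eq_zero_iff hJ]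
    exact ⟨fun hq => ⟨(key q hq.2.1).1 hq.1, hq.2⟩, fun hq => ⟨(key q hq.2.1).2 hq.1, hq.2⟩⟩
  constructor
  · intro hp
    have hap : a ≤ p.asIdeal := by
      obtain ⟨z, hz⟩ := Module.mem_support_iff'.mp hp
      intro r hr
      by_contra hrp
      obtain ⟨n, hn⟩ := (localCohomology.theory a R).torsion d N
        ((localCohomology.theoryIso a d N).symm z)
      refine hz (r ^ n) (fun hmem => hrp (p.2.mem_of_pow_mem n hmem)) ?_
      have := hn (r ^ n) (Ideal.pow_mem_pow (Ideal.mem_map_of_mem (algebraMap R R) hr) n)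
      rw [← _root_.map_smul, LinearEquiv.map_eq_zero_iff] at this
      exact this
    obtain ⟨q, hq, hq'⟩ := (htop hap).mp hp
    refine ⟨sup_le ?_ hap, q, hq, hq'⟩
    rw [Module.mem_support_tensorProduct_iff] at hq
    exact (Module.annihilator_le_of_mem_support hq).trans
      (comap_algebraMap_le_of_tower p S q.asIdeal)
  · rintro ⟨hap, hq⟩
    exact (htop (le_sup_right.trans hap)).mpr hq

end CompletedLocalization

theorem finite_support_topLC {R : Type} [CommRing R] [IsNoetherianRing R] (a : Ideal R) {d : ℕ}
    (N : Type) [AddCommGroup N] [Module R N] [Module.Finite R N] (hN : moduleDim R N = d) :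
    (Module.support R (TopLC R a d N)).Finite := by
  rw [← (localCohomology.theoryIso a d N).support_eq]
  refine (localCohomology.theory a R).finite_support_of_supportDim_lt d N ?_
  push_cast
  rw [ENat.WithBot.lt_add_one_iff]
  exact hN.le

theorem support_topLC_eq_Pset {R : Type} [CommRing R] [IsNoetherianRing R] (a : Ideal R) {d : ℕ}
    {N N' : Type} [AddCommGroup N] [Module R N] [Module.Finite R N] [AddCommGroup N'] [Module R N']
    [Module.Finite R N'] (hN : moduleDim R N = d) (h : Assh R N = Assh R N') :
    Module.support R (TopLC R a d N) = Pset R a N' d := by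
  ext p
  let A := Localization.AtPrime p.asIdeal
  let S := AdicCompletion (IsLocalRing.maximalIdeal A) A
  have : IsScalarTower R A S := inferInstance
  have : Module.FaithfullyFlat A S := Module.FaithfullyFlat.of_flat_of_isLocalHom
  rw [mem_support_topLC_iff p S AdicCompletion.maximalIdeal_eq_map a hN h]
  have e : S ⊗[R] N' ≃ₗ[S] AdicCompletion (IsLocalRing.maximalIdeal A)
      (LocalizedModule p.asIdeal.primeCompl N') :=
    (AlgebraTensorModule.cancelBaseChange R A S S N').symm ≪≫ₗ
      (AlgebraTensorModule.congr (LinearEquiv.refl S S)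
        (LocalizedModule.equivTensorProduct p.asIdeal.primeCompl N').symm) ≪≫ₗ
      AdicCompletion.ofTensorProductEquivOfFiniteNoetherian _ _
  rw [e.support_eq, IsScalarTower.algebraMap_eq R A S, ← Ideal.map_map]
  rfl

/-- For ideals `a`, `b` of a Noetherian ring `R` with `dim R/b = d` finite and
any finitely generated module `M` with `Assh_R M = Assh_R(R/b)`, one has
`Supp_R H^d_a(M) = P_{a,R/b}`; in particular `P_{a,R/b}` is finite. -/
theorem stmt_7 (R : Type) [CommRing R] [IsNoetherianRing R] (a b : Ideal R)
    (d : ℕ) (hd : ringKrullDim (R ⧸ b) = (d : WithBot ℕ∞))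
    (M : Type) [AddCommGroup M] [Module R M] [Module.Finite R M]
    (hassh : Assh R M = Assh R (R ⧸ b)) :
    Module.support R (TopLC R a d M) = Pset R a (R ⧸ b) d ∧
      (Pset R a (R ⧸ b) d).Finite := by
  have hb : moduleDim R (R ⧸ b) = d := (supportDim_quotient_eq_ringKrullDim b).trans hd
  have hM : moduleDim R M = d := moduleDim_eq_of_Assh_subset hassh.symm.subset hb
  have h := support_topLC_eq_Pset a hM hassh
  exact ⟨h, h ▸ finite_support_topLC a M hM⟩
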